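/- Let 1 < p ≤ q < ∞, let l₁,…,lₙ be positive integers, let α = (α₁,…,αₙ) be a multi-index, set ϰ = Σₖ (αₖ + 1/p − 1/q)/lₖ, and assume ϰ ≤ 1 and 0 ≤ μ ≤ 1 − ϰ. Then there exists C_μ > 0 such that for every complex-valued Schwartz function u ∈ S(ℝⁿ; ℂ), every h > 0 and every t ∈ (0,∞)ⁿ: (∏ₖ tₖ^{(αₖ + 1/p − 1/q)/lₖ}) ‖D^α u‖_{L^q(ℝⁿ)} ≤ C_μ [ h^μ ( ‖u‖_{L^p(ℝⁿ)} + Σₖ tₖ ‖∂ₖ^{lₖ} u‖_{L^p(ℝⁿ)} ) + h^{−(1−μ)} ‖u‖_{L^p(ℝⁿ)} ]. -/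

import Mathlib

open MeasureTheory

noncomputable section

/-- `i`-th classical partial derivative in the `k`-th coordinate of a Schwartz function. -/
def pdIter (n : ℕ) {H : Type*} [NormedAddCommGroup H] [NormedSpace ℝ H] (k : Fin n)
    (i : ℕ) (u : SchwartzMap (Fin n → ℝ) H) : SchwartzMap (Fin n → ℝ) H :=
  (fun v => LineDeriv.lineDerivOpCLM ℝ (SchwartzMap (Fin n → ℝ) H)
    (Pi.single k 1 : Fin n → ℝ) v)^[i] u

/-- The mixed partial derivative `D^α u = ∂₁^{α₁} ⋯ ∂ₙ^{αₙ} u` of a Schwartz function. -/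
def Dmix (n : ℕ) {H : Type*} [NormedAddCommGroup H] [NormedSpace ℝ H] (α : Fin n → ℕ)
    (u : SchwartzMap (Fin n → ℝ) H) : SchwartzMap (Fin n → ℝ) H :=
  (List.finRange n).foldl (fun v k => pdIter n k (α k) v) u

/-- The `L^p(ℝⁿ)` norm `(∫ ‖f x‖ ^ p dx) ^ (1/p)` for a real exponent `p`. -/
def LpN (n : ℕ) {H : Type*} [NormedAddCommGroup H] (p : ℝ) (f : (Fin n → ℝ) → H) : ℝ :=
  (∫ x, ‖f x‖ ^ p) ^ (1 / p)

namespace Anisotropic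

section

open scoped ENNReal

variable {n : ℕ} {E : Type*} [NormedAddCommGroup E]

/-- Bounded integrable functions. -/
def Nice (f : (Fin n → ℝ) → E) : Prop := Integrable f ∧ ∃ M, ∀ x, ‖f x‖ ≤ M

theorem Nice.neg_arg {f : (Fin n → ℝ) → E} (hf : Nice f) : Nice fun x => f (-x) :=
  ⟨hf.1.comp_neg, hf.2.imp fun _ h x => h (-x)⟩

theorem Nice.add {f g : (Fin n → ℝ) → E} (hf : Nice f) (hg : Nice g) :
    Nice fun x => f x + g x := by
  obtain ⟨M, hM⟩ := hf.2
  obtain ⟨N, hN⟩ := hg.2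
  exact ⟨hf.1.add hg.1, M + N, fun x => (norm_add_le _ _).trans (add_le_add (hM x) (hN x))⟩

theorem Nice.sum {ι : Type*} {f : ι → (Fin n → ℝ) → E} (s : Finset ι)
    (hf : ∀ i ∈ s, Nice (f i)) : Nice fun x => ∑ i ∈ s, f i x := by
  classical
  induction s using Finset.induction_on with
  | empty => exact ⟨by simp, 0, by simp⟩
  | insert a s ha ih =>
    simp_rw [Finset.sum_insert ha]
    exact (hf a (by simp)).add (ih fun i hi => hf i (by simp [hi]))

theorem Nice.lintegral_rpow_lt_top {f : (Fin n → ℝ) → E} (hf : Nice f) {p : ℝ} (hp : 1 ≤ p) :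
    ∫⁻ x, ‖f x‖ₑ ^ p < ∞ := by
  obtain ⟨M, hM⟩ := hf.2
  calc ∫⁻ x, ‖f x‖ₑ ^ p ≤ ∫⁻ x, (ENNReal.ofReal M) ^ (p - 1) * ‖f x‖ₑ := by
        refine lintegral_mono fun x => ?_
        calc ‖f x‖ₑ ^ p = ‖f x‖ₑ ^ (p - 1) * ‖f x‖ₑ := by
              nth_rewrite 3 [← ENNReal.rpow_one ‖f x‖ₑ]
              rw [← ENNReal.rpow_add_of_nonneg _ _ (by linarith) zero_le_one, sub_add_cancel]
          _ ≤ _ := by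
              gcongr
              rw [← ofReal_norm]
              exact ENNReal.ofReal_le_ofReal (hM x)
    _ = (ENNReal.ofReal M) ^ (p - 1) * ∫⁻ x, ‖f x‖ₑ :=
        lintegral_const_mul' _ _ (ENNReal.rpow_ne_top_of_nonneg (by linarith) ENNReal.ofReal_ne_top)
    _ < ∞ := ENNReal.mul_lt_top
        (ENNReal.rpow_lt_top_of_nonneg (by linarith) ENNReal.ofReal_ne_top) hf.1.2

theorem Nice.memLp {f : (Fin n → ℝ) → E} (hf : Nice f) {p : ℝ} (hp : 1 ≤ p) :
    MemLp f (ENNReal.ofReal p) := by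
  have hp0 : ENNReal.ofReal p ≠ 0 := by simp; linarith
  refine ⟨hf.1.aestronglyMeasurable, ?_⟩
  rw [eLpNorm_lt_top_iff_lintegral_rpow_enorm_lt_top hp0 ENNReal.ofReal_ne_top,
    ENNReal.toReal_ofReal (by linarith)]
  exact hf.lintegral_rpow_lt_top hp

variable [NormedSpace ℝ E]

/-- Convolution of a real kernel with a vector-valued function. -/
def cv (K : (Fin n → ℝ) → ℝ) (f : (Fin n → ℝ) → E) (x : Fin n → ℝ) : E := ∫ y, K (x - y) • f y

theorem cv_eq (K : (Fin n → ℝ) → ℝ) (f : (Fin n → ℝ) → E) (x : Fin n → ℝ) :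
    cv K f x = ∫ y, K y • f (x - y) := by
  have := integral_sub_left_eq_self (fun y => K y • f (x - y)) volume x
  rw [← this]
  simp [cv]

theorem Nice.integrand {K : (Fin n → ℝ) → ℝ} {f : (Fin n → ℝ) → E} (hK : Nice K) (hf : Nice f)
    (x : Fin n → ℝ) : Integrable (fun y => K (x - y) • f y) := by
  obtain ⟨M, hM⟩ := hK.2
  exact hf.1.bdd_smul M (hK.1.comp_sub_left x).aestronglyMeasurable
    (Filter.Eventually.of_forall fun y => hM _)

theorem Nice.smul {f : (Fin n → ℝ) → E} (hf : Nice f) (c : ℝ) : Nice fun x => c • f x := by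
  obtain ⟨M, hM⟩ := hf.2
  refine ⟨hf.1.smul c, ‖c‖ * M, fun x => ?_⟩
  rw [norm_smul]
  exact mul_le_mul_of_nonneg_left (hM x) (norm_nonneg _)

theorem Nice.sub {f g : (Fin n → ℝ) → E} (hf : Nice f) (hg : Nice g) :
    Nice fun x => f x - g x := by
  simpa [sub_eq_add_neg] using hf.add (hg.smul (-1))

theorem Nice.integrable_prod {K : (Fin n → ℝ) → ℝ} {f : (Fin n → ℝ) → E} (hK : Nice K)
    (hf : Nice f) : Integrable (fun z : (Fin n → ℝ) × (Fin n → ℝ) => K (z.1 - z.2) • f z.2)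
      (volume.prod volume) := by
  have := Integrable.convolution_integrand (ContinuousLinearMap.lsmul ℝ ℝ).flip hf.1 hK.1
  simpa using this

theorem Nice.cv {K : (Fin n → ℝ) → ℝ} {f : (Fin n → ℝ) → E} (hK : Nice K) (hf : Nice f) :
    Nice (cv K f) := by
  refine ⟨(hK.integrable_prod hf).integral_prod_left, ?_⟩
  obtain ⟨M, hM⟩ := hf.2
  refine ⟨(∫ y, ‖K y‖) * M, fun x => ?_⟩
  rw [cv_eq, ← integral_mul_const]
  refine norm_integral_le_of_norm_le (hK.1.norm.mul_const M) (Filter.Eventually.of_forall ?_)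
  intro y
  rw [norm_smul]
  exact mul_le_mul_of_nonneg_left (hM _) (norm_nonneg _)

theorem cv_comm (A B : (Fin n → ℝ) → ℝ) : cv A B = cv B A := by
  ext x
  rw [cv_eq, cv]
  simp [mul_comm]

theorem cv_assoc {A B : (Fin n → ℝ) → ℝ} {f : (Fin n → ℝ) → E} (hA : Nice A) (hB : Nice B)
    (hf : Nice f) : cv A (cv B f) = cv (cv A B) f := by
  ext x
  by_cases hE : CompleteSpace E
  swap
  · simp [cv, integral, hE]
  have hint : Integrable (fun z : (Fin n → ℝ) × (Fin n → ℝ) => (A (x - z.1) * B (z.1 - z.2)) • f z.2)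
      (volume.prod volume) := by
    obtain ⟨M, hM⟩ := hA.2
    have := (hB.integrable_prod hf).bdd_smul (φ := fun z => A (x - z.1)) M
      ((hA.1.comp_sub_left x).aestronglyMeasurable.comp_fst)
      (Filter.Eventually.of_forall fun y => hM _)
    convert this using 2 with z
    simp [smul_smul]
  calc cv A (cv B f) x = ∫ y, ∫ z, (A (x - y) * B (y - z)) • f z := by
        simp only [cv, ← integral_smul, smul_smul]
    _ = ∫ z, ∫ y, (A (x - y) * B (y - z)) • f z := integral_integral_swap hint
    _ = _ := by
        simp only [cv]
        congr 1
        ext z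
        rw [integral_smul_const]
        congr 1
        rw [← integral_add_right_eq_self (fun y => A (x - y) * B (y - z)) z]
        simp only [add_sub_cancel_right, smul_eq_mul, sub_sub, add_comm z]

theorem cv_left_comm {A B : (Fin n → ℝ) → ℝ} {f : (Fin n → ℝ) → E} (hA : Nice A) (hB : Nice B)
    (hf : Nice f) : cv A (cv B f) = cv B (cv A f) := by
  rw [cv_assoc hA hB hf, cv_assoc hB hA hf, cv_comm A B]

theorem cv_add_left {A B : (Fin n → ℝ) → ℝ} {f : (Fin n → ℝ) → E} (hA : Nice A) (hB : Nice B)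
    (hf : Nice f) (x : Fin n → ℝ) : cv (fun x => A x + B x) f x = cv A f x + cv B f x := by
  simp only [cv, add_smul]
  exact integral_add (hA.integrand hf x) (hB.integrand hf x)

theorem cv_sub_left {A B : (Fin n → ℝ) → ℝ} {f : (Fin n → ℝ) → E} (hA : Nice A) (hB : Nice B)
    (hf : Nice f) (x : Fin n → ℝ) : cv (fun x => A x - B x) f x = cv A f x - cv B f x := by
  simp only [cv, sub_smul]
  exact integral_sub (hA.integrand hf x) (hB.integrand hf x)

theorem cv_add_right {A : (Fin n → ℝ) → ℝ} {f g : (Fin n → ℝ) → E} (hA : Nice A) (hf : Nice f)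
    (hg : Nice g) (x : Fin n → ℝ) : cv A (fun x => f x + g x) x = cv A f x + cv A g x := by
  simp only [cv, smul_add]
  exact integral_add (hA.integrand hf x) (hA.integrand hg x)

theorem cv_sum_left {ι : Type*} (s : Finset ι) {A : ι → (Fin n → ℝ) → ℝ} {f : (Fin n → ℝ) → E}
    (hA : ∀ i ∈ s, Nice (A i)) (hf : Nice f) (x : Fin n → ℝ) :
    cv (fun x => ∑ i ∈ s, A i x) f x = ∑ i ∈ s, cv (A i) f x := by
  simp only [cv, Finset.sum_smul]
  exact integral_finsetSum _ fun i hi => (hA i hi).integrand hf x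

theorem cv_sum_right {ι : Type*} (s : Finset ι) {A : (Fin n → ℝ) → ℝ} {f : ι → (Fin n → ℝ) → E}
    (hA : Nice A) (hf : ∀ i ∈ s, Nice (f i)) (x : Fin n → ℝ) :
    cv A (fun x => ∑ i ∈ s, f i x) x = ∑ i ∈ s, cv A (f i) x := by
  simp only [cv, Finset.smul_sum]
  exact integral_finsetSum _ fun i hi => hA.integrand (hf i hi) x

theorem cv_smul_right (A : (Fin n → ℝ) → ℝ) (f : (Fin n → ℝ) → E) (c : ℝ) (x : Fin n → ℝ) :
    cv A (fun x => c • f x) x = c • cv A f x := by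
  simp only [cv, smul_comm _ c, integral_smul]

theorem continuous_cv {K : (Fin n → ℝ) → ℝ} {f : (Fin n → ℝ) → E} (hK : Nice K)
    (hKc : Continuous K) (hf : Nice f) : Continuous (cv K f) := by
  obtain ⟨M, hM⟩ := hK.2
  refine continuous_of_dominated (bound := fun y => M * ‖f y‖)
    (fun x => (hK.integrand hf x).aestronglyMeasurable) (fun x => ?_) (hf.1.norm.const_mul M) ?_
  · refine Filter.Eventually.of_forall fun y => ?_
    rw [norm_smul]
    exact mul_le_mul_of_nonneg_right (hM _) (norm_nonneg _)
  · exact Filter.Eventually.of_forall fun y => by fun_prop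

theorem integral_cv_mul {K : (Fin n → ℝ) → ℝ} {f g : (Fin n → ℝ) → ℂ} (hK : Nice K)
    (hf : Nice f) (hg : Nice g) :
    ∫ x, cv K f x * g x = ∫ x, f x * cv (fun z => K (-z)) g x := by
  have hint : Integrable (fun z : (Fin n → ℝ) × (Fin n → ℝ) => K (z.1 - z.2) • f z.2 * g z.1)
      (volume.prod volume) := by
    obtain ⟨M, hM⟩ := hg.2
    exact (hK.integrable_prod hf).mul_bdd (c := M) (hg.1.aestronglyMeasurable.comp_fst)
      (Filter.Eventually.of_forall fun y => hM _)
  calc ∫ x, cv K f x * g x = ∫ x, ∫ y, K (x - y) • f y * g x := by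
        simp only [cv, ← integral_mul_const]
    _ = ∫ y, ∫ x, K (x - y) • f y * g x := integral_integral_swap hint
    _ = _ := by
        simp only [cv, ← integral_const_mul]
        congr 1; ext y; congr 1; ext x
        simp only [neg_sub, Complex.real_smul]
        ring

theorem enorm_cv_le (K : (Fin n → ℝ) → ℝ) (f : (Fin n → ℝ) → E) (x : Fin n → ℝ) :
    ‖cv K f x‖ₑ ≤ ∫⁻ y, ‖K (x - y)‖ₑ * ‖f y‖ₑ := by
  refine (enorm_integral_le_lintegral_enorm _).trans (le_of_eq ?_)
  simp [enorm_smul]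

theorem enorm_cv_rpow_le {K : (Fin n → ℝ) → ℝ} {f : (Fin n → ℝ) → E} (hK : Nice K) (hf : Nice f)
    {p : ℝ} (hp : 1 < p) (x : Fin n → ℝ) :
    ‖cv K f x‖ₑ ^ p ≤ (∫⁻ y, ‖K y‖ₑ) ^ (p - 1) * ∫⁻ y, ‖K (x - y)‖ₑ * ‖f y‖ₑ ^ p := by
  have hp0 : 0 < p := by linarith
  have hpq : (p.conjExponent).HolderConjugate p := (Real.HolderConjugate.conjExponent hp).symm
  have hm : AEMeasurable (fun y => ‖K (x - y)‖ₑ) :=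
    (hK.1.comp_sub_left x).aestronglyMeasurable.enorm
  have hm' : AEMeasurable (fun y => ‖f y‖ₑ) := hf.1.aestronglyMeasurable.enorm
  have h1 := ENNReal.lintegral_mul_le_Lp_mul_Lq volume hpq
    (f := fun y => ‖K (x - y)‖ₑ ^ (1 / p.conjExponent))
    (g := fun y => ‖K (x - y)‖ₑ ^ (1 / p) * ‖f y‖ₑ) (hm.pow_const _) ((hm.pow_const _).mul hm')
  have hc0 : p.conjExponent ≠ 0 := hpq.ne_zero
  have e1 : ∀ y, ‖K (x - y)‖ₑ ^ (1 / p.conjExponent) * (‖K (x - y)‖ₑ ^ (1 / p) * ‖f y‖ₑ)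
      = ‖K (x - y)‖ₑ * ‖f y‖ₑ := by
    intro y
    rw [← mul_assoc, ← ENNReal.rpow_add_of_nonneg]
    · have : 1 / p.conjExponent + 1 / p = 1 := by simpa using hpq.inv_add_inv_eq_one
      rw [this, ENNReal.rpow_one]
    · have := hpq.pos; positivity
    · positivity
  simp only [Pi.mul_apply, e1, ← ENNReal.rpow_mul, one_div_mul_cancel hc0,
    one_div_mul_cancel hp0.ne',
    ENNReal.rpow_one, ENNReal.mul_rpow_of_nonneg _ _ hp0.le] at h1
  calc ‖cv K f x‖ₑ ^ p ≤ _ := ENNReal.rpow_le_rpow ((enorm_cv_le K f x).trans h1) hp0.le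
    _ = _ := by
      rw [ENNReal.mul_rpow_of_nonneg _ _ hp0.le, ← ENNReal.rpow_mul, ← ENNReal.rpow_mul,
        one_div_mul_cancel hp0.ne', ENNReal.rpow_one]
      congr 1
      rw [lintegral_sub_left_eq_self (fun y => ‖K y‖ₑ) x]
      congr 1
      rw [Real.conjExponent]
      field_simp

theorem lintegral_cv_rpow_le {K : (Fin n → ℝ) → ℝ} {f : (Fin n → ℝ) → E} (hK : Nice K)
    (hf : Nice f) {p : ℝ} (hp : 1 < p) :
    ∫⁻ x, ‖cv K f x‖ₑ ^ p ≤ (∫⁻ y, ‖K y‖ₑ) ^ p * ∫⁻ y, ‖f y‖ₑ ^ p := by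
  calc ∫⁻ x, ‖cv K f x‖ₑ ^ p
      ≤ ∫⁻ x, (∫⁻ y, ‖K y‖ₑ) ^ (p - 1) * ∫⁻ y, ‖K (x - y)‖ₑ * ‖f y‖ₑ ^ p :=
        lintegral_mono fun x => enorm_cv_rpow_le hK hf hp x
    _ = (∫⁻ y, ‖K y‖ₑ) ^ (p - 1) * ∫⁻ x, ∫⁻ y, ‖K (x - y)‖ₑ * ‖f y‖ₑ ^ p := by
        refine lintegral_const_mul' _ _ ?_
        exact ENNReal.rpow_ne_top_of_nonneg (by linarith) hK.1.2.ne
    _ = (∫⁻ y, ‖K y‖ₑ) ^ (p - 1) * ∫⁻ y, ∫⁻ x, ‖K (x - y)‖ₑ * ‖f y‖ₑ ^ p := by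
        rw [lintegral_lintegral_swap]
        have h1 : AEStronglyMeasurable (fun z : (Fin n → ℝ) × (Fin n → ℝ) => K (z.1 - z.2))
            (volume.prod volume) :=
          hK.1.aestronglyMeasurable.comp_quasiMeasurePreserving
            (quasiMeasurePreserving_sub_of_right_invariant volume volume)
        exact h1.enorm.mul (hf.1.aestronglyMeasurable.comp_snd.enorm.pow_const _)
    _ = (∫⁻ y, ‖K y‖ₑ) ^ (p - 1) * ∫⁻ y, (∫⁻ x, ‖K x‖ₑ) * ‖f y‖ₑ ^ p := by
        congr 1
        refine lintegral_congr fun y => ?_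
        rw [lintegral_mul_const'' _
          ((hK.1.comp_sub_right y).aestronglyMeasurable.enorm),
          lintegral_sub_right_eq_self (fun x => ‖K x‖ₑ) y]
    _ = _ := by
        rw [lintegral_const_mul' _ _ hK.1.2.ne, ← mul_assoc]
        congr 1
        nth_rewrite 2 [← ENNReal.rpow_one (∫⁻ y, ‖K y‖ₑ)]
        rw [← ENNReal.rpow_add_of_nonneg _ _ (by linarith) zero_le_one]
        congr 1; ring

end

section

open scoped ENNReal NNReal

variable {n : ℕ} {E : Type*} [NormedAddCommGroup E] [NormedSpace ℝ E]

theorem measurableEmbedding_mul {c : Fin n → ℝ} (hc : ∀ k, 0 < c k) :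
    MeasurableEmbedding (fun x : Fin n → ℝ => c * x) := by
  refine Continuous.measurableEmbedding (by fun_prop) fun x y hxy => ?_
  ext k
  have := congrFun hxy k
  simpa [(hc k).ne'] using this

theorem map_mul_volume {c : Fin n → ℝ} (hc : ∀ k, 0 < c k) :
    Measure.map (fun x : Fin n → ℝ => c * x) volume = ENNReal.ofReal (∏ k, c k)⁻¹ • volume := by
  have hpos : 0 < ∏ k, c k := Finset.prod_pos fun k _ => hc k
  have hdet : (Matrix.diagonal c).det = ∏ k, c k := Matrix.det_diagonal
  have h := Real.smul_map_diagonal_volume_pi (D := c) (by rw [hdet]; exact hpos.ne')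
  rw [hdet, abs_of_pos hpos] at h
  have he : (⇑(Matrix.toLin' (Matrix.diagonal c)) : (Fin n → ℝ) → Fin n → ℝ) = fun x => c * x := by
    ext x k
    simp [Matrix.mulVec_diagonal]
  rw [he] at h
  nth_rewrite 2 [← h]
  rw [smul_smul, ← ENNReal.ofReal_mul (by positivity), inv_mul_cancel₀ hpos.ne']
  simp

theorem lintegral_comp_mul {c : Fin n → ℝ} (hc : ∀ k, 0 < c k) (g : (Fin n → ℝ) → ℝ≥0∞) :
    ∫⁻ x, g (c * x) = ENNReal.ofReal (∏ k, c k)⁻¹ * ∫⁻ x, g x := by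
  rw [← (measurableEmbedding_mul hc).lintegral_map, map_mul_volume hc, lintegral_smul_measure,
    smul_eq_mul]

theorem integral_comp_mul {c : Fin n → ℝ} (hc : ∀ k, 0 < c k) (g : (Fin n → ℝ) → E) :
    ∫ x, g (c * x) = (∏ k, c k)⁻¹ • ∫ x, g x := by
  have hpos : 0 < ∏ k, c k := Finset.prod_pos fun k _ => hc k
  rw [← (measurableEmbedding_mul hc).integral_map, map_mul_volume hc, integral_smul_measure,
    ENNReal.toReal_ofReal (by positivity)]

theorem integrable_comp_mul {F : Type*} [NormedAddCommGroup F] {c : Fin n → ℝ}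
    (hc : ∀ k, 0 < c k) {g : (Fin n → ℝ) → F} (hg : Integrable g) : Integrable fun x => g (c * x) := by
  have := (measurableEmbedding_mul hc).integrable_map_iff (μ := volume) (g := g)
  refine this.1 ?_
  rw [map_mul_volume hc]
  exact hg.smul_measure ENNReal.ofReal_ne_top

/-- The dyadic anisotropic dilation factors. -/
def ds (w : Fin n → ℕ) (j : ℤ) : Fin n → ℝ := fun k => (2 : ℝ) ^ (j * w k)

/-- The homogeneous dimension of the dilations. -/
def hdim (w : Fin n → ℕ) : ℕ := ∑ k, w k

variable (w : Fin n → ℕ)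

theorem ds_pos (j : ℤ) (k : Fin n) : 0 < ds w j k := by unfold ds; positivity

theorem prod_ds (j : ℤ) : ∏ k, ds w j k = (2 : ℝ) ^ (j * hdim w) := by
  simp only [ds, hdim]
  rw [Nat.cast_sum, Finset.mul_sum]
  generalize (Finset.univ : Finset (Fin n)) = s
  induction s using Finset.induction_on with
  | empty => simp
  | insert a s ha ih => rw [Finset.prod_insert ha, Finset.sum_insert ha, zpow_add₀ two_ne_zero, ih]

theorem ds_add (i j : ℤ) : ds w (i + j) = ds w i * ds w j := by
  ext k
  simp [ds, add_mul, zpow_add₀]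

theorem ds_zero : ds w 0 = 1 := by
  ext k
  simp [ds]

theorem ds_neg_mul (j : ℤ) (x : Fin n → ℝ) : ds w (-j) * (ds w j * x) = x := by
  rw [← mul_assoc, ← ds_add, neg_add_cancel, ds_zero, one_mul]

/-- The `L¹`-normalised dilation of a kernel to scale `2 ^ j`. -/
def dil (j : ℤ) (κ : (Fin n → ℝ) → ℝ) (x : Fin n → ℝ) : ℝ :=
  (2 : ℝ) ^ (-(j * hdim w)) * κ (ds w (-j) * x)

theorem dil_dil (i j : ℤ) (κ : (Fin n → ℝ) → ℝ) : dil w j (dil w i κ) = dil w (i + j) κ := by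
  ext x
  simp only [dil]
  rw [← mul_assoc, ← mul_assoc, ← zpow_add₀ two_ne_zero, ← ds_add, neg_add]
  congr 2
  ring

theorem dil_add (j : ℤ) (A B : (Fin n → ℝ) → ℝ) :
    dil w j (fun x => A x + B x) = fun x => dil w j A x + dil w j B x := by
  ext x; simp [dil, mul_add]

theorem cv_dil_eq (j : ℤ) (κ : (Fin n → ℝ) → ℝ) (f : (Fin n → ℝ) → E) (x : Fin n → ℝ) :
    cv (dil w j κ) f x = ∫ z, κ z • f (x - ds w j * z) := by
  rw [cv_eq]
  have h := integral_comp_mul (ds_pos w j) fun y => dil w j κ y • f (x - y)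
  rw [prod_ds, ← zpow_neg] at h
  have h2 := congrArg (fun v => ((2 : ℝ) ^ (j * hdim w)) • v) h
  simp only [smul_smul, ← zpow_add₀ (two_ne_zero' ℝ), add_neg_cancel, zpow_zero, one_smul] at h2
  rw [← h2, ← integral_smul]
  congr 1; ext z
  rw [smul_smul]
  simp only [dil, ds_neg_mul]
  rw [← mul_assoc, ← zpow_add₀ two_ne_zero, add_neg_cancel, zpow_zero, one_mul]

theorem cv_dil_dil (j : ℤ) (A B : (Fin n → ℝ) → ℝ) :
    cv (dil w j A) (dil w j B) = dil w j (cv A B) := by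
  ext x
  rw [cv_dil_eq, dil, cv_eq, ← smul_eq_mul, ← integral_smul]
  congr 1; ext z
  simp only [dil, mul_sub, ds_neg_mul, smul_eq_mul]
  ring

theorem lintegral_comp_ds_neg (j : ℤ) (g : (Fin n → ℝ) → ℝ≥0∞) :
    ∫⁻ x, ENNReal.ofReal ((2 : ℝ) ^ (-(j * hdim w))) * g (ds w (-j) * x) = ∫⁻ x, g x := by
  rw [lintegral_const_mul' _ _ ENNReal.ofReal_ne_top, lintegral_comp_mul (ds_pos w (-j)),
    prod_ds, ← mul_assoc, ← ENNReal.ofReal_mul (by positivity), ← zpow_neg,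
    ← zpow_add₀ two_ne_zero]
  simp

theorem enorm_dil (j : ℤ) (κ : (Fin n → ℝ) → ℝ) (x : Fin n → ℝ) :
    ‖dil w j κ x‖ₑ = ENNReal.ofReal ((2 : ℝ) ^ (-(j * hdim w))) * ‖κ (ds w (-j) * x)‖ₑ := by
  rw [dil, enorm_mul, Real.enorm_eq_ofReal (by positivity)]

theorem lintegral_enorm_dil (j : ℤ) (κ : (Fin n → ℝ) → ℝ) :
    ∫⁻ x, ‖dil w j κ x‖ₑ = ∫⁻ x, ‖κ x‖ₑ := by
  simp_rw [enorm_dil]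
  exact lintegral_comp_ds_neg w j fun x => ‖κ x‖ₑ

variable {w} in
theorem Nice.dil {κ : (Fin n → ℝ) → ℝ} (h : Nice κ) (j : ℤ) : Nice (dil w j κ) := by
  obtain ⟨M, hM⟩ := h.2
  refine ⟨(integrable_comp_mul (ds_pos w (-j)) h.1).const_mul _,
    (2 : ℝ) ^ (-(j * hdim w : ℤ)) * M, fun x => ?_⟩
  rw [Anisotropic.dil, norm_mul, Real.norm_of_nonneg (by positivity)]
  exact mul_le_mul_of_nonneg_left (hM _) (by positivity)

/-- Compactly supported continuous kernels with a Lipschitz `L¹`-modulus of continuity. -/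
structure IsKer (κ : (Fin n → ℝ) → ℝ) : Prop where
  cont : Continuous κ
  supp : HasCompactSupport κ
  lip : ∃ C : ℝ≥0, ∀ y, ∫⁻ x, ‖κ (x - y) - κ x‖ₑ ≤ C * ‖y‖ₑ

theorem nice_of_hasCompactSupport {F : Type*} [NormedAddCommGroup F]
    {κ : (Fin n → ℝ) → F} (hc : Continuous κ)
    (hs : HasCompactSupport κ) : Nice κ :=
  ⟨hc.integrable_of_hasCompactSupport hs, hs.exists_bound_of_continuous hc⟩

theorem IsKer.nice {κ : (Fin n → ℝ) → ℝ} (h : IsKer κ) : Nice κ :=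
  nice_of_hasCompactSupport h.cont h.supp

theorem lintegral_dil_sub_le {κ : (Fin n → ℝ) → ℝ} {C : ℝ≥0}
    (hC : ∀ y, ∫⁻ x, ‖κ (x - y) - κ x‖ₑ ≤ C * ‖y‖ₑ) (j : ℤ) (y : Fin n → ℝ) :
    ∫⁻ x, ‖dil w j κ (x - y) - dil w j κ x‖ₑ ≤ C * ‖ds w (-j) * y‖ₑ := by
  refine le_trans (le_of_eq ?_) (hC _)
  rw [← lintegral_comp_ds_neg w j fun x => ‖κ (x - ds w (-j) * y) - κ x‖ₑ]
  refine lintegral_congr fun x => ?_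
  rw [dil, dil, ← mul_sub, enorm_mul, Real.enorm_eq_ofReal (by positivity), mul_sub]

theorem IsKer.of_contDiff {κ : (Fin n → ℝ) → ℝ} (h : ContDiff ℝ 1 κ) (hs : HasCompactSupport κ) :
    IsKer κ := by
  refine ⟨h.continuous, hs, ?_⟩
  obtain ⟨C, hC⟩ := h.lipschitzWith_of_hasCompactSupport hs (by simp)
  have hS : MeasurableSet (tsupport κ) := (isClosed_tsupport κ).measurableSet
  have hfin : volume (tsupport κ) ≠ ∞ := hs.isCompact.measure_lt_top.ne
  refine ⟨C * (2 * (volume (tsupport κ)).toNNReal), fun y => ?_⟩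
  have hpt : ∀ x, ‖κ (x - y) - κ x‖ₑ ≤ (tsupport κ).indicator (fun _ => C * ‖y‖ₑ) (x - y)
      + (tsupport κ).indicator (fun _ => (C : ℝ≥0∞) * ‖y‖ₑ) x := by
    intro x
    have hl : ‖κ (x - y) - κ x‖ₑ ≤ C * ‖y‖ₑ := by
      have := hC (x - y) x
      rw [edist_eq_enorm_sub, edist_eq_enorm_sub] at this
      simpa using this
    by_cases h1 : x - y ∈ tsupport κ
    · rw [Set.indicator_of_mem h1]
      exact hl.trans le_self_add
    · by_cases h2 : x ∈ tsupport κ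
      · rw [Set.indicator_of_mem h2]
        exact hl.trans le_add_self
      · rw [image_eq_zero_of_notMem_tsupport h1, image_eq_zero_of_notMem_tsupport h2]
        simp
  have hm : Measurable ((tsupport κ).indicator fun _ => (C : ℝ≥0∞) * ‖y‖ₑ) :=
    measurable_const.indicator hS
  refine (lintegral_mono hpt).trans (le_of_eq ?_)
  rw [lintegral_add_right _ hm, lintegral_sub_right_eq_self
    (fun x => (tsupport κ).indicator (fun _ => (C : ℝ≥0∞) * ‖y‖ₑ) x), lintegral_indicator_const hS]
  push_cast
  rw [ENNReal.coe_toNNReal hfin]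
  ring

theorem IsKer.neg_arg {κ : (Fin n → ℝ) → ℝ} (h : IsKer κ) : IsKer fun x => κ (-x) := by
  refine ⟨h.cont.comp continuous_neg, h.supp.comp_homeomorph (Homeomorph.neg _), ?_⟩
  obtain ⟨C, hC⟩ := h.lip
  refine ⟨C, fun y => ?_⟩
  have := hC (-y)
  rw [← lintegral_neg_eq_self] at this
  refine le_trans (le_of_eq ?_) (this.trans (by simp))
  refine lintegral_congr fun x => ?_
  rw [show -(x - y) = -x - -y by abel]

theorem lintegral_enorm_cv_le {A : (Fin n → ℝ) → ℝ} {B : (Fin n → ℝ) → E} (hA : Nice A)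
    (hB : Nice B) : ∫⁻ x, ‖cv A B x‖ₑ ≤ (∫⁻ x, ‖A x‖ₑ) * ∫⁻ x, ‖B x‖ₑ := by
  have h1 : AEStronglyMeasurable (fun z : (Fin n → ℝ) × (Fin n → ℝ) => A (z.1 - z.2))
      (volume.prod volume) := hA.1.aestronglyMeasurable.comp_quasiMeasurePreserving
        (quasiMeasurePreserving_sub_of_right_invariant volume volume)
  calc ∫⁻ x, ‖cv A B x‖ₑ ≤ ∫⁻ x, ∫⁻ y, ‖A (x - y)‖ₑ * ‖B y‖ₑ :=
        lintegral_mono fun x => enorm_cv_le _ _ _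
    _ = ∫⁻ y, ∫⁻ x, ‖A (x - y)‖ₑ * ‖B y‖ₑ :=
        lintegral_lintegral_swap (h1.enorm.mul hB.1.aestronglyMeasurable.comp_snd.enorm)
    _ = ∫⁻ y, (∫⁻ x, ‖A x‖ₑ) * ‖B y‖ₑ := by
        refine lintegral_congr fun y => ?_
        rw [lintegral_mul_const'' _ ((hA.1.comp_sub_right y).aestronglyMeasurable.enorm),
          lintegral_sub_right_eq_self (fun x => ‖A x‖ₑ) y]
    _ = _ := lintegral_const_mul' _ _ hA.1.2.ne

theorem IsKer.cv {A B : (Fin n → ℝ) → ℝ} (hA : IsKer A) (hB : IsKer B) : IsKer (cv A B) := by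
  refine ⟨continuous_cv hA.nice hA.cont hB.nice, ?_, ?_⟩
  · have : Anisotropic.cv A B
        = MeasureTheory.convolution A B (ContinuousLinearMap.lsmul ℝ ℝ) volume := by
      ext x; rw [cv_eq]; rfl
    rw [this]
    exact HasCompactSupport.convolution _ hA.supp hB.supp
  · obtain ⟨C, hC⟩ := hA.lip
    refine ⟨C * (∫⁻ x, ‖B x‖ₑ).toNNReal, fun y => ?_⟩
    have hAy : Nice fun x => A (x - y) :=
      ⟨hA.nice.1.comp_sub_right y, hA.nice.2.imp fun _ h x => h _⟩
    have := lintegral_enorm_cv_le (hAy.sub hA.nice) hB.nice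
    calc ∫⁻ x, ‖Anisotropic.cv A B (x - y) - Anisotropic.cv A B x‖ₑ
        = ∫⁻ x, ‖Anisotropic.cv (fun x => A (x - y) - A x) B x‖ₑ := by
          refine lintegral_congr fun x => ?_
          rw [cv_sub_left hAy hA.nice hB.nice]
          simp only [Anisotropic.cv, sub_right_comm]
      _ ≤ _ := this
      _ ≤ (C * ‖y‖ₑ) * ∫⁻ x, ‖B x‖ₑ := by gcongr; exact hC y
      _ = _ := by
          push_cast
          rw [ENNReal.coe_toNNReal hB.nice.1.2.ne]; ring

variable {w}

theorem norm_ds_neg_mul_le (hw : ∀ k, 0 < w k) {m : ℤ} (hm : 0 ≤ m) (z : Fin n → ℝ) :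
    ‖ds w (-m) * z‖ ≤ (2 : ℝ) ^ (-m) * ‖z‖ := by
  rw [pi_norm_le_iff_of_nonneg (by positivity)]
  intro k
  rw [Pi.mul_apply, norm_mul, Real.norm_of_nonneg (ds_pos w _ k).le]
  refine mul_le_mul ?_ (norm_le_pi_norm z k) (norm_nonneg _) (by positivity)
  refine zpow_le_zpow_right₀ one_le_two ?_
  have : (1 : ℤ) ≤ w k := by exact_mod_cast hw k
  nlinarith

theorem lintegral_cv_dil_le (hw : ∀ k, 0 < w k) {a b : (Fin n → ℝ) → ℝ} (ha : IsKer a)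
    (hb : IsKer b) (ha0 : ∫ x, a x = 0) :
    ∃ C : ℝ≥0, ∀ i j : ℤ, i ≤ j → ∫⁻ x, ‖cv (dil w i a) (dil w j b) x‖ₑ
      ≤ C * ENNReal.ofReal ((2 : ℝ) ^ (-(j - i))) := by
  obtain ⟨C, hC⟩ := hb.lip
  have hfin : ∫⁻ z, ‖a z‖ₑ * ‖z‖ₑ ≠ ∞ := by
    have : Integrable fun z => a z • z :=
      (ha.cont.smul continuous_id).integrable_of_hasCompactSupport
        (ha.supp.smul_right)
    have h := this.2.ne
    simpa [enorm_smul] using h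
  refine ⟨C * (∫⁻ z, ‖a z‖ₑ * ‖z‖ₑ).toNNReal, fun i j hij => ?_⟩
  have hb' : Nice (dil w (j - i) b) := hb.nice.dil _
  have key : ∀ x, ‖cv a (dil w (j - i) b) x‖ₑ
      ≤ ∫⁻ z, ‖a z‖ₑ * ‖dil w (j - i) b (x - z) - dil w (j - i) b x‖ₑ := by
    intro x
    have e : cv a (dil w (j - i) b) x
        = ∫ z, a z • (dil w (j - i) b (x - z) - dil w (j - i) b x) := by
      simp_rw [smul_sub]
      rw [integral_sub, integral_smul_const, ha0, zero_smul, sub_zero, cv_eq]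
      · have := (hb'.integrand ha.nice x)
        simpa [mul_comm] using this
      · exact ha.nice.1.smul_const _
    rw [e]
    refine (enorm_integral_le_lintegral_enorm _).trans (le_of_eq ?_)
    simp
  have hcd : Continuous (dil w (j - i) b) := by
    unfold dil
    exact continuous_const.mul (hb.cont.comp (by fun_prop))
  calc ∫⁻ x, ‖cv (dil w i a) (dil w j b) x‖ₑ
      = ∫⁻ x, ‖cv a (dil w (j - i) b) x‖ₑ := by
        rw [show dil w j b = dil w i (dil w (j - i) b) by rw [dil_dil]; congr 1; ring,
          cv_dil_dil, lintegral_enorm_dil]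
    _ ≤ ∫⁻ x, ∫⁻ z, ‖a z‖ₑ * ‖dil w (j - i) b (x - z) - dil w (j - i) b x‖ₑ := lintegral_mono key
    _ = ∫⁻ z, ∫⁻ x, ‖a z‖ₑ * ‖dil w (j - i) b (x - z) - dil w (j - i) b x‖ₑ := by
        refine lintegral_lintegral_swap (Measurable.aemeasurable ?_)
        exact (ha.cont.comp continuous_snd).measurable.enorm.mul
          ((hcd.comp (continuous_fst.sub continuous_snd)).sub
            (hcd.comp continuous_fst)).measurable.enorm
    _ ≤ ∫⁻ z, ‖a z‖ₑ * (C * (ENNReal.ofReal ((2 : ℝ) ^ (-(j - i))) * ‖z‖ₑ)) := by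
        refine lintegral_mono fun z => ?_
        rw [lintegral_const_mul' _ _ (by simp)]
        gcongr
        refine (lintegral_dil_sub_le w hC _ _).trans ?_
        gcongr
        rw [← ofReal_norm, ← ofReal_norm, ← ENNReal.ofReal_mul (by positivity)]
        exact ENNReal.ofReal_le_ofReal (norm_ds_neg_mul_le hw (by omega) z)
    _ = _ := by
        push_cast
        rw [ENNReal.coe_toNNReal hfin, mul_right_comm, ← lintegral_const_mul' _ _ (by finiteness)]
        refine lintegral_congr fun z => ?_
        ring

end

section

open scoped ENNReal NNReal

variable {n : ℕ} (w : Fin n → ℕ)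

/-- The integer coordinates of the dyadic box of level `j` containing a point. -/
def cell (j : ℤ) (x : Fin n → ℝ) : Fin n → ℤ := fun k => ⌊ds w (-j) k * x k⌋

/-- The dyadic box with given level and integer coordinates. -/
def box (Q : ℤ × (Fin n → ℤ)) : Set (Fin n → ℝ) := {y | cell w Q.1 y = Q.2}

/-- The union of a dyadic box and its neighbours of the same level. -/
def nbox (Q : ℤ × (Fin n → ℤ)) : Set (Fin n → ℝ) := {y | ∀ k, |cell w Q.1 y k - Q.2 k| ≤ 1}

/-- The volume of a dyadic box. -/
def bvol (Q : ℤ × (Fin n → ℤ)) : ℝ≥0∞ := ENNReal.ofReal ((2 : ℝ) ^ (Q.1 * hdim w))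

/-- The ancestor of a dyadic box, `m` generations up. -/
def anc (m : ℕ) (Q : ℤ × (Fin n → ℤ)) : ℤ × (Fin n → ℤ) :=
  (Q.1 + m, fun k => Q.2 k / (2 ^ (m * w k) : ℕ))

theorem cell_add (j : ℤ) (m : ℕ) (x : Fin n → ℝ) (k : Fin n) :
    cell w (j + m) x k = cell w j x k / (2 ^ (m * w k) : ℕ) := by
  rw [cell, cell, ← Int.floor_div_natCast]
  congr 1
  simp only [ds]
  rw [eq_div_iff (by positivity)]
  push_cast
  rw [← zpow_natCast, mul_right_comm, ← zpow_add₀ two_ne_zero]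
  congr 2
  push_cast
  ring

variable {w}

theorem mem_box_cell (j : ℤ) (x : Fin n → ℝ) : x ∈ box w (j, cell w j x) := rfl

theorem box_subset_anc (m : ℕ) (Q : ℤ × (Fin n → ℤ)) : box w Q ⊆ box w (anc w m Q) := by
  intro x hx
  ext k
  simp only [box, Set.mem_ofPred_eq] at hx
  simp only [anc, cell_add, hx]

theorem box_subset_nbox (Q : ℤ × (Fin n → ℤ)) : box w Q ⊆ nbox w Q := by
  intro x hx k
  simp only [box, Set.mem_ofPred_eq] at hx
  simp [hx]

theorem nbox_subset_anc (m : ℕ) (Q : ℤ × (Fin n → ℤ)) : nbox w Q ⊆ nbox w (anc w m Q) := by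
  intro x hx k
  have h := hx k
  simp only [anc, cell_add]
  generalize cell w Q.1 x k = a at *
  generalize Q.2 k = b at *
  have hd : (0 : ℤ) < (2 ^ (m * w k) : ℕ) := by positivity
  generalize ((2 ^ (m * w k) : ℕ) : ℤ) = d at *
  rw [abs_le] at h ⊢
  have h1 : (b + d) / d = b / d + 1 := by rw [Int.add_ediv_of_dvd_right (by simp)]; simp [hd.ne']
  have h2 : (a + d) / d = a / d + 1 := by rw [Int.add_ediv_of_dvd_right (by simp)]; simp [hd.ne']
  have h3 := Int.ediv_le_ediv hd (show a ≤ b + d by omega)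
  have h4 := Int.ediv_le_ediv hd (show b ≤ a + d by omega)
  constructor <;> omega

theorem measurable_cell (j : ℤ) : Measurable (cell w j) := by
  refine measurable_pi_lambda _ fun k => Int.measurable_floor.comp ?_
  exact measurable_const.mul (measurable_pi_apply k)

theorem measurableSet_box (Q : ℤ × (Fin n → ℤ)) : MeasurableSet (box w Q) :=
  measurable_cell Q.1 (MeasurableSet.singleton _)

theorem measurableSet_nbox (Q : ℤ × (Fin n → ℤ)) : MeasurableSet (nbox w Q) :=
  measurable_cell Q.1 (Set.to_countable {c : Fin n → ℤ | ∀ k, |c k - Q.2 k| ≤ 1}).measurableSet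

theorem volume_preimage_ds (j : ℤ) {s : Set (Fin n → ℝ)} :
    volume ((fun x => ds w (-j) * x) ⁻¹' s) = ENNReal.ofReal ((2 : ℝ) ^ (j * hdim w)) * volume s := by
  rw [← (measurableEmbedding_mul (ds_pos w (-j))).map_apply, map_mul_volume (ds_pos w (-j)),
    prod_ds, ← zpow_neg, Measure.smul_apply, smul_eq_mul]
  congr 3
  ring

theorem volume_box (Q : ℤ × (Fin n → ℤ)) : volume (box w Q) = bvol w Q := by
  have : box w Q = (fun x => ds w (-Q.1) * x) ⁻¹'
      (Set.univ.pi fun k => Set.Ico (Q.2 k : ℝ) (Q.2 k + 1)) := by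
    ext x
    simp only [box, Set.mem_ofPred_eq, funext_iff, cell, Int.floor_eq_iff, Set.mem_preimage,
      Set.mem_univ_pi, Set.mem_Ico, Pi.mul_apply]
  rw [this, volume_preimage_ds, Real.volume_pi_Ico]
  simp [bvol]

theorem volume_nbox (Q : ℤ × (Fin n → ℤ)) : volume (nbox w Q) = 3 ^ n * bvol w Q := by
  have : nbox w Q = (fun x => ds w (-Q.1) * x) ⁻¹'
      (Set.univ.pi fun k => Set.Ico ((Q.2 k : ℝ) - 1) (Q.2 k + 2)) := by
    ext x
    simp only [nbox, Set.mem_ofPred_eq, cell, Set.mem_preimage,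
      Set.mem_univ_pi, Set.mem_Ico, Pi.mul_apply]
    refine forall_congr' fun k => ?_
    generalize ds w (-Q.1) k * x k = t
    have h1 : ((Q.2 k : ℝ) - 1 ≤ t) ↔ Q.2 k - 1 ≤ ⌊t⌋ := by
      rw [Int.le_floor]; push_cast; rfl
    have h2 : (t < (Q.2 k : ℝ) + 2) ↔ ⌊t⌋ < Q.2 k + 2 := by
      rw [Int.floor_lt]; push_cast; rfl
    rw [h1, h2, abs_le]
    constructor <;> intro h <;> constructor <;> omega
  rw [this, volume_preimage_ds, Real.volume_pi_Ico]
  have : ∀ a : ℝ, a + 2 - (a - 1) = 3 := fun a => by ring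
  simp only [this, Finset.prod_const, Finset.card_univ, Fintype.card_fin, bvol]
  rw [mul_comm]
  norm_num

theorem bvol_ne_zero (Q : ℤ × (Fin n → ℤ)) : bvol w Q ≠ 0 := by
  simp only [bvol, ne_eq, ENNReal.ofReal_eq_zero, not_le]; positivity

theorem bvol_ne_top (Q : ℤ × (Fin n → ℤ)) : bvol w Q ≠ ∞ := ENNReal.ofReal_ne_top

theorem bvol_anc (m : ℕ) (Q : ℤ × (Fin n → ℤ)) :
    bvol w (anc w m Q) = 2 ^ (m * hdim w) * bvol w Q := by
  simp only [bvol, anc]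
  rw [add_mul, zpow_add₀ two_ne_zero, mul_comm, ENNReal.ofReal_mul (by positivity)]
  congr 1
  rw [show (m : ℤ) * hdim w = ((m * hdim w : ℕ) : ℤ) by push_cast; rfl, zpow_natCast,
    ENNReal.ofReal_pow (by norm_num)]
  simp

variable (w) in
/-- The mean of `F` over the box `Q` exceeds `r`. -/
def Bad (F : (Fin n → ℝ) → ℝ≥0∞) (r : ℝ≥0∞) (Q : ℤ × (Fin n → ℤ)) : Prop :=
  r * bvol w Q < ∫⁻ y in box w Q, F y

variable (w) in
/-- The maximal dyadic boxes over which the mean of `F` exceeds `r`. -/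
def stopBoxes (F : (Fin n → ℝ) → ℝ≥0∞) (r : ℝ≥0∞) : Set (ℤ × (Fin n → ℤ)) :=
  {Q | Bad w F r Q ∧ ∀ m : ℕ, 0 < m → ¬ Bad w F r (anc w m Q)}

theorem anc_anc (m m' : ℕ) (Q : ℤ × (Fin n → ℤ)) :
    anc w m (anc w m' Q) = anc w (m' + m) Q := by
  refine Prod.ext ?_ ?_
  · simp [anc, add_assoc]
  · ext k
    simp only [anc]
    rw [Int.ediv_ediv_of_nonneg]
    · rw [← Nat.cast_mul, ← pow_add, add_mul]
    · positivity

theorem exists_stopBox (hD : 0 < hdim w) {F : (Fin n → ℝ) → ℝ≥0∞} (hF : ∫⁻ y, F y ≠ ∞)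
    {r : ℝ≥0∞} (hr : r ≠ 0) {Q : ℤ × (Fin n → ℤ)} (hQ : Bad w F r Q) :
    ∃ m : ℕ, anc w m Q ∈ stopBoxes w F r := by
  have hb : ∃ N : ℕ, ∀ m : ℕ, Bad w F r (anc w m Q) → m < N := by
    have hlim : Filter.Tendsto (fun m : ℕ => (2 : ℝ≥0∞) ^ m * (r * bvol w Q)) Filter.atTop
        (nhds ∞) := by
      have h1 : Filter.Tendsto (fun m : ℕ => (2 : ℝ≥0∞) ^ m) Filter.atTop (nhds ∞) :=
        ENNReal.tendsto_pow_atTop_nhds_top_iff.2 (by norm_num)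
      have h0 : r * bvol w Q ≠ 0 := mul_ne_zero hr (bvol_ne_zero Q)
      have := ENNReal.Tendsto.mul_const (b := r * bvol w Q) h1 (Or.inl ENNReal.top_ne_zero)
      rwa [ENNReal.top_mul h0] at this
    obtain ⟨N, hN⟩ := (hlim.eventually (lt_mem_nhds hF.lt_top)).exists_forall_of_atTop
    refine ⟨N, fun m hm => ?_⟩
    by_contra hle
    have h1 := hN m (not_lt.1 hle)
    have h2 : r * bvol w (anc w m Q) < ∫⁻ y, F y :=
      lt_of_lt_of_le hm (setLIntegral_le_lintegral _ _)
    refine absurd (h1.trans_le ?_) (not_lt.2 h2.le)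
    rw [bvol_anc, ← mul_assoc, ← mul_assoc, mul_comm r]
    gcongr
    · norm_num
    · exact Nat.le_mul_of_pos_right m hD
  obtain ⟨N, hN⟩ := hb
  classical
  obtain ⟨m, hm, hmax⟩ : ∃ m, Bad w F r (anc w m Q) ∧ ∀ m', m < m' → ¬ Bad w F r (anc w m' Q) := by
    have h0 : Bad w F r (anc w 0 Q) := by simpa [anc] using hQ
    refine ⟨Nat.findGreatest (fun m => Bad w F r (anc w m Q)) N,
      Nat.findGreatest_spec (P := fun m => Bad w F r (anc w m Q)) (Nat.zero_le N) h0,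
      fun m' hm' hbad => ?_⟩
    exact absurd (Nat.le_findGreatest (P := fun m => Bad w F r (anc w m Q)) (hN m' hbad).le hbad)
      (not_le.2 hm')
  refine ⟨m, hm, fun m' hm' => ?_⟩
  rw [anc_anc]
  exact hmax _ (by omega)

theorem eq_of_mem_box {Q R : ℤ × (Fin n → ℤ)} {x : Fin n → ℝ} (hQ : x ∈ box w Q)
    (hR : x ∈ box w R) (h : Q.1 = R.1) : Q = R := by
  refine Prod.ext h ?_
  simp only [box, Set.mem_ofPred_eq] at hQ hR
  rw [← hQ, ← hR, h]

theorem stopBoxes_disjoint (F : (Fin n → ℝ) → ℝ≥0∞) (r : ℝ≥0∞) :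
    (stopBoxes w F r).PairwiseDisjoint (box w) := by
  intro Q hQ R hR hne
  rw [Function.onFun, Set.disjoint_left]
  intro x hxQ hxR
  wlog hle : Q.1 ≤ R.1 generalizing Q R
  · exact this hR hQ hne.symm hxR hxQ (by omega)
  obtain ⟨m, hm⟩ := Int.eq_ofNat_of_zero_le (sub_nonneg.2 hle)
  have hR' : R = anc w m Q :=
    eq_of_mem_box hxR (box_subset_anc m Q hxQ) (by simp only [anc]; omega)
  rcases Nat.eq_zero_or_pos m with h0 | hpos
  · subst h0
    exact hne (by rw [hR']; simp [anc])
  · exact hQ.2 m hpos (hR' ▸ hR.1)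

theorem stopBoxes_mass_le {F : (Fin n → ℝ) → ℝ≥0∞} {r : ℝ≥0∞} {Q : ℤ × (Fin n → ℤ)}
    (hQ : Q ∈ stopBoxes w F r) : ∫⁻ y in box w Q, F y ≤ 2 ^ hdim w * (r * bvol w Q) := by
  have h := hQ.2 1 one_pos
  rw [Bad, not_lt, bvol_anc, one_mul, mul_left_comm] at h
  exact (lintegral_mono_set (box_subset_anc 1 Q)).trans h

variable (w) in
/-- The union of the maximal dyadic boxes. -/
def stopSet (F : (Fin n → ℝ) → ℝ≥0∞) (r : ℝ≥0∞) : Set (Fin n → ℝ) :=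
  ⋃ Q : stopBoxes w F r, box w Q

variable (w) in
/-- The union of the maximal dyadic boxes and their neighbours. -/
def nstopSet (F : (Fin n → ℝ) → ℝ≥0∞) (r : ℝ≥0∞) : Set (Fin n → ℝ) :=
  ⋃ Q : stopBoxes w F r, nbox w Q

instance (F : (Fin n → ℝ) → ℝ≥0∞) (r : ℝ≥0∞) : Countable (stopBoxes w F r) :=
  (Set.to_countable _).to_subtype

theorem stopBoxes_pairwise (F : (Fin n → ℝ) → ℝ≥0∞) (r : ℝ≥0∞) :
    Pairwise (Function.onFun Disjoint fun Q : stopBoxes w F r => box w Q) :=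
  fun Q R h => stopBoxes_disjoint F r Q.2 R.2 (Subtype.coe_ne_coe.2 h)

theorem measurableSet_stopSet (F : (Fin n → ℝ) → ℝ≥0∞) (r : ℝ≥0∞) :
    MeasurableSet (stopSet w F r) := MeasurableSet.iUnion fun _ => measurableSet_box _

theorem measurableSet_nstopSet (F : (Fin n → ℝ) → ℝ≥0∞) (r : ℝ≥0∞) :
    MeasurableSet (nstopSet w F r) := MeasurableSet.iUnion fun _ => measurableSet_nbox _

theorem stopSet_subset (F : (Fin n → ℝ) → ℝ≥0∞) (r : ℝ≥0∞) : stopSet w F r ⊆ nstopSet w F r :=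
  Set.iUnion_mono fun _ => box_subset_nbox _

theorem volume_stopSet (F : (Fin n → ℝ) → ℝ≥0∞) (r : ℝ≥0∞) :
    volume (stopSet w F r) = ∑' Q : stopBoxes w F r, bvol w Q := by
  rw [stopSet, measure_iUnion (stopBoxes_pairwise F r) fun Q => measurableSet_box _]
  simp_rw [volume_box]

theorem volume_nstopSet_le (F : (Fin n → ℝ) → ℝ≥0∞) (r : ℝ≥0∞) :
    volume (nstopSet w F r) ≤ 3 ^ n * volume (stopSet w F r) := by
  refine (measure_iUnion_le _).trans (le_of_eq ?_)
  simp_rw [volume_nbox]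
  rw [ENNReal.tsum_mul_left, volume_stopSet]

theorem volume_stopSet_le (F : (Fin n → ℝ) → ℝ≥0∞) (r : ℝ≥0∞) :
    r * volume (stopSet w F r) ≤ ∫⁻ x, F x := by
  calc r * volume (stopSet w F r) = ∑' Q : stopBoxes w F r, r * bvol w Q := by
        rw [volume_stopSet, ENNReal.tsum_mul_left]
    _ ≤ ∑' Q : stopBoxes w F r, ∫⁻ y in box w Q, F y := ENNReal.tsum_le_tsum fun Q => Q.2.1.le
    _ = ∫⁻ y in stopSet w F r, F y :=
        (lintegral_iUnion (fun Q => measurableSet_box _) (stopBoxes_pairwise F r) _).symm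
    _ ≤ _ := setLIntegral_le_lintegral _ _

variable (w) in
/-- The dyadic maximal function over boxes and their neighbours. -/
def maxFun (F : (Fin n → ℝ) → ℝ≥0∞) (x : Fin n → ℝ) : ℝ≥0∞ :=
  ⨆ Q : {Q : ℤ × (Fin n → ℤ) // x ∈ nbox w Q}, (∫⁻ y in box w Q, F y) / bvol w Q

theorem lt_maxFun_iff (hD : 0 < hdim w) {F : (Fin n → ℝ) → ℝ≥0∞} (hF : ∫⁻ y, F y ≠ ∞)
    {r : ℝ≥0∞} (hr : r ≠ 0) (x : Fin n → ℝ) : r < maxFun w F x ↔ x ∈ nstopSet w F r := by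
  have hbad : ∀ Q, r < (∫⁻ y in box w Q, F y) / bvol w Q ↔ Bad w F r Q := fun Q => by
    rw [Bad, ENNReal.lt_div_iff_mul_lt (Or.inl (bvol_ne_zero Q)) (Or.inl (bvol_ne_top Q))]
  rw [maxFun, lt_iSup_iff, nstopSet, Set.mem_iUnion]
  constructor
  · rintro ⟨Q, hQ⟩
    obtain ⟨m, hm⟩ := exists_stopBox hD hF hr ((hbad Q).1 hQ)
    exact ⟨⟨_, hm⟩, nbox_subset_anc m _ Q.2⟩
  · rintro ⟨Q, hQ⟩
    exact ⟨⟨Q, hQ⟩, (hbad Q).2 Q.2.1⟩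

theorem volume_lt_maxFun_le (hD : 0 < hdim w) {F : (Fin n → ℝ) → ℝ≥0∞} (hF : ∫⁻ y, F y ≠ ∞)
    {r : ℝ≥0∞} (hr : r ≠ 0) : r * volume {x | r < maxFun w F x} ≤ 3 ^ n * ∫⁻ x, F x := by
  simp_rw [lt_maxFun_iff hD hF hr]
  calc _ ≤ r * (3 ^ n * volume (stopSet w F r)) := by
        gcongr; exact volume_nstopSet_le F r
    _ ≤ _ := by
        rw [mul_left_comm]
        gcongr; exact volume_stopSet_le F r

theorem maxFun_le_add (F : (Fin n → ℝ) → ℝ≥0∞) (r : ℝ≥0∞) (x : Fin n → ℝ) :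
    maxFun w F x ≤ maxFun w ({y | r < F y}.indicator F) x + r := by
  refine iSup_le fun Q => ?_
  have h1 : ∀ y, F y ≤ {y | r < F y}.indicator F y + r := by
    intro y
    by_cases h : r < F y
    · rw [Set.indicator_of_mem (by exact h)]; exact le_self_add
    · exact (not_lt.1 h).trans le_add_self
  calc (∫⁻ y in box w Q, F y) / bvol w Q
      ≤ (∫⁻ y in box w Q, ({y | r < F y}.indicator F y + r)) / bvol w Q := by
        gcongr with y; exact h1 y
    _ = (∫⁻ y in box w Q, {y | r < F y}.indicator F y) / bvol w Q + r := by
        rw [lintegral_add_right _ measurable_const, setLIntegral_const, volume_box,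
          ENNReal.add_div, ENNReal.mul_div_cancel_right (bvol_ne_zero _) (bvol_ne_top _)]
    _ ≤ _ := by
        gcongr
        exact le_iSup (fun Q : {Q : ℤ × (Fin n → ℤ) // x ∈ nbox w Q} =>
          (∫⁻ y in box w Q, {y | r < F y}.indicator F y) / bvol w Q) Q

theorem volume_lt_maxFun_le_setLIntegral (hD : 0 < hdim w) {F : (Fin n → ℝ) → ℝ≥0∞}
    (hFm : Measurable F) (hF : ∫⁻ y, F y ≠ ∞) {r : ℝ≥0∞} (hr : r ≠ 0) :
    r * volume {x | r < maxFun w F x} ≤ 2 * 3 ^ n * ∫⁻ x in {y | r / 2 < F y}, F x := by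
  have hs : MeasurableSet {y | r / 2 < F y} := measurableSet_lt measurable_const hFm
  have h2 : r / 2 ≠ 0 := by simp [hr]
  have hle : volume {x | r < maxFun w F x}
      ≤ volume {x | r / 2 < maxFun w ({y | r / 2 < F y}.indicator F) x} := by
    refine measure_mono fun x hx => ?_
    simp only [Set.mem_ofPred_eq] at hx ⊢
    have h := hx.trans_le (maxFun_le_add F (r / 2) x)
    by_contra hcon
    have := h.trans_le (add_le_add_left (not_lt.1 hcon) _)
    rw [ENNReal.add_halves] at this
    exact lt_irrefl _ this
  have hfin : ∫⁻ y, {y | r / 2 < F y}.indicator F y ≠ ∞ :=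
    ((lintegral_mono (Set.indicator_le_self _ _)).trans_lt hF.lt_top).ne
  have := volume_lt_maxFun_le hD hfin h2
  rw [lintegral_indicator hs] at this
  calc r * volume {x | r < maxFun w F x}
      ≤ r * volume {x | r / 2 < maxFun w ({y | r / 2 < F y}.indicator F) x} := by gcongr
    _ = 2 * (r / 2 * volume {x | r / 2 < maxFun w ({y | r / 2 < F y}.indicator F) x}) := by
        rw [← mul_assoc, ENNReal.mul_div_cancel (by norm_num) (by norm_num)]
    _ ≤ _ := by rw [mul_assoc]; gcongr

theorem measurable_maxFun (F : (Fin n → ℝ) → ℝ≥0∞) : Measurable (maxFun w F) := by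
  have : maxFun w F = fun x => ⨆ Q : ℤ × (Fin n → ℤ),
      (nbox w Q).indicator (fun _ => (∫⁻ y in box w Q, F y) / bvol w Q) x := by
    ext x
    refine le_antisymm (iSup_le fun Q => ?_) (iSup_le fun Q => ?_)
    · refine le_iSup_of_le Q.1 ?_
      rw [Set.indicator_of_mem Q.2]
    · by_cases h : x ∈ nbox w Q
      · rw [Set.indicator_of_mem h]
        exact le_iSup (fun Q : {Q : ℤ × (Fin n → ℤ) // x ∈ nbox w Q} =>
          (∫⁻ y in box w Q, F y) / bvol w Q) ⟨Q, h⟩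
      · rw [Set.indicator_of_notMem h]; exact zero_le
  rw [this]
  exact Measurable.iSup fun Q => measurable_const.indicator (measurableSet_nbox Q)

theorem norm_sub_le_of_mem_box (hw : ∀ k, 0 < w k) {j : ℤ} (hj : j ≤ 0) {x y : Fin n → ℝ}
    (h : y ∈ box w (j, cell w j x)) : ‖y - x‖ ≤ (2 : ℝ) ^ j := by
  rw [pi_norm_le_iff_of_nonneg (by positivity)]
  intro k
  have hk : ⌊ds w (-j) k * y k⌋ = ⌊ds w (-j) k * x k⌋ := congrFun h k
  have h1 := Int.abs_sub_lt_one_of_floor_eq_floor hk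
  rw [← mul_sub, abs_mul, abs_of_pos (ds_pos w _ k)] at h1
  rw [Pi.sub_apply, Real.norm_eq_abs]
  have hd : (2 : ℝ) ^ (-j) ≤ ds w (-j) k := by
    refine zpow_le_zpow_right₀ one_le_two ?_
    have : (1 : ℤ) ≤ w k := by exact_mod_cast hw k
    nlinarith
  have h2 : (2 : ℝ) ^ (-j) * |y k - x k| ≤ 1 :=
    (mul_le_mul_of_nonneg_right hd (abs_nonneg _)).trans h1.le
  rw [zpow_neg, inv_mul_le_iff₀ (by positivity), mul_one] at h2
  exact h2

theorem le_of_notMem_stopSet (hw : ∀ k, 0 < w k) (hD : 0 < hdim w) {F : (Fin n → ℝ) → ℝ≥0∞}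
    (hFc : Continuous F) (hF : ∫⁻ y, F y ≠ ∞) {r : ℝ≥0∞} (hr : r ≠ 0) {x : Fin n → ℝ}
    (hx : x ∉ stopSet w F r) : F x ≤ r := by
  by_contra hlt
  obtain ⟨s, hrs, hsF⟩ := exists_between (not_le.1 hlt)
  have hev := hFc.continuousAt.eventually (lt_mem_nhds hsF)
  obtain ⟨ε, hε, hball⟩ := Metric.eventually_nhds_iff.1 hev
  obtain ⟨m, hm⟩ := exists_pow_lt_of_lt_one hε (show (1 / 2 : ℝ) < 1 by norm_num)
  have hbad : Bad w F r (-(m : ℤ), cell w (-m) x) := by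
    have hle : s * bvol w (-(m : ℤ), cell w (-m) x)
        ≤ ∫⁻ y in box w (-(m : ℤ), cell w (-m) x), F y := by
      rw [← volume_box, ← setLIntegral_const]
      refine setLIntegral_mono' (measurableSet_box _) fun y hy => (hball ?_).le
      rw [dist_eq_norm]
      refine (norm_sub_le_of_mem_box hw (by omega) hy).trans_lt ?_
      rw [zpow_neg, zpow_natCast]
      simpa using hm
    refine lt_of_lt_of_le ?_ hle
    exact ENNReal.mul_lt_mul_left (bvol_ne_zero _) (bvol_ne_top _) hrs
  obtain ⟨m', hm'⟩ := exists_stopBox hD hF hr hbad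
  exact hx (Set.mem_iUnion.2 ⟨⟨_, hm'⟩, box_subset_anc m' _ (mem_box_cell _ _)⟩)

theorem lintegral_nbox_le {F : (Fin n → ℝ) → ℝ≥0∞} (j : ℤ) (x : Fin n → ℝ) :
    ∫⁻ y in nbox w (j, cell w j x), F y
      ≤ 3 ^ n * (ENNReal.ofReal ((2 : ℝ) ^ (j * hdim w)) * maxFun w F x) := by
  let S : Finset (Fin n → ℤ) := Fintype.piFinset fun k => Finset.Icc (cell w j x k - 1) (cell w j x k + 1)
  have hsub : nbox w (j, cell w j x) ⊆ ⋃ c ∈ S, box w (j, c) := by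
    intro y hy
    simp only [Set.mem_iUnion]
    refine ⟨cell w j y, ?_, rfl⟩
    simp only [S, Fintype.mem_piFinset, Finset.mem_Icc]
    intro k
    have := abs_le.1 (hy k)
    constructor <;> [have := this.1; have := this.2] <;> simp only at this <;> omega
  have hcard : (S.card : ℝ≥0∞) = 3 ^ n := by
    have : S.card = 3 ^ n := by
      simp only [S, Fintype.card_piFinset, Int.card_Icc]
      have : ∀ a : ℤ, (a + 1 + 1 - (a - 1)).toNat = 3 := fun a => by omega
      simp [this]
    rw [this]; norm_num
  calc ∫⁻ y in nbox w (j, cell w j x), F y ≤ ∫⁻ y in ⋃ c ∈ S, box w (j, c), F y :=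
        lintegral_mono_set hsub
    _ ≤ ∑ c ∈ S, ∫⁻ y in box w (j, c), F y := by
        have := lintegral_iUnion_le (μ := volume) (fun c : S => box w (j, (c : Fin n → ℤ))) F
        rw [show (⋃ c ∈ S, box w (j, c)) = ⋃ c : S, box w (j, (c : Fin n → ℤ)) from
          Set.biUnion_eq_iUnion (S : Set (Fin n → ℤ)) fun c _ => box w (j, c)]
        refine this.trans (le_of_eq ?_)
        rw [tsum_fintype, Finset.sum_coe_sort S fun c => ∫⁻ y in box w (j, c), F y]
    _ ≤ ∑ c ∈ S, ENNReal.ofReal ((2 : ℝ) ^ (j * hdim w)) * maxFun w F x := by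
        refine Finset.sum_le_sum fun c hc => ?_
        have hx : x ∈ nbox w (j, c) := by
          intro k
          have := Finset.mem_Icc.1 (Fintype.mem_piFinset.1 hc k)
          simp only
          rw [abs_le]; constructor <;> omega
        have := le_iSup (fun Q : {Q : ℤ × (Fin n → ℤ) // x ∈ nbox w Q} =>
          (∫⁻ y in box w Q, F y) / bvol w Q) ⟨(j, c), hx⟩
        have h2 : (∫⁻ y in box w (j, c), F y) / bvol w (j, c) ≤ maxFun w F x := this
        rw [ENNReal.div_le_iff (bvol_ne_zero _) (bvol_ne_top _), mul_comm] at h2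
        exact h2
    _ = _ := by rw [Finset.sum_const, nsmul_eq_mul, hcard]

end

section

open scoped ENNReal NNReal

section LayerCake

theorem lintegral_rpow_lt {a : ℝ} (ha : 0 < a) {s : ℝ≥0∞} (hs : s ≠ ∞) :
    ∫⁻ t in Set.Ioi (0 : ℝ), {t : ℝ | ENNReal.ofReal t < s}.indicator
      (fun t => ENNReal.ofReal (t ^ (a - 1))) t = ENNReal.ofReal a⁻¹ * s ^ a := by
  lift s to ℝ≥0 using hs
  have hset : {t : ℝ | ENNReal.ofReal t < s} ∩ Set.Ioi 0 = Set.Ioo 0 (s : ℝ) := by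
    ext t
    simp only [Set.mem_inter_iff, Set.mem_ofPred_eq, Set.mem_Ioi, Set.mem_Ioo]
    rw [and_comm]
    refine and_congr_right fun ht => ?_
    rw [← ENNReal.ofReal_coe_nnreal, ENNReal.ofReal_lt_ofReal_iff_of_nonneg ht.le]
  rw [lintegral_indicator (measurableSet_lt (by fun_prop) (by fun_prop)),
    Measure.restrict_restrict (measurableSet_lt (by fun_prop) (by fun_prop)), hset]
  have hint : IntervalIntegrable (fun t : ℝ => t ^ (a - 1)) volume 0 s :=
    intervalIntegral.intervalIntegrable_rpow' (by linarith)
  rw [Measure.restrict_congr_set Ioo_ae_eq_Ioc, ← ofReal_integral_eq_lintegral_ofReal, ← intervalIntegral.integral_of_le s.coe_nonneg,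
    integral_rpow (Or.inl (by linarith))]
  · rw [sub_add_cancel, Real.zero_rpow ha.ne', sub_zero, div_eq_inv_mul,
      ENNReal.ofReal_mul (by positivity), ← ENNReal.ofReal_rpow_of_nonneg s.coe_nonneg ha.le]
    simp
  · exact (intervalIntegrable_iff_integrableOn_Ioc_of_le s.coe_nonneg).1 hint
  · refine (ae_restrict_iff' measurableSet_Ioc).2 (Filter.Eventually.of_forall fun t ht => ?_)
    exact Real.rpow_nonneg ht.1.le _

theorem lintegral_rpow_ge {b : ℝ} (hb : 0 < b) {s : ℝ≥0∞} (hs : s ≠ ∞) :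
    ∫⁻ t in Set.Ioi (0 : ℝ), {t : ℝ | s ≤ ENNReal.ofReal t}.indicator
      (fun t => ENNReal.ofReal (t ^ (-b - 1))) t ≤ ENNReal.ofReal b⁻¹ * s ^ (-b) := by
  rcases eq_or_ne s 0 with rfl | h0
  · rw [ENNReal.zero_rpow_of_neg (by linarith), ENNReal.mul_top (by simpa using hb)]
    exact le_top
  lift s to ℝ≥0 using hs
  have hs0 : (0 : ℝ) < s := by
    have : s ≠ 0 := by simpa using h0
    positivity
  have hset : {t : ℝ | (s : ℝ≥0∞) ≤ ENNReal.ofReal t} ∩ Set.Ioi 0 = Set.Ici (s : ℝ) := by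
    ext t
    simp only [Set.mem_inter_iff, Set.mem_ofPred_eq, Set.mem_Ioi, Set.mem_Ici]
    constructor
    · rintro ⟨h, ht⟩
      rwa [← ENNReal.ofReal_coe_nnreal, ENNReal.ofReal_le_ofReal_iff ht.le] at h
    · intro h
      refine ⟨?_, hs0.trans_le h⟩
      rw [← ENNReal.ofReal_coe_nnreal]
      exact ENNReal.ofReal_le_ofReal h
  rw [lintegral_indicator (measurableSet_le (by fun_prop) (by fun_prop)),
    Measure.restrict_restrict (measurableSet_le (by fun_prop) (by fun_prop)), hset]
  rw [← restrict_Ioi_eq_restrict_Ici, ← ofReal_integral_eq_lintegral_ofReal,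
    integral_Ioi_rpow_of_lt (by linarith) hs0]
  · rw [sub_add_cancel, neg_div_neg_eq, div_eq_inv_mul,
      ENNReal.ofReal_mul (by positivity), ← ENNReal.ofReal_rpow_of_pos hs0]
    simp
  · exact integrableOn_Ioi_rpow_of_lt (by linarith) hs0
  · refine (ae_restrict_iff' measurableSet_Ioi).2 (Filter.Eventually.of_forall fun t ht => ?_)
    exact Real.rpow_nonneg (hs0.trans ht).le _

variable {X : Type*} [MeasurableSpace X] {μ : Measure X} [SFinite μ]

theorem lintegral_mul_setLIntegral_swap {P : ℝ → X → Prop} (hP : MeasurableSet {z : ℝ × X | P z.1 z.2})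
    {H : X → ℝ≥0∞} (hH : Measurable H) {φ : ℝ → ℝ≥0∞} (hφ : Measurable φ) (ν : Measure ℝ) [SFinite ν] :
    ∫⁻ t, φ t * ∫⁻ x in {x | P t x}, H x ∂μ ∂ν
      = ∫⁻ x, (∫⁻ t, {t | P t x}.indicator φ t ∂ν) * H x ∂μ := by
  have hm : Measurable ({z : ℝ × X | P z.1 z.2}.indicator fun z => φ z.1 * H z.2) :=
    (by fun_prop : Measurable fun z : ℝ × X => φ z.1 * H z.2).indicator hP
  have hS : ∀ t, MeasurableSet {x | P t x} := fun t => measurable_prodMk_left (x := t) hP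
  have hT : ∀ x, MeasurableSet {t | P t x} := fun x => measurable_prodMk_right (y := x) hP
  have hswap := lintegral_lintegral_swap (μ := ν) (ν := μ)
    (f := fun t x => {z : ℝ × X | P z.1 z.2}.indicator (fun z => φ z.1 * H z.2) (t, x))
    hm.aemeasurable
  refine Eq.trans ?_ (hswap.trans ?_)
  · refine lintegral_congr fun t => ?_
    rw [← lintegral_indicator (hS t), ← lintegral_const_mul _ (hH.indicator (hS t))]
    refine lintegral_congr fun x => ?_
    by_cases h : P t x <;> simp [Set.indicator, h]
  · refine lintegral_congr fun x => ?_
    rw [← lintegral_mul_const _ (hφ.indicator (hT x))]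
    refine lintegral_congr fun t => ?_
    by_cases h : P t x <;> simp [Set.indicator, h]

theorem lintegral_rpow_mul_setLIntegral_lt {a : ℝ} (ha : 0 < a) {G H : X → ℝ≥0∞}
    (hG : Measurable G) (hGt : ∀ x, G x ≠ ∞) (hH : Measurable H) :
    ∫⁻ t in Set.Ioi (0 : ℝ), ENNReal.ofReal (t ^ (a - 1)) *
        ∫⁻ x in {x | ENNReal.ofReal t < G x}, H x ∂μ
      = ENNReal.ofReal a⁻¹ * ∫⁻ x, G x ^ a * H x ∂μ := by
  rw [lintegral_mul_setLIntegral_swap (P := fun t x => ENNReal.ofReal t < G x)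
    (measurableSet_lt (by fun_prop) (by fun_prop)) hH (by fun_prop) (volume.restrict (Set.Ioi 0)),
    ← lintegral_const_mul _ (by fun_prop)]
  refine lintegral_congr fun x => ?_
  rw [lintegral_rpow_lt ha (hGt x), mul_assoc]

theorem lintegral_rpow_mul_setLIntegral_le {b : ℝ} (hb : 0 < b) {G H : X → ℝ≥0∞}
    (hG : Measurable G) (hGt : ∀ x, G x ≠ ∞) (hH : Measurable H) :
    ∫⁻ t in Set.Ioi (0 : ℝ), ENNReal.ofReal (t ^ (-b - 1)) *
        ∫⁻ x in {x | G x ≤ ENNReal.ofReal t}, H x ∂μ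
      ≤ ENNReal.ofReal b⁻¹ * ∫⁻ x, G x ^ (-b) * H x ∂μ := by
  rw [lintegral_mul_setLIntegral_swap (P := fun t x => G x ≤ ENNReal.ofReal t)
    (measurableSet_le (by fun_prop) (by fun_prop)) hH (by fun_prop) (volume.restrict (Set.Ioi 0)),
    ← lintegral_const_mul _ (by fun_prop)]
  refine lintegral_mono fun x => ?_
  rw [← mul_assoc]
  gcongr
  exact lintegral_rpow_ge hb (hGt x)

theorem lintegral_rpow_eq_measure_lt {a : ℝ} (ha : 0 < a) {G : X → ℝ≥0∞}
    (hG : Measurable G) (hGt : ∀ x, G x ≠ ∞) :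
    ∫⁻ x, G x ^ a ∂μ = ENNReal.ofReal a * ∫⁻ t in Set.Ioi (0 : ℝ),
      ENNReal.ofReal (t ^ (a - 1)) * μ {x | ENNReal.ofReal t < G x} := by
  have h := lintegral_rpow_mul_setLIntegral_lt (μ := μ) ha hG hGt (measurable_const (a := 1))
  simp only [setLIntegral_const, one_mul, mul_one] at h
  rw [h, ← mul_assoc, ← ENNReal.ofReal_mul ha.le, mul_inv_cancel₀ ha.ne']
  simp

end LayerCake

variable {n : ℕ} {w : Fin n → ℕ}

theorem maxFun_le {F : (Fin n → ℝ) → ℝ≥0∞} {M : ℝ≥0∞} (hM : ∀ x, F x ≤ M) (x : Fin n → ℝ) :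
    maxFun w F x ≤ M := by
  refine iSup_le fun Q => ENNReal.div_le_of_le_mul ?_
  rw [← volume_box, ← setLIntegral_const]
  exact lintegral_mono fun y => hM y

variable (n) in
/-- The constant in the maximal inequality. -/
def maxConst (p : ℝ) : ℝ≥0∞ :=
  ENNReal.ofReal p * (2 * 3 ^ n * (ENNReal.ofReal (p - 1)⁻¹ * 2 ^ (p - 1)))

theorem maxConst_ne_top {p : ℝ} (hp : 1 < p) : maxConst n p ≠ ∞ := by
  unfold maxConst
  have : (2 : ℝ≥0∞) ^ (p - 1) ≠ ∞ := ENNReal.rpow_ne_top_of_nonneg (by linarith) (by norm_num)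
  finiteness

theorem lintegral_rpow_volume_maxFun_le (hD : 0 < hdim w) {F : (Fin n → ℝ) → ℝ≥0∞} (hFm : Measurable F)
    (hF : ∫⁻ y, F y ≠ ∞) (hFt : ∀ x, F x ≠ ∞) {p : ℝ} (hp : 1 < p) :
    ENNReal.ofReal p * ∫⁻ t in Set.Ioi (0 : ℝ), ENNReal.ofReal (t ^ (p - 1)) *
      volume {x | ENNReal.ofReal t < maxFun w F x} ≤ maxConst n p * ∫⁻ x, F x ^ p := by
  have hG := lintegral_rpow_mul_setLIntegral_lt (μ := (volume : Measure (Fin n → ℝ)))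
    (a := p - 1) (by linarith) (G := fun x => 2 * F x) (by fun_prop)
    (fun x => by have := hFt x; finiteness) hFm
  calc _ ≤ ENNReal.ofReal p * ∫⁻ t in Set.Ioi (0 : ℝ), 2 * 3 ^ n * (ENNReal.ofReal (t ^ (p - 1 - 1)) *
          ∫⁻ x in {x | ENNReal.ofReal t < 2 * F x}, F x) := by
        gcongr ENNReal.ofReal p * ?_
        refine setLIntegral_mono' measurableSet_Ioi fun t ht => ?_
        have ht' : (0 : ℝ) < t := ht
        have h := volume_lt_maxFun_le_setLIntegral hD hFm hF (r := ENNReal.ofReal t)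
          (by simpa using ht')
        have hset : {y | ENNReal.ofReal t / 2 < F y} = {x | ENNReal.ofReal t < 2 * F x} := by
          ext y
          simp only [Set.mem_ofPred_eq]
          rw [ENNReal.div_lt_iff (by norm_num) (by norm_num), mul_comm]
        rw [hset] at h
        calc _ = ENNReal.ofReal (t ^ (p - 1 - 1)) * (ENNReal.ofReal t *
              volume {x | ENNReal.ofReal t < maxFun w F x}) := by
              rw [← mul_assoc, ← ENNReal.ofReal_mul (by positivity), Real.rpow_sub_one ht'.ne' (p - 1),
                div_mul_cancel₀ _ ht'.ne']
          _ ≤ _ := by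
              rw [mul_left_comm (2 * 3 ^ n)]
              gcongr
    _ = _ := by
        rw [lintegral_const_mul' _ _ (by finiteness), hG, maxConst]
        simp only [mul_assoc]
        congr 4
        rw [← lintegral_const_mul _ (by fun_prop)]
        refine lintegral_congr fun x => ?_
        rw [ENNReal.mul_rpow_of_nonneg _ _ (by linarith), mul_assoc]
        congr 1
        nth_rewrite 2 [← ENNReal.rpow_one (F x)]
        rw [← ENNReal.rpow_add_of_nonneg _ _ (by linarith) (by norm_num), sub_add_cancel]

theorem lintegral_maxFun_rpow_le (hD : 0 < hdim w) {F : (Fin n → ℝ) → ℝ≥0∞} (hFm : Measurable F)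
    (hF : ∫⁻ y, F y ≠ ∞) {M : ℝ≥0∞} (hM : M ≠ ∞) (hFM : ∀ x, F x ≤ M) {p : ℝ} (hp : 1 < p) :
    ∫⁻ x, maxFun w F x ^ p ≤ maxConst n p * ∫⁻ x, F x ^ p := by
  rw [lintegral_rpow_eq_measure_lt (by linarith) (measurable_maxFun F)
    fun x => ((maxFun_le hFM x).trans_lt hM.lt_top).ne]
  exact lintegral_rpow_volume_maxFun_le hD hFm hF
    (fun x => ((hFM x).trans_lt hM.lt_top).ne) hp

end

section

open scoped ENNReal NNReal

variable {n : ℕ} (w : Fin n → ℕ)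

/-- The good part of the Calderón–Zygmund decomposition of `f` at height `r`. -/
def good (f : (Fin n → ℝ) → ℂ) (r : ℝ≥0∞) (x : Fin n → ℝ) : ℂ :=
  open Classical in
  if h : ∃ Q ∈ stopBoxes w (fun x => ‖f x‖ₑ) r, x ∈ box w Q then ⨍ y in box w h.choose, f y
  else f x

variable {w}

theorem good_of_mem {f : (Fin n → ℝ) → ℂ} {r : ℝ≥0∞} {Q : ℤ × (Fin n → ℤ)}
    (hQ : Q ∈ stopBoxes w (fun x => ‖f x‖ₑ) r) {x : Fin n → ℝ} (hx : x ∈ box w Q) :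
    good w f r x = ⨍ y in box w Q, f y := by
  have h : ∃ Q ∈ stopBoxes w (fun x => ‖f x‖ₑ) r, x ∈ box w Q := ⟨Q, hQ, hx⟩
  rw [good, dif_pos h]
  have : h.choose = Q := by
    by_contra hne
    exact Set.disjoint_left.1 (stopBoxes_disjoint _ r h.choose_spec.1 hQ hne) h.choose_spec.2 hx
  rw [this]

theorem good_of_notMem {f : (Fin n → ℝ) → ℂ} {r : ℝ≥0∞} {x : Fin n → ℝ}
    (hx : x ∉ stopSet w (fun x => ‖f x‖ₑ) r) : good w f r x = f x := by
  rw [good, dif_neg]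
  rintro ⟨Q, hQ, hxQ⟩
  exact hx (Set.mem_iUnion.2 ⟨⟨Q, hQ⟩, hxQ⟩)

theorem enorm_average_le {f : (Fin n → ℝ) → ℂ} {r : ℝ≥0∞} {Q : ℤ × (Fin n → ℤ)}
    (hQ : Q ∈ stopBoxes w (fun x => ‖f x‖ₑ) r) : ‖⨍ y in box w Q, f y‖ₑ ≤ 2 ^ hdim w * r := by
  rw [setAverage_eq, enorm_smul]
  have h1 : ‖(volume.real (box w Q))⁻¹‖ₑ = (bvol w Q)⁻¹ := by
    rw [Real.enorm_eq_ofReal (by positivity), measureReal_def, volume_box,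
      ENNReal.ofReal_inv_of_pos (ENNReal.toReal_pos (bvol_ne_zero Q) (bvol_ne_top Q)),
      ENNReal.ofReal_toReal (bvol_ne_top Q)]
  rw [h1, ← ENNReal.div_eq_inv_mul]
  refine ENNReal.div_le_of_le_mul ((enorm_integral_le_lintegral_enorm _).trans ?_)
  rw [mul_assoc]
  exact stopBoxes_mass_le hQ

theorem aestronglyMeasurable_good {f : (Fin n → ℝ) → ℂ} (hf : AEStronglyMeasurable f) (r : ℝ≥0∞) :
    AEStronglyMeasurable (good w f r) := by
  rw [← Measure.restrict_univ (μ := volume), ← Set.union_compl_self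
    (stopSet w (fun x => ‖f x‖ₑ) r), aestronglyMeasurable_union_iff]
  constructor
  · rw [stopSet, aestronglyMeasurable_iUnion_iff]
    intro Q
    refine (aestronglyMeasurable_const (b := ⨍ y in box w (Q : ℤ × (Fin n → ℤ)), f y)).congr ?_
    exact (ae_restrict_iff' (measurableSet_box _)).2
      (Filter.Eventually.of_forall fun x hx => (good_of_mem Q.2 hx).symm)
  · refine hf.restrict.congr ?_
    exact (ae_restrict_iff' (measurableSet_stopSet _ _).compl).2
      (Filter.Eventually.of_forall fun x hx => (good_of_notMem hx).symm)

theorem enorm_good_le_of_mem {f : (Fin n → ℝ) → ℂ} {r : ℝ≥0∞} {x : Fin n → ℝ}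
    (hx : x ∈ stopSet w (fun x => ‖f x‖ₑ) r) : ‖good w f r x‖ₑ ≤ 2 ^ hdim w * r := by
  obtain ⟨Q, hQ⟩ := Set.mem_iUnion.1 hx
  rw [good_of_mem Q.2 hQ]
  exact enorm_average_le Q.2

theorem volume_stopSet_ne_top {F : (Fin n → ℝ) → ℝ≥0∞} (hF : ∫⁻ y, F y ≠ ∞) {r : ℝ≥0∞}
    (hr : r ≠ 0) : volume (stopSet w F r) ≠ ∞ := by
  have h := volume_stopSet_le (w := w) F r
  intro htop
  rw [htop, ENNReal.mul_top hr, top_le_iff] at h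
  exact hF h

theorem nice_good {f : (Fin n → ℝ) → ℂ} (hf : Nice f) {r : ℝ≥0∞} (hr : r ≠ 0) (hrt : r ≠ ∞) :
    Nice (good w f r) := by
  set S := stopSet w (fun x => ‖f x‖ₑ) r with hS
  have hSm : MeasurableSet S := measurableSet_stopSet _ _
  have hfin : volume S ≠ ∞ := volume_stopSet_ne_top hf.1.2.ne hr
  refine ⟨⟨aestronglyMeasurable_good hf.1.aestronglyMeasurable r, ?_⟩, ?_⟩
  · rw [HasFiniteIntegral, ← lintegral_add_compl _ hSm]
    refine ENNReal.add_lt_top.2 ⟨?_, ?_⟩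
    · calc ∫⁻ x in S, ‖good w f r x‖ₑ ≤ ∫⁻ x in S, 2 ^ hdim w * r :=
            setLIntegral_mono' hSm fun x hx => enorm_good_le_of_mem hx
        _ < ∞ := by rw [setLIntegral_const]; finiteness
    · calc ∫⁻ x in Sᶜ, ‖good w f r x‖ₑ = ∫⁻ x in Sᶜ, ‖f x‖ₑ :=
            setLIntegral_congr_fun hSm.compl fun x hx => by simp only [good_of_notMem hx]
        _ ≤ ∫⁻ x, ‖f x‖ₑ := setLIntegral_le_lintegral _ _
        _ < ∞ := hf.1.2
  · obtain ⟨M, hM⟩ := hf.2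
    refine ⟨max M (2 ^ hdim w * r).toReal, fun x => ?_⟩
    by_cases hx : x ∈ S
    · refine le_max_of_le_right ?_
      rw [← toReal_enorm]
      exact ENNReal.toReal_mono (by finiteness) (enorm_good_le_of_mem hx)
    · rw [good_of_notMem hx]
      exact le_max_of_le_left (hM x)

theorem lintegral_good_sq_le (hw : ∀ k, 0 < w k) (hD : 0 < hdim w) {f : (Fin n → ℝ) → ℂ}
    (hf : Nice f) (hfc : Continuous f) {r : ℝ≥0∞} (hr : r ≠ 0) :
    ∫⁻ x, ‖good w f r x‖ₑ ^ (2 : ℝ) ≤ (2 ^ hdim w * r) ^ (2 : ℝ) *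
      volume (stopSet w (fun x => ‖f x‖ₑ) r) + ∫⁻ x in {x | ‖f x‖ₑ ≤ r}, ‖f x‖ₑ ^ (2 : ℝ) := by
  set S := stopSet w (fun x => ‖f x‖ₑ) r with hS
  have hSm : MeasurableSet S := measurableSet_stopSet _ _
  rw [← lintegral_add_compl _ hSm]
  refine add_le_add ?_ ?_
  · calc ∫⁻ x in S, ‖good w f r x‖ₑ ^ (2 : ℝ) ≤ ∫⁻ x in S, (2 ^ hdim w * r) ^ (2 : ℝ) :=
          setLIntegral_mono' hSm fun x hx =>
            ENNReal.rpow_le_rpow (enorm_good_le_of_mem hx) (by norm_num)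
      _ = _ := setLIntegral_const _ _
  · calc ∫⁻ x in Sᶜ, ‖good w f r x‖ₑ ^ (2 : ℝ) = ∫⁻ x in Sᶜ, ‖f x‖ₑ ^ (2 : ℝ) :=
          setLIntegral_congr_fun hSm.compl fun x hx => by simp only [good_of_notMem hx]
      _ ≤ _ := lintegral_mono_set fun x hx =>
          le_of_notMem_stopSet hw hD hfc.enorm hf.1.2.ne hr hx

theorem integral_bad_eq_zero {f : (Fin n → ℝ) → ℂ} (hf : Nice f) {r : ℝ≥0∞} (hr : r ≠ 0)
    (hrt : r ≠ ∞) {Q : ℤ × (Fin n → ℤ)} (hQ : Q ∈ stopBoxes w (fun x => ‖f x‖ₑ) r) :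
    ∫ x in box w Q, (f x - good w f r x) = 0 := by
  rw [integral_sub hf.1.integrableOn (nice_good hf hr hrt).1.integrableOn,
    setIntegral_congr_fun (measurableSet_box Q) fun x hx => good_of_mem hQ hx, setIntegral_const,
    setAverage_eq, smul_smul, mul_inv_cancel₀, one_smul, sub_self]
  rw [measureReal_def, volume_box]
  exact (ENNReal.toReal_pos (bvol_ne_zero Q) (bvol_ne_top Q)).ne'

theorem lintegral_bad_le {f : (Fin n → ℝ) → ℂ} {r : ℝ≥0∞}
    {Q : ℤ × (Fin n → ℤ)} (hQ : Q ∈ stopBoxes w (fun x => ‖f x‖ₑ) r) :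
    ∫⁻ x in box w Q, ‖f x - good w f r x‖ₑ ≤ 2 * 2 ^ hdim w * r * bvol w Q := by
  calc ∫⁻ x in box w Q, ‖f x - good w f r x‖ₑ
      ≤ ∫⁻ x in box w Q, (‖f x‖ₑ + 2 ^ hdim w * r) := by
        refine setLIntegral_mono' (measurableSet_box Q) fun x hx => enorm_sub_le.trans ?_
        gcongr
        rw [good_of_mem hQ hx]
        exact enorm_average_le hQ
    _ = (∫⁻ x in box w Q, ‖f x‖ₑ) + 2 ^ hdim w * r * bvol w Q := by
        rw [lintegral_add_right _ measurable_const, setLIntegral_const, volume_box]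
    _ ≤ 2 ^ hdim w * (r * bvol w Q) + 2 ^ hdim w * r * bvol w Q := by
        gcongr; exact stopBoxes_mass_le hQ
    _ = _ := by ring

variable (w) in
/-- Calderón–Zygmund kernels adapted to the dyadic anisotropic boxes. -/
structure IsCZ (A : ℝ≥0) (K : (Fin n → ℝ) → ℝ) : Prop where
  nice : Nice K
  cont : Continuous K
  sq : ∀ f : (Fin n → ℝ) → ℂ, Nice f →
    ∫⁻ x, ‖cv K f x‖ₑ ^ (2 : ℝ) ≤ A * ∫⁻ x, ‖f x‖ₑ ^ (2 : ℝ)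
  smooth : ∀ (Q : ℤ × (Fin n → ℤ)) (y c : Fin n → ℝ), y ∈ box w Q → c ∈ box w Q →
    ∫⁻ x in (nbox w Q)ᶜ, ‖K (x - y) - K (x - c)‖ₑ ≤ A

theorem box_nonempty (Q : ℤ × (Fin n → ℤ)) : (box w Q).Nonempty :=
  nonempty_of_measure_ne_zero (μ := volume) (by rw [volume_box]; exact bvol_ne_zero Q)

/-- A point of a dyadic box. -/
def pt (Q : ℤ × (Fin n → ℤ)) : Fin n → ℝ := (box_nonempty (w := w) Q).some

theorem pt_mem (Q : ℤ × (Fin n → ℤ)) : pt (w := w) Q ∈ box w Q := (box_nonempty Q).some_mem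

theorem enorm_cv_bad_le {K : (Fin n → ℝ) → ℝ} (hK : Nice K) {f : (Fin n → ℝ) → ℂ} (hf : Nice f)
    {r : ℝ≥0∞} (hr : r ≠ 0) (hrt : r ≠ ∞) (x : Fin n → ℝ) :
    ‖cv K (fun y => f y - good w f r y) x‖ₑ ≤ ∑' Q : stopBoxes w (fun x => ‖f x‖ₑ) r,
      ∫⁻ y in box w Q, ‖K (x - y) - K (x - pt (w := w) Q)‖ₑ * ‖f y - good w f r y‖ₑ := by
  have hb : Nice fun y => f y - good w f r y := hf.sub (nice_good hf hr hrt)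
  have hint := hK.integrand hb x
  have h0 : cv K (fun y => f y - good w f r y) x
      = ∫ y in stopSet w (fun x => ‖f x‖ₑ) r, K (x - y) • (f y - good w f r y) := by
    rw [cv, setIntegral_eq_integral_of_forall_compl_eq_zero]
    intro y hy
    rw [good_of_notMem hy, sub_self, smul_zero]
  rw [h0, stopSet, ← (hasSum_integral_iUnion (fun Q => measurableSet_box _)
    (stopBoxes_pairwise _ r) hint.integrableOn).tsum_eq]
  refine enorm_tsum_le_tsum_enorm.trans (ENNReal.tsum_le_tsum fun Q => ?_)
  have h1 : ∫ y in box w Q, K (x - y) • (f y - good w f r y)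
      = ∫ y in box w Q, (K (x - y) - K (x - pt (w := w) Q)) • (f y - good w f r y) := by
    simp_rw [sub_smul]
    have hc : IntegrableOn (fun y => K (x - pt (w := w) Q) • (f y - good w f r y)) (box w Q) :=
      hb.1.integrableOn.smul (K (x - pt (w := w) Q))
    rw [integral_sub hint.integrableOn hc, integral_smul,
      integral_bad_eq_zero hf hr hrt Q.2, smul_zero, sub_zero]
  rw [h1]
  refine (enorm_integral_le_lintegral_enorm _).trans (le_of_eq ?_)
  simp only [enorm_smul]

theorem lintegral_cv_bad_le {A : ℝ≥0} {K : (Fin n → ℝ) → ℝ} (hK : IsCZ w A K)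
    {f : (Fin n → ℝ) → ℂ} (hf : Nice f) {r : ℝ≥0∞} (hr : r ≠ 0) (hrt : r ≠ ∞) :
    ∫⁻ x in (nstopSet w (fun x => ‖f x‖ₑ) r)ᶜ, ‖cv K (fun y => f y - good w f r y) x‖ₑ
      ≤ A * (2 * 2 ^ hdim w * r) * volume (stopSet w (fun x => ‖f x‖ₑ) r) := by
  set N := nstopSet w (fun x => ‖f x‖ₑ) r
  have hb : Nice fun y => f y - good w f r y := hf.sub (nice_good hf hr hrt)
  have hbm : AEMeasurable fun y => ‖f y - good w f r y‖ₑ := hb.1.aestronglyMeasurable.enorm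
  have hmeas : ∀ (Q : ℤ × (Fin n → ℤ)) (μ ν : Measure (Fin n → ℝ)) [SFinite μ] [SFinite ν], ν ≪ volume → AEMeasurable
      (Function.uncurry fun x y => ‖K (x - y) - K (x - pt (w := w) Q)‖ₑ * ‖f y - good w f r y‖ₑ)
      (μ.prod ν) := by
    intro Q μ ν _ _ hν
    have hc : Continuous fun z : (Fin n → ℝ) × (Fin n → ℝ) =>
        K (z.1 - z.2) - K (z.1 - pt (w := w) Q) :=
      (hK.cont.comp (continuous_fst.sub continuous_snd)).sub
        (hK.cont.comp (continuous_fst.sub continuous_const))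
    refine AEMeasurable.mul (f := fun z : (Fin n → ℝ) × (Fin n → ℝ) =>
      ‖K (z.1 - z.2) - K (z.1 - pt (w := w) Q)‖ₑ) hc.measurable.enorm.aemeasurable ?_
    exact (hbm.mono_ac hν).comp_quasiMeasurePreserving Measure.quasiMeasurePreserving_snd
  calc ∫⁻ x in Nᶜ, ‖cv K (fun y => f y - good w f r y) x‖ₑ
      ≤ ∫⁻ x in Nᶜ, ∑' Q : stopBoxes w (fun x => ‖f x‖ₑ) r,
        ∫⁻ y in box w Q, ‖K (x - y) - K (x - pt (w := w) Q)‖ₑ * ‖f y - good w f r y‖ₑ :=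
        lintegral_mono fun x => enorm_cv_bad_le hK.nice hf hr hrt x
    _ = ∑' Q : stopBoxes w (fun x => ‖f x‖ₑ) r, ∫⁻ x in Nᶜ,
        ∫⁻ y in box w Q, ‖K (x - y) - K (x - pt (w := w) Q)‖ₑ * ‖f y - good w f r y‖ₑ :=
        lintegral_tsum fun Q => (hmeas Q _ _ Measure.absolutelyContinuous_restrict).lintegral_prod_right'
    _ = ∑' Q : stopBoxes w (fun x => ‖f x‖ₑ) r, ∫⁻ y in box w Q,
        ∫⁻ x in Nᶜ, ‖K (x - y) - K (x - pt (w := w) Q)‖ₑ * ‖f y - good w f r y‖ₑ := by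
        refine tsum_congr fun Q => lintegral_lintegral_swap (hmeas Q _ _ Measure.absolutelyContinuous_restrict)
    _ ≤ ∑' Q : stopBoxes w (fun x => ‖f x‖ₑ) r, ∫⁻ y in box w Q, A * ‖f y - good w f r y‖ₑ := by
        refine ENNReal.tsum_le_tsum fun Q => setLIntegral_mono' (measurableSet_box _) fun y hy => ?_
        rw [lintegral_mul_const' _ _ (by simp)]
        gcongr
        refine le_trans (lintegral_mono_set ?_) (hK.smooth Q y _ hy (pt_mem _))
        exact Set.compl_subset_compl.2 (Set.subset_iUnion (fun Q : stopBoxes w (fun x => ‖f x‖ₑ) r => nbox w Q) Q)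
    _ ≤ ∑' Q : stopBoxes w (fun x => ‖f x‖ₑ) r, A * (2 * 2 ^ hdim w * r) * bvol w Q := by
        refine ENNReal.tsum_le_tsum fun Q => ?_
        rw [lintegral_const_mul' _ _ (by simp), mul_assoc]
        gcongr
        exact lintegral_bad_le Q.2
    _ = _ := by rw [ENNReal.tsum_mul_left, volume_stopSet]

variable (w) in
/-- The constant in the weak-type inequality. -/
def weakConst (A : ℝ≥0) : ℝ≥0∞ := A * (2 ^ hdim w) ^ (2 : ℝ) + 1 + A * (2 * 2 ^ hdim w)

theorem volume_lt_cv_le (hw : ∀ k, 0 < w k) (hD : 0 < hdim w) {A : ℝ≥0} {K : (Fin n → ℝ) → ℝ}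
    (hK : IsCZ w A K) {f : (Fin n → ℝ) → ℂ} (hf : Nice f) (hfc : Continuous f) {r : ℝ≥0∞}
    (hr : r ≠ 0) (hrt : r ≠ ∞) :
    volume {x | 2 * r < ‖cv K f x‖ₑ} ≤ weakConst w A * volume {x | r < maxFun w (fun x => ‖f x‖ₑ) x}
      + A * (r ^ (-2 : ℝ) * ∫⁻ x in {x | ‖f x‖ₑ ≤ r}, ‖f x‖ₑ ^ (2 : ℝ)) := by
  set N := nstopSet w (fun x => ‖f x‖ₑ) r with hN
  set S := stopSet w (fun x => ‖f x‖ₑ) r with hS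
  have hset : {x | r < maxFun w (fun x => ‖f x‖ₑ) x} = N := by
    ext x; exact lt_maxFun_iff hD hf.1.2.ne hr x
  rw [hset]
  have hg := nice_good (w := w) hf hr hrt
  have hb : Nice fun y => f y - good w f r y := hf.sub hg
  have hsplit : ∀ x, cv K f x = cv K (good w f r) x + cv K (fun y => f y - good w f r y) x := by
    intro x
    rw [← cv_add_right hK.nice hg hb]
    simp
  have hsub : {x | 2 * r < ‖cv K f x‖ₑ} ⊆ {x | r ≤ ‖cv K (good w f r) x‖ₑ} ∪ N ∪
      ({x | r ≤ ‖cv K (fun y => f y - good w f r y) x‖ₑ} ∩ Nᶜ) := by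
    intro x hx
    by_cases h1 : x ∈ N
    · exact Or.inl (Or.inr h1)
    by_cases h2 : r ≤ ‖cv K (good w f r) x‖ₑ
    · exact Or.inl (Or.inl h2)
    refine Or.inr ⟨?_, h1⟩
    by_contra h3
    have h3' : ‖cv K (fun y => f y - good w f r y) x‖ₑ < r := not_le.1 h3
    have hx' : 2 * r < ‖cv K f x‖ₑ := hx
    rw [hsplit] at hx'
    have := (hx'.trans_le (enorm_add_le _ _)).trans (ENNReal.add_lt_add (not_le.1 h2) h3')
    rw [two_mul] at this
    exact lt_irrefl _ this
  have hSN : volume S ≤ volume N := measure_mono (stopSet_subset _ _)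
  have hrr : r ^ (-2 : ℝ) * r ^ (2 : ℝ) = 1 := by
    rw [← ENNReal.rpow_add _ _ hr hrt]; norm_num
  have e1 : volume {x | r ≤ ‖cv K (good w f r) x‖ₑ} ≤ A * (2 ^ hdim w) ^ (2 : ℝ) * volume N
      + A * (r ^ (-2 : ℝ) * ∫⁻ x in {x | ‖f x‖ₑ ≤ r}, ‖f x‖ₑ ^ (2 : ℝ)) := by
    have hm := mul_meas_ge_le_lintegral₀ (μ := volume)
      ((hK.nice.cv hg).1.aestronglyMeasurable.enorm.pow_const (2 : ℝ)) (r ^ (2 : ℝ))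
    have heq : {x | r ^ (2 : ℝ) ≤ ‖cv K (good w f r) x‖ₑ ^ (2 : ℝ)}
        = {x | r ≤ ‖cv K (good w f r) x‖ₑ} := by
      ext x
      exact ENNReal.rpow_le_rpow_iff (by norm_num)
    rw [heq] at hm
    calc volume {x | r ≤ ‖cv K (good w f r) x‖ₑ}
        = r ^ (-2 : ℝ) * (r ^ (2 : ℝ) * volume {x | r ≤ ‖cv K (good w f r) x‖ₑ}) := by
          rw [← mul_assoc, hrr, one_mul]
      _ ≤ r ^ (-2 : ℝ) * (A * ((2 ^ hdim w * r) ^ (2 : ℝ) * volume N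
            + ∫⁻ x in {x | ‖f x‖ₑ ≤ r}, ‖f x‖ₑ ^ (2 : ℝ))) := by
          gcongr r ^ (-2 : ℝ) * ?_
          refine hm.trans ((hK.sq _ hg).trans ?_)
          gcongr
          refine (lintegral_good_sq_le hw hD hf hfc hr).trans ?_
          gcongr
      _ = (r ^ (-2 : ℝ) * r ^ (2 : ℝ)) * (A * (2 ^ hdim w) ^ (2 : ℝ) * volume N)
          + A * (r ^ (-2 : ℝ) * ∫⁻ x in {x | ‖f x‖ₑ ≤ r}, ‖f x‖ₑ ^ (2 : ℝ)) := by
          rw [ENNReal.mul_rpow_of_nonneg _ _ (by norm_num : (0 : ℝ) ≤ 2)]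
          ring
      _ = _ := by rw [hrr, one_mul]
  have e2 : volume ({x | r ≤ ‖cv K (fun y => f y - good w f r y) x‖ₑ} ∩ Nᶜ)
      ≤ A * (2 * 2 ^ hdim w) * volume N := by
    have hm := mul_meas_ge_le_lintegral₀ (μ := volume.restrict Nᶜ)
      ((hK.nice.cv hb).1.aestronglyMeasurable.enorm.restrict) r
    rw [Measure.restrict_apply' (measurableSet_nstopSet _ _).compl] at hm
    have h := hm.trans (lintegral_cv_bad_le hK hf hr hrt)
    refine (ENNReal.mul_le_mul_iff_right hr hrt).1 (h.trans ?_)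
    calc A * (2 * 2 ^ hdim w * r) * volume S ≤ A * (2 * 2 ^ hdim w * r) * volume N := by gcongr
      _ = _ := by ring
  calc volume {x | 2 * r < ‖cv K f x‖ₑ}
      ≤ volume {x | r ≤ ‖cv K (good w f r) x‖ₑ} + volume N +
        volume ({x | r ≤ ‖cv K (fun y => f y - good w f r y) x‖ₑ} ∩ Nᶜ) :=
        (measure_mono hsub).trans ((measure_union_le _ _).trans
          (by gcongr; exact measure_union_le _ _))
    _ ≤ (A * (2 ^ hdim w) ^ (2 : ℝ) * volume N
      + A * (r ^ (-2 : ℝ) * ∫⁻ x in {x | ‖f x‖ₑ ≤ r}, ‖f x‖ₑ ^ (2 : ℝ))) + volume N +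
        A * (2 * 2 ^ hdim w) * volume N := by gcongr
    _ = _ := by rw [weakConst]; ring

theorem lintegral_cv_rpow_le_of_lt_two (hw : ∀ k, 0 < w k) (hD : 0 < hdim w) (A : ℝ≥0) {p : ℝ}
    (hp : 1 < p) (hp2 : p < 2) : ∃ C : ℝ≥0, ∀ K : (Fin n → ℝ) → ℝ, IsCZ w A K →
      ∀ f : (Fin n → ℝ) → ℂ, Nice f → Continuous f →
      ∫⁻ x, ‖cv K f x‖ₑ ^ p ≤ C * ∫⁻ x, ‖f x‖ₑ ^ p := by
  set C : ℝ≥0∞ := 2 ^ p * (weakConst w A * maxConst n p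
    + ENNReal.ofReal p * A * ENNReal.ofReal (2 - p)⁻¹) with hC
  have hCt : C ≠ ∞ := by
    have h1 := maxConst_ne_top (n := n) hp
    have h2 : (2 : ℝ≥0∞) ^ p ≠ ∞ := ENNReal.rpow_ne_top_of_nonneg (by linarith) (by norm_num)
    have h3 : weakConst w A ≠ ∞ := by
      have : ((2 : ℝ≥0∞) ^ hdim w) ^ (2 : ℝ) ≠ ∞ :=
        ENNReal.rpow_ne_top_of_nonneg (by norm_num) (by finiteness)
      unfold weakConst
      finiteness
    finiteness
  refine ⟨C.toNNReal, fun K hK f hf hfc => ?_⟩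
  rw [ENNReal.coe_toNNReal hCt]
  have hTc : Continuous (cv K f) := continuous_cv hK.nice hK.cont hf
  set T : (Fin n → ℝ) → ℝ≥0∞ := fun x => ‖cv K f x‖ₑ / 2 with hT
  have hTm : Measurable T := hTc.measurable.enorm.div_const 2
  have hTt : ∀ x, T x ≠ ∞ := fun x => by simp only [hT]; finiteness
  have hfm : Measurable fun x => ‖f x‖ₑ := hfc.measurable.enorm
  have e0 : ∫⁻ x, ‖cv K f x‖ₑ ^ p = 2 ^ p * ∫⁻ x, T x ^ p := by
    rw [← lintegral_const_mul _ (by fun_prop)]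
    refine lintegral_congr fun x => ?_
    rw [← ENNReal.mul_rpow_of_nonneg _ _ (by linarith), hT,
      ENNReal.mul_div_cancel (by norm_num) (by norm_num)]
  rw [e0, hC, mul_assoc]
  gcongr 2 ^ p * ?_
  rw [lintegral_rpow_eq_measure_lt (by linarith) hTm hTt]
  have hG := lintegral_rpow_mul_setLIntegral_le (μ := (volume : Measure (Fin n → ℝ)))
    (b := 2 - p) (by linarith) (G := fun x => ‖f x‖ₑ) hfm (by simp)
    (H := fun x => ‖f x‖ₑ ^ (2 : ℝ)) (by fun_prop)
  calc _ ≤ ENNReal.ofReal p * ∫⁻ t in Set.Ioi (0 : ℝ),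
        (weakConst w A * (ENNReal.ofReal (t ^ (p - 1)) *
          volume {x | ENNReal.ofReal t < maxFun w (fun x => ‖f x‖ₑ) x})
        + A * (ENNReal.ofReal (t ^ (-(2 - p) - 1)) *
          ∫⁻ x in {x | ‖f x‖ₑ ≤ ENNReal.ofReal t}, ‖f x‖ₑ ^ (2 : ℝ))) := by
        gcongr ENNReal.ofReal p * ?_
        refine setLIntegral_mono' measurableSet_Ioi fun t ht => ?_
        have ht' : (0 : ℝ) < t := ht
        have h := volume_lt_cv_le hw hD hK hf hfc (r := ENNReal.ofReal t)
          (by simpa using ht') ENNReal.ofReal_ne_top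
        have hset : {x | ENNReal.ofReal t < T x} = {x | 2 * ENNReal.ofReal t < ‖cv K f x‖ₑ} := by
          ext y
          simp only [Set.mem_ofPred_eq, hT]
          rw [ENNReal.lt_div_iff_mul_lt (by norm_num) (by norm_num), mul_comm]
        rw [hset]
        refine (mul_le_mul_right h _).trans (le_of_eq ?_)
        rw [mul_add, mul_left_comm, mul_left_comm _ (A : ℝ≥0∞), ← mul_assoc _ (_ ^ (-2 : ℝ)),
          ENNReal.ofReal_rpow_of_pos ht', ← ENNReal.ofReal_mul (by positivity),
          ← Real.rpow_add ht', show p - 1 + -2 = -(2 - p) - 1 by ring]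
    _ ≤ weakConst w A * (ENNReal.ofReal p * ∫⁻ t in Set.Ioi (0 : ℝ), ENNReal.ofReal (t ^ (p - 1)) *
          volume {x | ENNReal.ofReal t < maxFun w (fun x => ‖f x‖ₑ) x})
        + ENNReal.ofReal p * A * ∫⁻ t in Set.Ioi (0 : ℝ), ENNReal.ofReal (t ^ (-(2 - p) - 1)) *
          ∫⁻ x in {x | ‖f x‖ₑ ≤ ENNReal.ofReal t}, ‖f x‖ₑ ^ (2 : ℝ) := by
        rw [lintegral_add_left, lintegral_const_mul, lintegral_const_mul' _ _ ENNReal.coe_ne_top]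
        · apply le_of_eq; ring
        · have : Measurable fun t : ℝ =>
              volume {x | ENNReal.ofReal t < maxFun w (fun x => ‖f x‖ₑ) x} :=
            Antitone.measurable fun s t hst => measure_mono fun x hx =>
              lt_of_le_of_lt (ENNReal.ofReal_le_ofReal hst) hx
          fun_prop
        · have : Measurable fun t : ℝ =>
              volume {x | ENNReal.ofReal t < maxFun w (fun x => ‖f x‖ₑ) x} :=
            Antitone.measurable fun s t hst => measure_mono fun x hx =>
              lt_of_le_of_lt (ENNReal.ofReal_le_ofReal hst) hx
          fun_prop
    _ ≤ weakConst w A * (maxConst n p * ∫⁻ x, ‖f x‖ₑ ^ p) + ENNReal.ofReal p * A *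
        (ENNReal.ofReal (2 - p)⁻¹ * ∫⁻ x, ‖f x‖ₑ ^ p) := by
        refine add_le_add (mul_le_mul_right ?_ _) (mul_le_mul_right ?_ _)
        · exact lintegral_rpow_volume_maxFun_le hD hfm hf.1.2.ne (by simp) hp
        · refine hG.trans (le_of_eq ?_)
          congr 1
          refine lintegral_congr fun x => ?_
          rcases eq_or_ne (‖f x‖ₑ) 0 with h0 | h0
          · rw [h0, ENNReal.zero_rpow_of_pos (by norm_num : (0 : ℝ) < 2), mul_zero,
              ENNReal.zero_rpow_of_pos (by linarith)]
          · rw [← ENNReal.rpow_add _ _ h0 (by simp)]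
            congr 1; ring
    _ = _ := by ring

end

section

open scoped ENNReal NNReal ComplexConjugate

variable {n : ℕ} {w : Fin n → ℕ}

theorem lintegral_cv_rpow_le_of_dual {K : (Fin n → ℝ) → ℝ} (hK : Nice K) (hKc : Continuous K)
    {p p' : ℝ} (hp : 2 < p) (hpp : p.HolderConjugate p') {C : ℝ≥0}
    (hC : ∀ g : (Fin n → ℝ) → ℂ, Nice g → Continuous g →
      ∫⁻ x, ‖cv (fun z => K (-z)) g x‖ₑ ^ p' ≤ C * ∫⁻ x, ‖g x‖ₑ ^ p')
    {f : (Fin n → ℝ) → ℂ} (hf : Nice f) :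
    ∫⁻ x, ‖cv K f x‖ₑ ^ p ≤ (C : ℝ≥0∞) ^ (p - 1) * ∫⁻ x, ‖f x‖ₑ ^ p := by
  set W := cv K f with hW
  have hWn : Nice W := hK.cv hf
  have hWc : Continuous W := continuous_cv hK hKc hf
  set g : (Fin n → ℝ) → ℂ := fun x => ((‖W x‖ ^ (p - 2) : ℝ) : ℂ) * conj (W x) with hg
  have hgnorm : ∀ x, ‖g x‖ = ‖W x‖ ^ (p - 1) := fun x => by
    rw [hg]
    simp only [norm_mul, Complex.norm_real, RCLike.norm_conj, Real.norm_eq_abs]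
    rw [abs_of_nonneg (by positivity), show p - 1 = (p - 2) + 1 by ring,
      Real.rpow_add_one' (norm_nonneg _) (by linarith)]
  have hgen : ∀ x, ‖g x‖ₑ = ‖W x‖ₑ ^ (p - 1) := fun x => by
    rw [← ofReal_norm, hgnorm, ← ofReal_norm, ENNReal.ofReal_rpow_of_nonneg (norm_nonneg _) (by linarith)]
  have hgc : Continuous g :=
    (Complex.continuous_ofReal.comp
      (hWc.norm.rpow_const fun x => Or.inr (by linarith))).mul (Complex.continuous_conj.comp hWc)
  have hgn : Nice g := by
    refine ⟨⟨hgc.aestronglyMeasurable, ?_⟩, ?_⟩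
    · rw [HasFiniteIntegral]
      simp_rw [hgen]
      exact hWn.lintegral_rpow_lt_top (by linarith)
    · obtain ⟨M, hM⟩ := hWn.2
      refine ⟨M ^ (p - 1), fun x => ?_⟩
      rw [hgnorm]
      exact Real.rpow_le_rpow (norm_nonneg _) (hM x) (by linarith)
  set I := ∫⁻ x, ‖W x‖ₑ ^ p with hI
  have hIt : I ≠ ∞ := (hWn.lintegral_rpow_lt_top (by linarith)).ne
  have hWg : ∀ x, W x * g x = ((‖W x‖ ^ p : ℝ) : ℂ) := fun x => by
    rw [hg]
    simp only
    rw [mul_left_comm, Complex.mul_conj, ← Complex.ofReal_mul, Complex.normSq_eq_norm_sq]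
    congr 1
    rcases eq_or_ne ‖W x‖ 0 with h0 | h0
    · rw [h0, Real.zero_rpow (show p ≠ 0 by linarith)]; simp
    · rw [← Real.rpow_natCast, ← Real.rpow_add (by positivity)]
      congr 1; push_cast; ring
  have e1 : I = ‖∫ x, W x * g x‖ₑ := by
    simp_rw [hWg]
    rw [integral_complex_ofReal, ← ofReal_norm, Complex.norm_real, Real.norm_of_nonneg
      (integral_nonneg fun x => by positivity), ofReal_integral_eq_lintegral_ofReal]
    · refine lintegral_congr fun x => ?_
      rw [← ofReal_norm, ENNReal.ofReal_rpow_of_nonneg (norm_nonneg _) (by linarith)]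
    · refine ⟨(hWc.norm.rpow_const fun x => Or.inr (by linarith)).aestronglyMeasurable, ?_⟩
      rw [HasFiniteIntegral]
      refine lt_of_le_of_lt (le_of_eq (lintegral_congr fun x => ?_)) hIt.lt_top
      rw [Real.enorm_eq_ofReal (by positivity), ← ofReal_norm,
        ENNReal.ofReal_rpow_of_nonneg (norm_nonneg _) (by linarith)]
    · exact Filter.Eventually.of_forall fun x => by positivity
  have hgI : ∫⁻ x, ‖g x‖ₑ ^ p' = I := by
    refine lintegral_congr fun x => ?_
    rw [hgen, ← ENNReal.rpow_mul, hpp.sub_one_mul_conj]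
  have e2 : I ≤ (∫⁻ x, ‖f x‖ₑ ^ p) ^ (1 / p) * (C * I) ^ (1 / p') := by
    calc I = ‖∫ x, f x * cv (fun z => K (-z)) g x‖ₑ := by
          rw [← integral_cv_mul hK hf hgn]
          exact e1
      _ ≤ ∫⁻ x, ‖f x‖ₑ * ‖cv (fun z => K (-z)) g x‖ₑ := by
          refine (enorm_integral_le_lintegral_enorm _).trans (le_of_eq ?_)
          simp only [enorm_mul]
      _ ≤ (∫⁻ x, ‖f x‖ₑ ^ p) ^ (1 / p) * (∫⁻ x, ‖cv (fun z => K (-z)) g x‖ₑ ^ p') ^ (1 / p') :=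
          ENNReal.lintegral_mul_le_Lp_mul_Lq _ hpp hf.1.aestronglyMeasurable.enorm
            (hK.neg_arg.cv hgn).1.aestronglyMeasurable.enorm
      _ ≤ _ := by
          have := hpp.symm.pos
          gcongr
          rw [← hgI]
          exact hC g hgn hgc
  rcases eq_or_ne I 0 with h0 | h0
  · rw [h0]; exact zero_le
  have hp0 : 0 < p := by linarith
  have e3 : I ^ (1 / p) ≤ (∫⁻ x, ‖f x‖ₑ ^ p) ^ (1 / p) * (C : ℝ≥0∞) ^ (1 / p') := by
    have hI' : I = I ^ (1 / p) * I ^ (1 / p') := by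
      rw [← ENNReal.rpow_add _ _ h0 hIt]
      have := hpp.inv_add_inv_eq_one
      rw [one_div, one_div, this, ENNReal.rpow_one]
    have hne : I ^ (1 / p') ≠ 0 := by simp [h0, hIt]
    have hnt : I ^ (1 / p') ≠ ∞ := by
      refine ENNReal.rpow_ne_top_of_nonneg ?_ hIt
      have := hpp.symm.pos
      positivity
    refine (ENNReal.mul_le_mul_iff_left hne hnt).1 ?_
    rw [← hI']
    refine e2.trans (le_of_eq ?_)
    rw [ENNReal.mul_rpow_of_nonneg _ _ (by have := hpp.symm.pos; positivity), mul_assoc]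
  have e4 := ENNReal.rpow_le_rpow e3 hp0.le
  rw [ENNReal.mul_rpow_of_nonneg _ _ hp0.le, ← ENNReal.rpow_mul, ← ENNReal.rpow_mul,
    ← ENNReal.rpow_mul, one_div_mul_cancel hp0.ne', ENNReal.rpow_one, ENNReal.rpow_one, mul_comm] at e4
  refine e4.trans (le_of_eq ?_)
  congr 2
  have := hpp.sub_one_mul_conj
  have h' := hpp.symm.ne_zero
  field_simp
  linarith

theorem lintegral_cv_rpow_le_of_isCZ (hw : ∀ k, 0 < w k) (hD : 0 < hdim w) (A : ℝ≥0) {p : ℝ}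
    (hp : 1 < p) : ∃ C : ℝ≥0, ∀ K : (Fin n → ℝ) → ℝ, IsCZ w A K → IsCZ w A (fun z => K (-z)) →
      ∀ f : (Fin n → ℝ) → ℂ, Nice f → Continuous f →
      ∫⁻ x, ‖cv K f x‖ₑ ^ p ≤ C * ∫⁻ x, ‖f x‖ₑ ^ p := by
  rcases lt_trichotomy p 2 with h | h | h
  · obtain ⟨C, hC⟩ := lintegral_cv_rpow_le_of_lt_two hw hD A hp h
    exact ⟨C, fun K hK _ f hf hfc => hC K hK f hf hfc⟩
  · subst h
    exact ⟨A, fun K hK _ f hf _ => hK.sq f hf⟩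
  · have hpp := Real.HolderConjugate.conjExponent hp
    have h2 : p.conjExponent < 2 := by
      rw [Real.conjExponent, div_lt_iff₀ (by linarith)]; linarith
    obtain ⟨C, hC⟩ := lintegral_cv_rpow_le_of_lt_two hw hD A hpp.symm.lt h2
    refine ⟨C ^ (p - 1), fun K hK hK' f hf _ => ?_⟩
    rw [ENNReal.coe_rpow_of_nonneg _ (by linarith)]
    exact lintegral_cv_rpow_le_of_dual hK.nice hK.cont h hpp (fun g hg hgc => hC _ hK' g hg hgc) hf

end

section

open scoped ENNReal NNReal ComplexConjugate

variable {n : ℕ} {w : Fin n → ℕ}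

/-- The total mass of the two-sided geometric sequence `2 ^ (-|m|)`. -/
def geomMass : ℝ≥0∞ := ∑' m : ℤ, ENNReal.ofReal ((2 : ℝ) ^ (-|m|))

theorem geomMass_ne_top : geomMass ≠ ∞ := by
  have h : Summable fun m : ℤ => (2 : ℝ) ^ (-|m|) := by
    refine Summable.of_nat_of_neg ?_ ?_ <;>
    · refine (summable_geometric_of_lt_one (r := (1 / 2 : ℝ)) (by norm_num) (by norm_num)).congr
        fun k => ?_
      simp
  exact h.tsum_ofReal_ne_top

theorem sum_geom_le (J : Finset ℤ) (i : ℤ) :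
    ∑ j ∈ J, ENNReal.ofReal ((2 : ℝ) ^ (-|j - i|)) ≤ geomMass := by
  refine (ENNReal.sum_le_tsum J).trans (le_of_eq ?_)
  exact (Equiv.subRight i).tsum_eq fun m : ℤ => ENNReal.ofReal ((2 : ℝ) ^ (-|m|))

theorem lintegral_mul_le_sq {f g : (Fin n → ℝ) → ℂ} (hf : Nice f) (hg : Nice g) :
    ‖∫ x, f x * g x‖ₑ ≤ (∫⁻ x, ‖f x‖ₑ ^ (2 : ℝ)) ^ (1 / 2 : ℝ)
      * (∫⁻ x, ‖g x‖ₑ ^ (2 : ℝ)) ^ (1 / 2 : ℝ) := by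
  refine (enorm_integral_le_lintegral_enorm _).trans ?_
  simp only [enorm_mul]
  exact ENNReal.lintegral_mul_le_Lp_mul_Lq _ Real.HolderConjugate.two_two
    hf.1.aestronglyMeasurable.enorm hg.1.aestronglyMeasurable.enorm

theorem Nice.conj {f : (Fin n → ℝ) → ℂ} (hf : Nice f) : Nice fun x => conj (f x) := by
  obtain ⟨M, hM⟩ := hf.2
  refine ⟨?_, M, fun x => by simpa using hM x⟩
  refine ⟨Complex.continuous_conj.comp_aestronglyMeasurable hf.1.aestronglyMeasurable, ?_⟩
  have := hf.1.2
  rw [HasFiniteIntegral] at this ⊢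
  simpa only [RCLike.enorm_conj] using this

theorem cv_conj (K : (Fin n → ℝ) → ℝ) (f : (Fin n → ℝ) → ℂ) (x : Fin n → ℝ) :
    cv K (fun x => conj (f x)) x = conj (cv K f x) := by
  rw [cv, cv, ← integral_conj]
  congr 1; ext y
  simp

theorem lintegral_sq_eq {f : (Fin n → ℝ) → ℂ} (hf : Nice f) :
    ∫⁻ x, ‖f x‖ₑ ^ (2 : ℝ) = ‖∫ x, f x * conj (f x)‖ₑ := by
  have h1 : ∀ x, f x * conj (f x) = ((‖f x‖ ^ 2 : ℝ) : ℂ) := fun x => by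
    rw [Complex.mul_conj, Complex.normSq_eq_norm_sq]
  have h2 : ∀ x, ‖f x‖ₑ ^ (2 : ℝ) = ENNReal.ofReal (‖f x‖ ^ 2) := fun x => by
    rw [← ofReal_norm, ENNReal.ofReal_pow (norm_nonneg _)]
    exact_mod_cast ENNReal.rpow_natCast _ 2
  simp_rw [h1]
  rw [integral_complex_ofReal, ← ofReal_norm, Complex.norm_real, Real.norm_of_nonneg
    (integral_nonneg fun x => by positivity), ofReal_integral_eq_lintegral_ofReal]
  · exact lintegral_congr h2
  · refine ⟨(hf.1.aestronglyMeasurable.norm.pow 2), ?_⟩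
    rw [HasFiniteIntegral]
    refine lt_of_le_of_lt (le_of_eq (lintegral_congr fun x => ?_))
      (hf.lintegral_rpow_lt_top one_le_two)
    rw [h2, Real.enorm_eq_ofReal (by positivity)]
  · exact Filter.Eventually.of_forall fun x => by positivity

theorem dil_neg_arg (j : ℤ) (κ : (Fin n → ℝ) → ℝ) :
    (fun z => dil w j κ (-z)) = dil w j fun z => κ (-z) := by
  ext z; simp [dil]

theorem mul_le_sq_add_sq (x y : ℝ≥0∞) : x * y ≤ x ^ 2 + y ^ 2 := by
  rcases le_total x y with h | h
  · calc x * y ≤ y * y := mul_le_mul_left h y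
      _ ≤ _ := by rw [← sq]; exact le_add_self
  · calc x * y ≤ x * x := mul_le_mul_right h x
      _ ≤ _ := by rw [← sq]; exact le_self_add

theorem rpow_half_sq (x : ℝ≥0∞) : (x ^ (1 / 2 : ℝ)) ^ 2 = x := by
  rw [← ENNReal.rpow_natCast, ← ENNReal.rpow_mul]; norm_num

theorem lintegral_sum_cv_dil_sq_le (hw : ∀ k, 0 < w k) {a : (Fin n → ℝ) → ℝ} (ha : IsKer a)
    (ha0 : ∫ x, a x = 0) :
    ∃ C : ℝ≥0, ∀ (J : Finset ℤ) (g : ℤ → (Fin n → ℝ) → ℂ), (∀ j, Nice (g j)) →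
      ∫⁻ x, ‖∑ j ∈ J, cv (dil w j a) (g j) x‖ₑ ^ (2 : ℝ)
        ≤ C * ∑ j ∈ J, ∫⁻ x, ‖g j x‖ₑ ^ (2 : ℝ) := by
  set a' : (Fin n → ℝ) → ℝ := fun z => a (-z) with ha'
  have ha'0 : ∫ x, a' x = 0 := by rw [ha', integral_neg_eq_self]; exact ha0
  obtain ⟨C₁, hC₁⟩ := lintegral_cv_dil_le hw ha.neg_arg ha ha'0
  obtain ⟨C₂, hC₂⟩ := lintegral_cv_dil_le hw ha ha.neg_arg ha0
  have hker : ∀ j k : ℤ, ∫⁻ x, ‖cv (dil w j a') (dil w k a) x‖ₑ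
      ≤ (C₁ + C₂) * ENNReal.ofReal ((2 : ℝ) ^ (-|j - k|)) := by
    intro j k
    rcases le_total j k with h | h
    · refine (hC₁ j k h).trans ?_
      rw [abs_sub_comm, abs_of_nonneg (by linarith)]
      exact mul_le_mul_left le_self_add _
    · rw [cv_comm]
      refine (hC₂ k j h).trans ?_
      rw [abs_of_nonneg (by linarith)]
      exact mul_le_mul_left le_add_self _
  refine ⟨2 * (C₁ + C₂) * geomMass.toNNReal, fun J g hg => ?_⟩
  have hn : ∀ j, Nice (dil w j a) := fun j => ha.nice.dil j
  have hn' : ∀ j, Nice (dil w j a') := fun j => ha.neg_arg.nice.dil j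
  have hS : Nice fun x => ∑ j ∈ J, cv (dil w j a) (g j) x :=
    Nice.sum J fun j _ => (hn j).cv (hg j)
  set X : ℤ → ℝ≥0∞ := fun j => ∫⁻ x, ‖g j x‖ₑ ^ (2 : ℝ) with hX
  have hterm : ∀ j k, ‖∫ x, cv (dil w j a) (g j) x * conj (cv (dil w k a) (g k) x)‖ₑ
      ≤ (C₁ + C₂) * ENNReal.ofReal ((2 : ℝ) ^ (-|j - k|)) * (X j + X k) := by
    intro j k
    have e1 : ∫ x, cv (dil w j a) (g j) x * conj (cv (dil w k a) (g k) x)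
        = ∫ x, g j x * cv (cv (dil w j a') (dil w k a)) (fun x => conj (g k x)) x := by
      rw [integral_cv_mul (hn j) (hg j) ((hn k).cv (hg k)).conj, dil_neg_arg,
        ← cv_assoc (hn' j) (hn k) (hg k).conj]
      simp_rw [← cv_conj]
      rfl
    rw [e1]
    have hcv := (hn' j).cv (hn k)
    refine (lintegral_mul_le_sq (hg j) (hcv.cv (hg k).conj)).trans ?_
    have h2 : (∫⁻ x, ‖cv (cv (dil w j a') (dil w k a)) (fun x => conj (g k x)) x‖ₑ ^ (2 : ℝ))
        ^ (1 / 2 : ℝ) ≤ (C₁ + C₂) * ENNReal.ofReal ((2 : ℝ) ^ (-|j - k|)) * X k ^ (1 / 2 : ℝ) := by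
      calc _ ≤ ((∫⁻ x, ‖cv (dil w j a') (dil w k a) x‖ₑ) ^ (2 : ℝ)
              * ∫⁻ x, ‖conj (g k x)‖ₑ ^ (2 : ℝ)) ^ (1 / 2 : ℝ) :=
            ENNReal.rpow_le_rpow (lintegral_cv_rpow_le hcv (hg k).conj one_lt_two) (by norm_num)
        _ = (∫⁻ x, ‖cv (dil w j a') (dil w k a) x‖ₑ) * X k ^ (1 / 2 : ℝ) := by
            rw [ENNReal.mul_rpow_of_nonneg _ _ (by norm_num), ← ENNReal.rpow_mul]
            simp only [RCLike.enorm_conj]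
            rw [show (2 : ℝ) * (1 / 2) = 1 by norm_num, ENNReal.rpow_one]
        _ ≤ _ := mul_le_mul_left (hker j k) _
    refine (mul_le_mul_right h2 _).trans ?_
    rw [mul_left_comm]
    refine mul_le_mul_right ((mul_le_sq_add_sq _ _).trans (le_of_eq ?_)) _
    rw [rpow_half_sq, rpow_half_sq]
  have hexp : ∫ x, (∑ j ∈ J, cv (dil w j a) (g j) x) * conj (∑ k ∈ J, cv (dil w k a) (g k) x)
      = ∑ j ∈ J, ∑ k ∈ J, ∫ x, cv (dil w j a) (g j) x * conj (cv (dil w k a) (g k) x) := by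
    have hint : ∀ j k, Integrable fun x =>
        cv (dil w j a) (g j) x * conj (cv (dil w k a) (g k) x) := fun j k => by
      obtain ⟨M, hM⟩ := ((hn k).cv (hg k)).conj.2
      exact ((hn j).cv (hg j)).1.mul_bdd (c := M)
        ((hn k).cv (hg k)).conj.1.aestronglyMeasurable (Filter.Eventually.of_forall hM)
    simp_rw [map_sum, Finset.sum_mul_sum]
    rw [integral_finsetSum _ fun j _ => integrable_finsetSum _ fun k _ => hint j k]
    refine Finset.sum_congr rfl fun j _ => ?_
    rw [integral_finsetSum _ fun k _ => hint j k]
  rw [lintegral_sq_eq hS, hexp]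
  have hG : (geomMass.toNNReal : ℝ≥0∞) = geomMass := ENNReal.coe_toNNReal geomMass_ne_top
  calc _ ≤ ∑ j ∈ J, ∑ k ∈ J, (C₁ + C₂) * ENNReal.ofReal ((2 : ℝ) ^ (-|j - k|)) * (X j + X k) := by
        refine (enorm_sum_le _ _).trans (Finset.sum_le_sum fun j _ => ?_)
        exact (enorm_sum_le _ _).trans (Finset.sum_le_sum fun k _ => hterm j k)
    _ = (∑ j ∈ J, (C₁ + C₂) * X j * ∑ k ∈ J, ENNReal.ofReal ((2 : ℝ) ^ (-|k - j|)))
        + ∑ k ∈ J, (C₁ + C₂) * X k * ∑ j ∈ J, ENNReal.ofReal ((2 : ℝ) ^ (-|j - k|)) := by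
        simp_rw [mul_add, Finset.sum_add_distrib]
        congr 1
        · refine Finset.sum_congr rfl fun j _ => ?_
          rw [Finset.mul_sum]
          refine Finset.sum_congr rfl fun k _ => ?_
          rw [abs_sub_comm]; ring
        · rw [Finset.sum_comm]
          refine Finset.sum_congr rfl fun j _ => ?_
          rw [Finset.mul_sum]
          refine Finset.sum_congr rfl fun k _ => ?_
          ring
    _ ≤ (∑ j ∈ J, (C₁ + C₂) * X j * geomMass) + ∑ j ∈ J, (C₁ + C₂) * X j * geomMass :=
        add_le_add (Finset.sum_le_sum fun j _ => mul_le_mul_right (sum_geom_le J j) _)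
          (Finset.sum_le_sum fun j _ => mul_le_mul_right (sum_geom_le J j) _)
    _ = _ := by
        push_cast
        rw [hG, ← Finset.sum_mul, ← Finset.mul_sum]
        ring

theorem le_of_le_sqrt_mul_sqrt {S X : ℝ≥0∞} {C : ℝ≥0} (hS : S ≠ ∞)
    (h : S ≤ X ^ (1 / 2 : ℝ) * (C * S) ^ (1 / 2 : ℝ)) : S ≤ C * X := by
  rcases eq_or_ne S 0 with rfl | hS0
  · exact zero_le
  have h2 : S ^ 2 ≤ X * (C * S) := by
    calc S ^ 2 ≤ (X ^ (1 / 2 : ℝ) * (C * S) ^ (1 / 2 : ℝ)) ^ 2 := pow_le_pow_left' h 2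
      _ = _ := by rw [mul_pow, rpow_half_sq, rpow_half_sq]
  rw [sq, show X * (C * S) = S * (C * X) by ring] at h2
  exact (ENNReal.mul_le_mul_iff_right hS0 hS).1 h2

theorem sum_lintegral_cv_dil_sq_le (hw : ∀ k, 0 < w k) {b : (Fin n → ℝ) → ℝ} (hb : IsKer b)
    (hb0 : ∫ x, b x = 0) :
    ∃ C : ℝ≥0, ∀ (J : Finset ℤ) (f : (Fin n → ℝ) → ℂ), Nice f →
      ∑ j ∈ J, ∫⁻ x, ‖cv (dil w j b) f x‖ₑ ^ (2 : ℝ) ≤ C * ∫⁻ x, ‖f x‖ₑ ^ (2 : ℝ) := by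
  set b' : (Fin n → ℝ) → ℝ := fun z => b (-z) with hb'
  have hb'0 : ∫ x, b' x = 0 := by rw [hb', integral_neg_eq_self]; exact hb0
  obtain ⟨C, hC⟩ := lintegral_sum_cv_dil_sq_le hw hb.neg_arg hb'0
  refine ⟨C, fun J f hf => ?_⟩
  have hn : ∀ j, Nice (dil w j b) := fun j => hb.nice.dil j
  have hn' : ∀ j, Nice (dil w j b') := fun j => hb.neg_arg.nice.dil j
  have hg : ∀ j, Nice fun x => conj (cv (dil w j b) f x) := fun j => ((hn j).cv hf).conj
  have hsum : Nice fun x => ∑ j ∈ J, cv (dil w j b') (fun x => conj (cv (dil w j b) f x)) x :=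
    Nice.sum J fun j _ => (hn' j).cv (hg j)
  set S := ∑ j ∈ J, ∫⁻ x, ‖cv (dil w j b) f x‖ₑ ^ (2 : ℝ) with hS
  have hSt : S ≠ ∞ := (ENNReal.sum_lt_top.2 fun j _ =>
    ((hn j).cv hf).lintegral_rpow_lt_top one_le_two).ne
  have hint : ∀ j, Integrable fun x =>
      f x * cv (dil w j b') (fun x => conj (cv (dil w j b) f x)) x := fun j => by
    obtain ⟨M, hM⟩ := ((hn' j).cv (hg j)).2
    exact hf.1.mul_bdd (c := M) ((hn' j).cv (hg j)).1.aestronglyMeasurable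
      (Filter.Eventually.of_forall hM)
  have hsq : ∀ j, ∫⁻ x, ‖cv (dil w j b) f x‖ₑ ^ (2 : ℝ)
      = ENNReal.ofReal (∫ x, ‖cv (dil w j b) f x‖ ^ 2) ∧
      ∫ x, f x * cv (dil w j b') (fun x => conj (cv (dil w j b) f x)) x
        = ((∫ x, ‖cv (dil w j b) f x‖ ^ 2 : ℝ) : ℂ) := fun j => by
    have e : ∫ x, cv (dil w j b) f x * conj (cv (dil w j b) f x)
        = ((∫ x, ‖cv (dil w j b) f x‖ ^ 2 : ℝ) : ℂ) := by
      rw [← integral_complex_ofReal]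
      congr 1; ext x
      rw [Complex.mul_conj, Complex.normSq_eq_norm_sq]
    constructor
    · rw [lintegral_sq_eq ((hn j).cv hf), e, ← ofReal_norm, Complex.norm_real,
        Real.norm_of_nonneg (integral_nonneg fun x => by positivity)]
    · rw [← e, integral_cv_mul (hn j) hf (hg j), dil_neg_arg]
  have hSeq : S = ‖∫ x, f x * ∑ j ∈ J, cv (dil w j b') (fun x => conj (cv (dil w j b) f x)) x‖ₑ := by
    simp_rw [Finset.mul_sum]
    rw [integral_finsetSum _ fun j _ => hint j, hS]
    simp_rw [fun j => (hsq j).1, fun j => (hsq j).2]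
    rw [← Complex.ofReal_sum, ← ofReal_norm, Complex.norm_real, Real.norm_of_nonneg
      (Finset.sum_nonneg fun j _ => integral_nonneg fun x => by positivity),
      ENNReal.ofReal_sum_of_nonneg fun j _ => integral_nonneg fun x => by positivity]
  refine le_of_le_sqrt_mul_sqrt hSt ?_
  calc S ≤ _ := hSeq.le.trans (lintegral_mul_le_sq hf hsum)
    _ ≤ _ := by
      refine mul_le_mul_right (ENNReal.rpow_le_rpow ?_ (by norm_num)) _
      refine (hC J _ hg).trans (le_of_eq ?_)
      simp only [RCLike.enorm_conj]
      rfl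

theorem lintegral_cv_sum_dil_sq_le (hw : ∀ k, 0 < w k) {A B : (Fin n → ℝ) → ℝ} (hA : IsKer A)
    (hB : IsKer B) (hA0 : ∫ x, A x = 0) (hB0 : ∫ x, B x = 0) :
    ∃ C : ℝ≥0, ∀ (J : Finset ℤ) (f : (Fin n → ℝ) → ℂ), Nice f →
      ∫⁻ x, ‖cv (fun z => ∑ j ∈ J, dil w j (cv A B) z) f x‖ₑ ^ (2 : ℝ)
        ≤ C * ∫⁻ x, ‖f x‖ₑ ^ (2 : ℝ) := by
  obtain ⟨C₁, hC₁⟩ := lintegral_sum_cv_dil_sq_le hw hA hA0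
  obtain ⟨C₂, hC₂⟩ := sum_lintegral_cv_dil_sq_le hw hB hB0
  refine ⟨C₁ * C₂, fun J f hf => ?_⟩
  have e : ∀ x, cv (fun z => ∑ j ∈ J, dil w j (cv A B) z) f x
      = ∑ j ∈ J, cv (dil w j A) (cv (dil w j B) f) x := fun x => by
    rw [cv_sum_left J (fun j _ => (hA.cv hB).nice.dil j) hf]
    refine Finset.sum_congr rfl fun j _ => ?_
    rw [cv_assoc (hA.nice.dil j) (hB.nice.dil j) hf, cv_dil_dil]
  simp_rw [e]
  refine (hC₁ J _ fun j => (hB.nice.dil j).cv hf).trans ?_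
  rw [ENNReal.coe_mul, mul_assoc]
  exact mul_le_mul_right (hC₂ J f hf) _

theorem one_le_norm_of_notMem_nbox {Q : ℤ × (Fin n → ℤ)} {x y : Fin n → ℝ} (hx : x ∉ nbox w Q)
    (hy : y ∈ box w Q) : 1 ≤ ‖ds w (-Q.1) * (x - y)‖ := by
  simp only [nbox, Set.mem_ofPred_eq, not_forall, not_le] at hx
  obtain ⟨k, hk⟩ := hx
  rw [← (show cell w Q.1 y = Q.2 from hy)] at hk
  refine le_trans ?_ (norm_le_pi_norm _ k)
  simp only [cell] at hk
  set a := ds w (-Q.1) k * x k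
  set b := ds w (-Q.1) k * y k
  have hab : (ds w (-Q.1) * (x - y)) k = a - b := by
    simp only [Pi.mul_apply, Pi.sub_apply, mul_sub]; rfl
  rw [hab, Real.norm_eq_abs]
  by_contra hlt
  push Not at hlt
  have h1 := abs_lt.1 hlt
  have h2 : |⌊a⌋ - ⌊b⌋| ≤ 1 := by
    rw [abs_le]
    constructor
    · have : ⌊b⌋ ≤ ⌊a⌋ + 1 := by
        rw [← Int.floor_add_one]; exact Int.floor_le_floor (by linarith)
      linarith
    · have : ⌊a⌋ ≤ ⌊b⌋ + 1 := by
        rw [← Int.floor_add_one]; exact Int.floor_le_floor (by linarith)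
      linarith
  linarith

theorem norm_le_one_of_mem_box {Q : ℤ × (Fin n → ℤ)} {c y : Fin n → ℝ} (hc : c ∈ box w Q)
    (hy : y ∈ box w Q) : ‖ds w (-Q.1) * (y - c)‖ ≤ 1 := by
  rw [pi_norm_le_iff_of_nonneg zero_le_one]
  intro k
  have h : cell w Q.1 y k = cell w Q.1 c k := by
    rw [show cell w Q.1 y = Q.2 from hy, show cell w Q.1 c = Q.2 from hc]
  have := Int.abs_sub_lt_one_of_floor_eq_floor h
  rw [Pi.mul_apply, Pi.sub_apply, mul_sub, Real.norm_eq_abs]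
  exact this.le

theorem lintegral_smooth_dil_le (hw : ∀ k, 0 < w k) {κ : (Fin n → ℝ) → ℝ} (hκ : IsKer κ) :
    ∃ C : ℝ≥0, ∀ (j : ℤ) (Q : ℤ × (Fin n → ℤ)) (y c : Fin n → ℝ), y ∈ box w Q → c ∈ box w Q →
      ∫⁻ x in (nbox w Q)ᶜ, ‖dil w j κ (x - y) - dil w j κ (x - c)‖ₑ
        ≤ C * ENNReal.ofReal ((2 : ℝ) ^ (-|j - Q.1|)) := by
  obtain ⟨C, hC⟩ := hκ.lip
  obtain ⟨R, hR⟩ := hκ.supp.isCompact.isBounded.exists_norm_le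
  obtain ⟨r, hr⟩ := pow_unbounded_of_one_lt R (one_lt_two)
  have hfin : ∫⁻ x, ‖κ x‖ₑ ≠ ∞ := hκ.nice.1.2.ne
  refine ⟨C + 2 * (∫⁻ x, ‖κ x‖ₑ).toNNReal * 2 ^ r, fun j Q y c hy hc => ?_⟩
  rcases le_total Q.1 j with hj | hj
  · have h1 : ∫⁻ x, ‖dil w j κ (x - y) - dil w j κ (x - c)‖ₑ ≤ C * ‖ds w (-j) * (y - c)‖ₑ := by
      refine le_trans (le_of_eq ?_) (lintegral_dil_sub_le w hC j (y - c))
      rw [← lintegral_sub_right_eq_self (fun x => ‖dil w j κ (x - (y - c)) - dil w j κ x‖ₑ) c]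
      refine lintegral_congr fun x => ?_
      rw [show x - c - (y - c) = x - y by abel]
    refine (setLIntegral_le_lintegral _ _).trans (h1.trans ?_)
    refine mul_le_mul' (by push_cast; exact le_self_add) ?_
    rw [← ofReal_norm]
    refine ENNReal.ofReal_le_ofReal ?_
    rw [abs_of_nonneg (by linarith)]
    have e : ds w (-j) * (y - c) = ds w (-(j - Q.1)) * (ds w (-Q.1) * (y - c)) := by
      rw [← mul_assoc, ← ds_add]; congr 2; ring
    rw [e]
    refine (norm_ds_neg_mul_le hw (by linarith) _).trans ?_
    exact mul_le_of_le_one_right (by positivity) (norm_le_one_of_mem_box hc hy)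
  · rcases le_total (Q.1 - r) j with hj2 | hj2
    · have h1 : ∫⁻ x, ‖dil w j κ (x - y) - dil w j κ (x - c)‖ₑ ≤ 2 * ∫⁻ x, ‖κ x‖ₑ := by
        have hm : AEMeasurable (fun x => ‖dil w j κ (x - y)‖ₑ) := by
          have hd : Continuous (dil w j κ) :=
            continuous_const.mul (hκ.cont.comp (continuous_const.mul continuous_id))
          exact (hd.comp (continuous_id.sub continuous_const)).enorm.aemeasurable
        calc _ ≤ ∫⁻ x, ‖dil w j κ (x - y)‖ₑ + ‖dil w j κ (x - c)‖ₑ :=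
              lintegral_mono fun x => enorm_sub_le
          _ = _ := by
              rw [lintegral_add_left' hm,
                lintegral_sub_right_eq_self (fun x => ‖dil w j κ x‖ₑ) y,
                lintegral_sub_right_eq_self (fun x => ‖dil w j κ x‖ₑ) c, lintegral_enorm_dil,
                two_mul]
      refine (setLIntegral_le_lintegral _ _).trans (h1.trans ?_)
      push_cast
      rw [ENNReal.coe_toNNReal hfin]
      have h2 : (1 : ℝ≥0∞) ≤ 2 ^ r * ENNReal.ofReal ((2 : ℝ) ^ (-|j - Q.1|)) := by
        rw [show (2 : ℝ≥0∞) ^ r = ENNReal.ofReal ((2 : ℝ) ^ (r : ℤ)) by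
          rw [zpow_natCast, ENNReal.ofReal_pow zero_le_two]; simp,
          ← ENNReal.ofReal_mul (by positivity), ← zpow_add₀ two_ne_zero, ENNReal.one_le_ofReal]
        refine one_le_zpow₀ one_le_two ?_
        rw [abs_of_nonpos (by linarith)]
        linarith
      calc 2 * ∫⁻ x, ‖κ x‖ₑ ≤ 2 * (∫⁻ x, ‖κ x‖ₑ) * (2 ^ r * ENNReal.ofReal ((2 : ℝ) ^ (-|j - Q.1|))) :=
            le_mul_of_one_le_right zero_le h2
        _ ≤ _ := by
            rw [← mul_assoc]
            exact mul_le_mul_left le_add_self _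
    · have hz : ∀ x ∈ (nbox w Q)ᶜ, ∀ v ∈ box w Q, dil w j κ (x - v) = 0 := by
        intro x hx v hv
        rw [dil]
        refine mul_eq_zero_of_right _ ?_
        by_contra hne
        have h1 := hR _ (subset_tsupport _ hne)
        have h2 := one_le_norm_of_notMem_nbox hx hv
        have e : ds w (-Q.1) * (x - v) = ds w (-(Q.1 - j)) * (ds w (-j) * (x - v)) := by
          rw [← mul_assoc, ← ds_add]; congr 2; ring
        rw [e] at h2
        have h3 := norm_ds_neg_mul_le hw (by linarith : 0 ≤ Q.1 - j) (ds w (-j) * (x - v))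
        have h4 : (2 : ℝ) ^ (-(Q.1 - j)) ≤ ((2 : ℝ) ^ r)⁻¹ := by
          rw [← zpow_natCast, ← zpow_neg]
          exact zpow_le_zpow_right₀ one_le_two (by linarith)
        have h5 : 1 ≤ ((2 : ℝ) ^ r)⁻¹ * R :=
          h2.trans (h3.trans (mul_le_mul h4 h1 (norm_nonneg _) (by positivity)))
        rw [inv_mul_eq_div, one_le_div (by positivity)] at h5
        linarith
      rw [setLIntegral_congr_fun (g := fun _ => 0) (measurableSet_nbox Q).compl
        fun x hx => by simp only [hz x hx y hy, hz x hx c hc, sub_zero, enorm_zero]]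
      simp

theorem continuous_dil {κ : (Fin n → ℝ) → ℝ} (hκ : Continuous κ) (j : ℤ) :
    Continuous (dil w j κ) :=
  continuous_const.mul (hκ.comp (continuous_const.mul continuous_id))

theorem isCZ_sum_dil (hw : ∀ k, 0 < w k) {A B : (Fin n → ℝ) → ℝ} (hA : IsKer A)
    (hB : IsKer B) (hA0 : ∫ x, A x = 0) (hB0 : ∫ x, B x = 0) :
    ∃ C : ℝ≥0, ∀ J : Finset ℤ, ∀ C', C ≤ C' →
      IsCZ w C' fun z => ∑ j ∈ J, dil w j (cv A B) z := by
  obtain ⟨C₁, hC₁⟩ := lintegral_cv_sum_dil_sq_le hw hA hB hA0 hB0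
  obtain ⟨C₂, hC₂⟩ := lintegral_smooth_dil_le hw (hA.cv hB)
  have hn := (hA.cv hB).nice
  have hc := (hA.cv hB).cont
  refine ⟨C₁ + C₂ * geomMass.toNNReal, fun J C' hC' => ⟨Nice.sum J fun j _ => hn.dil j,
    continuous_finsetSum _ fun j _ => continuous_dil hc j, fun f hf => ?_, fun Q y c hy hcQ => ?_⟩⟩
  · refine (hC₁ J f hf).trans (mul_le_mul_left ?_ _)
    exact_mod_cast le_self_add.trans hC'
  · calc _ ≤ ∫⁻ x in (nbox w Q)ᶜ, ∑ j ∈ J, ‖dil w j (cv A B) (x - y) - dil w j (cv A B) (x - c)‖ₑ :=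
          lintegral_mono fun x => by
            rw [← Finset.sum_sub_distrib]; exact enorm_sum_le _ _
      _ = ∑ j ∈ J, ∫⁻ x in (nbox w Q)ᶜ, ‖dil w j (cv A B) (x - y) - dil w j (cv A B) (x - c)‖ₑ := by
          refine lintegral_finsetSum' _ fun j _ => ?_
          have hd : Continuous (dil w j (cv A B)) := continuous_dil hc j
          exact ((hd.comp (continuous_id.sub continuous_const)).sub
            (hd.comp (continuous_id.sub continuous_const))).enorm.aemeasurable
      _ ≤ ∑ j ∈ J, C₂ * ENNReal.ofReal ((2 : ℝ) ^ (-|j - Q.1|)) :=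
          Finset.sum_le_sum fun j _ => hC₂ j Q y c hy hcQ
      _ ≤ C₂ * geomMass := by
          rw [← Finset.mul_sum]; exact mul_le_mul_right (sum_geom_le J Q.1) _
      _ ≤ _ := by
          rw [← ENNReal.coe_toNNReal geomMass_ne_top]
          exact_mod_cast le_add_self.trans hC'

theorem cv_neg_arg (A B : (Fin n → ℝ) → ℝ) (z : Fin n → ℝ) :
    cv A B (-z) = cv (fun x => A (-x)) (fun x => B (-x)) z := by
  rw [cv, cv, ← integral_neg_eq_self]
  congr 1; ext y
  rw [show -(z - y) = -z - -y by abel]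

/-- Uniform `L^p` bounds for finite sums of dilates of a kernel with cancellation. -/
theorem lintegral_cv_sum_dil_rpow_le (hw : ∀ k, 0 < w k) (hD : 0 < hdim w)
    {A B : (Fin n → ℝ) → ℝ} (hA : IsKer A) (hB : IsKer B) (hA0 : ∫ x, A x = 0)
    (hB0 : ∫ x, B x = 0) {p : ℝ} (hp : 1 < p) :
    ∃ C : ℝ≥0, ∀ (J : Finset ℤ) (f : (Fin n → ℝ) → ℂ), Nice f → Continuous f →
      ∫⁻ x, ‖cv (fun z => ∑ j ∈ J, dil w j (cv A B) z) f x‖ₑ ^ p ≤ C * ∫⁻ x, ‖f x‖ₑ ^ p := by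
  obtain ⟨C₁, hC₁⟩ := isCZ_sum_dil hw hA hB hA0 hB0
  obtain ⟨C₂, hC₂⟩ := isCZ_sum_dil hw hA.neg_arg hB.neg_arg
    (by rw [integral_neg_eq_self]; exact hA0) (by rw [integral_neg_eq_self]; exact hB0)
  obtain ⟨C, hC⟩ := lintegral_cv_rpow_le_of_isCZ hw hD (max C₁ C₂) hp
  refine ⟨C, fun J f hf hfc => hC _ (hC₁ J _ (le_max_left _ _)) ?_ f hf hfc⟩
  have := hC₂ J _ (le_max_right C₁ C₂)
  convert this using 3 with z j
  rw [show dil w j (cv A B) (-z) = (fun z => dil w j (cv A B) (-z)) z from rfl, dil_neg_arg]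
  congr 1
  ext z
  exact cv_neg_arg A B z

end

section

open scoped ENNReal NNReal

variable {n : ℕ} {w : Fin n → ℕ}

theorem summable_two_rpow_neg_abs {δ : ℝ} (hδ : 0 < δ) :
    Summable fun m : ℤ => (2 : ℝ) ^ (-(δ * |(m : ℝ)|)) := by
  have h1 : (2 : ℝ) ^ (-δ) < 1 := Real.rpow_lt_one_of_one_lt_of_neg one_lt_two (by linarith)
  refine Summable.of_nat_of_neg ?_ ?_ <;>
  · refine (summable_geometric_of_lt_one (by positivity) h1).congr fun k => ?_
    rw [← Real.rpow_natCast, ← Real.rpow_mul zero_le_two]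
    simp

/-- Optimising a sum of two competing geometric sequences. -/
theorem sum_min_geom_le {σ τ : ℝ} (hσ : 0 < σ) (hτ : 0 < τ) :
    ∃ C : ℝ, 0 < C ∧ ∀ (J : Finset ℤ) (m b : ℝ), 0 < m → 0 < b →
      ∑ j ∈ J, min ((2 : ℝ) ^ (j * σ) * m) ((2 : ℝ) ^ (-(j * τ)) * b)
        ≤ C * (m ^ (τ / (σ + τ)) * b ^ (σ / (σ + τ))) := by
  set δ := min σ τ with hδ
  have hδ0 : 0 < δ := lt_min hσ hτ
  have hsum := summable_two_rpow_neg_abs hδ0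
  refine ⟨(2 : ℝ) ^ δ * ∑' m : ℤ, (2 : ℝ) ^ (-(δ * |(m : ℝ)|)), ?_, fun J m b hm hb => ?_⟩
  · have : 0 < ∑' m : ℤ, (2 : ℝ) ^ (-(δ * |(m : ℝ)|)) :=
      hsum.tsum_pos (fun _ => by positivity) 0 (by positivity)
    positivity
  have hst : 0 < σ + τ := by linarith
  set ρ := Real.logb 2 (b / m) / (σ + τ) with hρ
  have hbm : (2 : ℝ) ^ (ρ * (σ + τ)) = b / m := by
    rw [hρ, div_mul_cancel₀ _ hst.ne', Real.rpow_logb (by norm_num) (by norm_num) (by positivity)]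
  have hpow : ∀ c : ℝ, (2 : ℝ) ^ (ρ * c) = (b / m) ^ (c / (σ + τ)) := fun c => by
    rw [← hbm, ← Real.rpow_mul zero_le_two]
    congr 1; field_simp
  set P := m ^ (τ / (σ + τ)) * b ^ (σ / (σ + τ)) with hP
  have hP0 : 0 < P := by positivity
  have e1 : (2 : ℝ) ^ (ρ * σ) * m = P := by
    rw [hpow, Real.div_rpow hb.le hm.le, hP,
      show τ / (σ + τ) = 1 - σ / (σ + τ) by field_simp; ring, Real.rpow_sub hm, Real.rpow_one]
    field_simp
  have e2 : (2 : ℝ) ^ (-(ρ * τ)) * b = P := by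
    rw [Real.rpow_neg zero_le_two, hpow, Real.div_rpow hb.le hm.le, hP,
      show σ / (σ + τ) = 1 - τ / (σ + τ) by field_simp; ring, Real.rpow_sub hb, Real.rpow_one]
    field_simp
  have hterm : ∀ j : ℤ, min ((2 : ℝ) ^ (j * σ) * m) ((2 : ℝ) ^ (-(j * τ)) * b)
      ≤ P * ((2 : ℝ) ^ δ * (2 : ℝ) ^ (-(δ * |((j - ⌊ρ⌋ : ℤ) : ℝ)|))) := by
    intro j
    have habs : |((j - ⌊ρ⌋ : ℤ) : ℝ)| ≤ |j - ρ| + 1 := by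
      have h1 := Int.floor_le ρ
      have h2 := Int.lt_floor_add_one ρ
      push_cast
      calc |(j : ℝ) - ⌊ρ⌋| = |((j : ℝ) - ρ) + (ρ - ⌊ρ⌋)| := by ring_nf
        _ ≤ |(j : ℝ) - ρ| + |ρ - ⌊ρ⌋| := abs_add_le _ _
        _ ≤ _ := by
          rw [abs_of_nonneg (by linarith : 0 ≤ ρ - ⌊ρ⌋)]; linarith
    have hkey : min ((2 : ℝ) ^ (j * σ) * m) ((2 : ℝ) ^ (-(j * τ)) * b)
        ≤ P * (2 : ℝ) ^ (-(δ * |(j : ℝ) - ρ|)) := by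
      rcases le_total (j : ℝ) ρ with h | h
      · refine (min_le_left _ _).trans ?_
        rw [← e1, show (j : ℝ) * σ = ρ * σ + (j - ρ) * σ by ring, Real.rpow_add two_pos,
          mul_right_comm]
        refine mul_le_mul_of_nonneg_left (Real.rpow_le_rpow_of_exponent_le one_le_two ?_)
          (by positivity)
        rw [abs_of_nonpos (by linarith)]
        have : δ ≤ σ := min_le_left _ _
        nlinarith
      · refine (min_le_right _ _).trans ?_
        rw [← e2, show -((j : ℝ) * τ) = -(ρ * τ) + -((j - ρ) * τ) by ring, Real.rpow_add two_pos,
          mul_right_comm]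
        refine mul_le_mul_of_nonneg_left (Real.rpow_le_rpow_of_exponent_le one_le_two ?_)
          (by positivity)
        rw [abs_of_nonneg (by linarith)]
        have : δ ≤ τ := min_le_right _ _
        nlinarith
    refine hkey.trans (mul_le_mul_of_nonneg_left ?_ hP0.le)
    rw [← Real.rpow_add two_pos]
    refine Real.rpow_le_rpow_of_exponent_le one_le_two ?_
    nlinarith
  calc _ ≤ ∑ j ∈ J, P * ((2 : ℝ) ^ δ * (2 : ℝ) ^ (-(δ * |((j - ⌊ρ⌋ : ℤ) : ℝ)|))) :=
        Finset.sum_le_sum fun j _ => hterm j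
    _ = (2 : ℝ) ^ δ * (∑ j ∈ J, (2 : ℝ) ^ (-(δ * |((j - ⌊ρ⌋ : ℤ) : ℝ)|))) * P := by
        rw [← Finset.mul_sum, ← Finset.mul_sum]; ring
    _ ≤ _ := by
        refine mul_le_mul_of_nonneg_right (mul_le_mul_of_nonneg_left ?_ (by positivity)) hP0.le
        have hs' : Summable fun j : ℤ => (2 : ℝ) ^ (-(δ * |((j - ⌊ρ⌋ : ℤ) : ℝ)|)) :=
          (Equiv.subRight ⌊ρ⌋).summable_iff.2 hsum
        refine (hs'.sum_le_tsum J fun _ _ => by positivity).trans (le_of_eq ?_)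
        exact (Equiv.subRight ⌊ρ⌋).tsum_eq fun m : ℤ => (2 : ℝ) ^ (-(δ * |(m : ℝ)|))

theorem sum_min_geom_le_ennreal {σ τ : ℝ} (hσ : 0 < σ) (hτ : 0 < τ) :
    ∃ C : ℝ≥0, ∀ (J : Finset ℤ) (m b : ℝ≥0∞) (g : ℤ → ℝ≥0∞),
      (∀ j, g j ≤ ENNReal.ofReal ((2 : ℝ) ^ (j * σ)) * m) →
      (∀ j, g j ≤ ENNReal.ofReal ((2 : ℝ) ^ (-(j * τ))) * b) →
      ∑ j ∈ J, g j ≤ C * (m ^ (τ / (σ + τ)) * b ^ (σ / (σ + τ))) := by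
  obtain ⟨C, hC0, hC⟩ := sum_min_geom_le hσ hτ
  have h1 : 0 < τ / (σ + τ) := by positivity
  have h2 : 0 < σ / (σ + τ) := by positivity
  refine ⟨C.toNNReal, fun J m b g hm hb => ?_⟩
  have hCne : (C.toNNReal : ℝ≥0∞) ≠ 0 := by
    simpa using hC0
  rcases eq_or_ne m 0 with rfl | hm0
  · rw [Finset.sum_eq_zero fun j _ => by simpa using hm j]; exact zero_le
  rcases eq_or_ne b 0 with rfl | hb0
  · rw [Finset.sum_eq_zero fun j _ => by simpa using hb j]; exact zero_le
  have hmp : m ^ (τ / (σ + τ)) ≠ 0 := by simp [ENNReal.rpow_eq_zero_iff, hm0, h1.le]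
  have hbp : b ^ (σ / (σ + τ)) ≠ 0 := by simp [ENNReal.rpow_eq_zero_iff, hb0, h2.le]
  rcases eq_or_ne m ∞ with rfl | hmt
  · rw [ENNReal.top_rpow_of_pos h1, ENNReal.top_mul hbp, ENNReal.mul_top hCne]; exact le_top
  rcases eq_or_ne b ∞ with rfl | hbt
  · rw [ENNReal.top_rpow_of_pos h2, ENNReal.mul_top hmp, ENNReal.mul_top hCne]; exact le_top
  lift m to ℝ≥0 using hmt
  lift b to ℝ≥0 using hbt
  have hm' : (0 : ℝ) < m := by exact_mod_cast pos_iff_ne_zero.2 (by simpa using hm0)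
  have hb' : (0 : ℝ) < b := by exact_mod_cast pos_iff_ne_zero.2 (by simpa using hb0)
  calc ∑ j ∈ J, g j ≤ ∑ j ∈ J, ENNReal.ofReal
        (min ((2 : ℝ) ^ (j * σ) * m) ((2 : ℝ) ^ (-(j * τ)) * b)) := by
        refine Finset.sum_le_sum fun j _ => ?_
        rw [ENNReal.ofReal_min, ENNReal.ofReal_mul (by positivity),
          ENNReal.ofReal_mul (by positivity), ENNReal.ofReal_coe_nnreal, ENNReal.ofReal_coe_nnreal]
        exact le_min (hm j) (hb j)
    _ = ENNReal.ofReal (∑ j ∈ J, min ((2 : ℝ) ^ (j * σ) * m) ((2 : ℝ) ^ (-(j * τ)) * b)) :=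
        (ENNReal.ofReal_sum_of_nonneg fun j _ => by positivity).symm
    _ ≤ _ := ENNReal.ofReal_le_ofReal (hC J m b hm' hb')
    _ = _ := by
        rw [ENNReal.ofReal_mul hC0.le, ENNReal.ofReal_mul (by positivity),
          ← ENNReal.ofReal_rpow_of_pos hm', ← ENNReal.ofReal_rpow_of_pos hb',
          ENNReal.ofReal_coe_nnreal, ENNReal.ofReal_coe_nnreal]
        rfl

theorem rpow_eq_rpow_sub_one_mul (F : ℝ≥0∞) {r : ℝ} (hr : 0 ≤ r - 1) :
    F ^ r = F ^ (r - 1) * F := by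
  have := ENNReal.rpow_add_of_nonneg (x := F) (r - 1) 1 hr zero_le_one
  rwa [sub_add_cancel, ENNReal.rpow_one] at this

/-- Single-scale supremum bound. -/
theorem enorm_cv_dil_rpow_le {κ : (Fin n → ℝ) → ℝ} (hκ : Nice κ) {p : ℝ} (hp : 1 < p) :
    ∃ C : ℝ≥0, ∀ (j : ℤ) (f : (Fin n → ℝ) → ℂ), Nice f → ∀ x,
      ‖cv (dil w j κ) f x‖ₑ ^ p
        ≤ C * ENNReal.ofReal ((2 : ℝ) ^ (-(j * hdim w) : ℤ)) * ∫⁻ y, ‖f y‖ₑ ^ p := by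
  obtain ⟨M, hM⟩ := hκ.2
  have hfin : (∫⁻ y, ‖κ y‖ₑ) ^ (p - 1) ≠ ∞ :=
    ENNReal.rpow_ne_top_of_nonneg (by linarith) hκ.1.2.ne
  refine ⟨((∫⁻ y, ‖κ y‖ₑ) ^ (p - 1)).toNNReal * M.toNNReal, fun j f hf x => ?_⟩
  refine (enorm_cv_rpow_le (hκ.dil j) hf hp x).trans ?_
  rw [lintegral_enorm_dil, ENNReal.coe_mul, ENNReal.coe_toNNReal hfin, mul_assoc, mul_assoc]
  refine mul_le_mul_right ?_ _
  rw [← mul_assoc, ← lintegral_const_mul' _ _ (ENNReal.mul_ne_top ENNReal.coe_ne_top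
    ENNReal.ofReal_ne_top)]
  refine lintegral_mono fun y => mul_le_mul_left ?_ _
  rw [enorm_dil, mul_comm]
  refine mul_le_mul_left ?_ _
  rw [← ofReal_norm]
  exact ENNReal.ofReal_le_ofReal (hM _)

/-- Single-scale `L^p`-`L^q` bound. -/
theorem lintegral_cv_dil_rpow_le {κ : (Fin n → ℝ) → ℝ} (hκ : Nice κ) {p q : ℝ} (hp : 1 < p)
    (hpq : p ≤ q) :
    ∃ C : ℝ≥0, ∀ (j : ℤ) (f : (Fin n → ℝ) → ℂ), Nice f →
      ∫⁻ x, ‖cv (dil w j κ) f x‖ₑ ^ q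
        ≤ C * ENNReal.ofReal ((2 : ℝ) ^ (-(j * (hdim w * (q / p - 1)))))
          * (∫⁻ y, ‖f y‖ₑ ^ p) ^ (q / p) := by
  obtain ⟨C, hC⟩ := enorm_cv_dil_rpow_le (w := w) hκ hp
  have hp0 : 0 < p := by linarith
  have hθ : 0 ≤ q / p - 1 := by rw [sub_nonneg, one_le_div hp0]; exact hpq
  have hfin : (∫⁻ y, ‖κ y‖ₑ) ^ p ≠ ∞ := ENNReal.rpow_ne_top_of_nonneg hp0.le hκ.1.2.ne
  refine ⟨C ^ (q / p - 1) * ((∫⁻ y, ‖κ y‖ₑ) ^ p).toNNReal, fun j f hf => ?_⟩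
  set F := ∫⁻ y, ‖f y‖ₑ ^ p with hF
  set s := ENNReal.ofReal ((2 : ℝ) ^ (-(j * hdim w) : ℤ)) with hs
  have hFt : F ≠ ∞ := (hf.lintegral_rpow_lt_top hp.le).ne
  have hpt : ∀ x, ‖cv (dil w j κ) f x‖ₑ ^ q
      ≤ (C * s * F) ^ (q / p - 1) * ‖cv (dil w j κ) f x‖ₑ ^ p := fun x => by
    calc ‖cv (dil w j κ) f x‖ₑ ^ q
        = (‖cv (dil w j κ) f x‖ₑ ^ p) ^ (q / p - 1) * ‖cv (dil w j κ) f x‖ₑ ^ p := by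
          rw [← ENNReal.rpow_mul, ← ENNReal.rpow_add_of_nonneg _ _ (by positivity) hp0.le]
          congr 1; field_simp; ring
      _ ≤ _ := mul_le_mul_left (ENNReal.rpow_le_rpow (hC j f hf x) hθ) _
  have hss : s ^ (q / p - 1) = ENNReal.ofReal ((2 : ℝ) ^ (-(j * (hdim w * (q / p - 1))))) := by
    rw [hs, ENNReal.ofReal_rpow_of_pos (by positivity), ← Real.rpow_intCast,
      ← Real.rpow_mul zero_le_two]
    congr 2; push_cast; ring
  calc _ ≤ ∫⁻ x, (C * s * F) ^ (q / p - 1) * ‖cv (dil w j κ) f x‖ₑ ^ p := lintegral_mono hpt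
    _ = (C * s * F) ^ (q / p - 1) * ∫⁻ x, ‖cv (dil w j κ) f x‖ₑ ^ p :=
        lintegral_const_mul' _ _ (ENNReal.rpow_ne_top_of_nonneg hθ
          (ENNReal.mul_ne_top (ENNReal.mul_ne_top ENNReal.coe_ne_top ENNReal.ofReal_ne_top) hFt))
    _ ≤ (C * s * F) ^ (q / p - 1) * ((∫⁻ y, ‖κ y‖ₑ) ^ p * F) := by
        refine mul_le_mul_right ?_ _
        have := lintegral_cv_rpow_le (hκ.dil (w := w) j) hf hp
        rwa [lintegral_enorm_dil] at this
    _ = _ := by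
        rw [ENNReal.mul_rpow_of_nonneg _ _ hθ, ENNReal.mul_rpow_of_nonneg _ _ hθ, hss,
          ENNReal.coe_mul, ENNReal.coe_toNNReal hfin, ← ENNReal.coe_rpow_of_nonneg _ hθ,
          rpow_eq_rpow_sub_one_mul F hθ]
        ring

theorem mem_nbox_cell_of_norm_lt {i : ℤ} {x y : Fin n → ℝ}
    (h : ‖ds w (-i) * (x - y)‖ < 1) : y ∈ nbox w (i, cell w i x) := by
  by_contra hy
  have h1 := one_le_norm_of_notMem_nbox hy (mem_box_cell i x)
  simp only at h1
  rw [show y - x = -(x - y) by abel, mul_neg, norm_neg] at h1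
  linarith

/-- Single-scale bound by the maximal function. -/
theorem enorm_cv_dil_le_maxFun (hw : ∀ k, 0 < w k) {κ : (Fin n → ℝ) → ℝ} (hκ : IsKer κ) :
    ∃ C : ℝ≥0, ∀ (j : ℤ) (f : (Fin n → ℝ) → ℂ) (x : Fin n → ℝ),
      ‖cv (dil w j κ) f x‖ₑ ≤ C * maxFun w (fun y => ‖f y‖ₑ) x := by
  obtain ⟨M, hM⟩ := hκ.nice.2
  obtain ⟨R, hR⟩ := hκ.supp.isCompact.isBounded.exists_norm_le
  obtain ⟨r, hr⟩ := pow_unbounded_of_one_lt R (one_lt_two)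
  refine ⟨M.toNNReal * 3 ^ n * 2 ^ (r * hdim w), fun j f x => ?_⟩
  set i : ℤ := j + r with hi
  have hsupp : ∀ y, y ∉ nbox w (i, cell w i x) → dil w j κ (x - y) = 0 := by
    intro y hy
    rw [dil]
    refine mul_eq_zero_of_right _ ?_
    by_contra hne
    have h1 := hR _ (subset_tsupport _ hne)
    refine hy (mem_nbox_cell_of_norm_lt ?_)
    have e : ds w (-i) * (x - y) = ds w (-(r : ℤ)) * (ds w (-j) * (x - y)) := by
      rw [← mul_assoc, ← ds_add]; congr 2; rw [hi]; ring
    rw [e]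
    refine (norm_ds_neg_mul_le hw (by positivity) _).trans_lt ?_
    rw [zpow_neg, zpow_natCast, inv_mul_lt_iff₀ (by positivity), mul_one]
    linarith
  have hbd : ∀ y, ‖dil w j κ (x - y)‖ₑ
      ≤ ENNReal.ofReal ((2 : ℝ) ^ (-(j * hdim w) : ℤ)) * M.toNNReal := fun y => by
    rw [enorm_dil]
    refine mul_le_mul_right ?_ _
    rw [← ofReal_norm]
    exact ENNReal.ofReal_le_ofReal (hM _)
  have hpow : ENNReal.ofReal ((2 : ℝ) ^ (-(j * hdim w) : ℤ)) * ENNReal.ofReal ((2 : ℝ) ^ (i * hdim w))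
      = 2 ^ (r * hdim w) := by
    rw [← ENNReal.ofReal_mul (by positivity), ← zpow_add₀ two_ne_zero,
      show -(j * hdim w : ℤ) + i * hdim w = ((r * hdim w : ℕ) : ℤ) by rw [hi]; push_cast; ring,
      zpow_natCast, ENNReal.ofReal_pow zero_le_two]
    simp
  calc ‖cv (dil w j κ) f x‖ₑ ≤ ∫⁻ y, ‖dil w j κ (x - y)‖ₑ * ‖f y‖ₑ := enorm_cv_le _ _ _
    _ ≤ ∫⁻ y in nbox w (i, cell w i x),
          ENNReal.ofReal ((2 : ℝ) ^ (-(j * hdim w) : ℤ)) * M.toNNReal * ‖f y‖ₑ := by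
        rw [← lintegral_indicator (measurableSet_nbox _)]
        refine lintegral_mono fun y => ?_
        by_cases hy : y ∈ nbox w (i, cell w i x)
        · rw [Set.indicator_of_mem hy]
          exact mul_le_mul_left (hbd y) _
        · rw [hsupp y hy]; simp
    _ = ENNReal.ofReal ((2 : ℝ) ^ (-(j * hdim w) : ℤ)) * M.toNNReal *
          ∫⁻ y in nbox w (i, cell w i x), ‖f y‖ₑ :=
        lintegral_const_mul' _ _ (ENNReal.mul_ne_top ENNReal.ofReal_ne_top ENNReal.coe_ne_top)
    _ ≤ ENNReal.ofReal ((2 : ℝ) ^ (-(j * hdim w) : ℤ)) * M.toNNReal *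
          (3 ^ n * (ENNReal.ofReal ((2 : ℝ) ^ (i * hdim w)) * maxFun w (fun y => ‖f y‖ₑ) x)) :=
        mul_le_mul_right (lintegral_nbox_le i x) _
    _ = M.toNNReal * 3 ^ n * (ENNReal.ofReal ((2 : ℝ) ^ (-(j * hdim w) : ℤ))
          * ENNReal.ofReal ((2 : ℝ) ^ (i * hdim w))) * maxFun w (fun y => ‖f y‖ₑ) x := by ring
    _ = _ := by rw [hpow]; push_cast; ring

/-- Hardy–Littlewood–Sobolev bound for sums of dilates. -/
theorem lintegral_sum_dil_rpow_le (hw : ∀ k, 0 < w k) (hD : 0 < hdim w) {κ : (Fin n → ℝ) → ℝ}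
    (hκ : IsKer κ) {p q : ℝ} (hp : 1 < p) (hpq : p < q) :
    ∃ C : ℝ≥0, ∀ (J : Finset ℤ) (f : (Fin n → ℝ) → ℂ), Nice f → Continuous f →
      ∫⁻ x, (∑ j ∈ J, ENNReal.ofReal ((2 : ℝ) ^ (j * (hdim w * (1 / p - 1 / q))))
          * ‖cv (dil w j κ) f x‖ₑ) ^ q ≤ C * (∫⁻ y, ‖f y‖ₑ ^ p) ^ (q / p) := by
  have hp0 : 0 < p := by linarith
  have hq0 : 0 < q := by linarith
  have hD' : (0 : ℝ) < hdim w := by exact_mod_cast hD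
  set σ : ℝ := hdim w * (1 / p - 1 / q) with hσ
  set τ : ℝ := hdim w / q with hτ
  have hσ0 : 0 < σ := mul_pos hD' (sub_pos.2 (one_div_lt_one_div_of_lt hp0 hpq))
  have hτ0 : 0 < τ := by positivity
  have hst : σ + τ = hdim w / p := by rw [hσ, hτ]; ring
  obtain ⟨C₁, hC₁⟩ := enorm_cv_dil_le_maxFun hw hκ
  obtain ⟨C₂, hC₂⟩ := enorm_cv_dil_rpow_le (w := w) hκ.nice hp
  obtain ⟨C₃, hC₃⟩ := sum_min_geom_le_ennreal hσ0 hτ0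
  have hθ : τ / (σ + τ) = p / q := by rw [hst, hτ]; field_simp
  have hθ' : σ / (σ + τ) = 1 - p / q := by rw [hst, hσ]; field_simp
  have hpq' : 0 ≤ 1 - p / q := by rw [sub_nonneg, div_le_one hq0]; exact hpq.le
  rw [hθ, hθ'] at hC₃
  have hqp : 0 ≤ q / p - 1 := by rw [sub_nonneg, one_le_div hp0]; exact hpq.le
  set A : ℝ≥0 := C₃ ^ q * (C₁ ^ p * (C₂ ^ (q / p - 1))) with hA
  refine ⟨A * (maxConst n p).toNNReal, fun J f hf hfc => ?_⟩
  set F := ∫⁻ y, ‖f y‖ₑ ^ p with hF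
  have hFt : F ≠ ∞ := (hf.lintegral_rpow_lt_top hp.le).ne
  have hpt : ∀ x, (∑ j ∈ J, ENNReal.ofReal ((2 : ℝ) ^ (j * σ)) * ‖cv (dil w j κ) f x‖ₑ) ^ q
      ≤ A * F ^ (q / p - 1) * maxFun w (fun y => ‖f y‖ₑ) x ^ p := by
    intro x
    have h := hC₃ J (C₁ * maxFun w (fun y => ‖f y‖ₑ) x) ((C₂ * F) ^ (1 / p))
      (fun j => ENNReal.ofReal ((2 : ℝ) ^ (j * σ)) * ‖cv (dil w j κ) f x‖ₑ)
      (fun j => mul_le_mul_right (hC₁ j f x) _) fun j => by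
        have h1 : ‖cv (dil w j κ) f x‖ₑ
            ≤ ENNReal.ofReal ((2 : ℝ) ^ (-(j * (hdim w / p)))) * (C₂ * F) ^ (1 / p) := by
          have h2 := ENNReal.rpow_le_rpow (hC₂ j f hf x) (by positivity : 0 ≤ 1 / p)
          rw [← ENNReal.rpow_mul, mul_one_div_cancel hp0.ne', ENNReal.rpow_one] at h2
          refine h2.trans (le_of_eq ?_)
          rw [mul_comm (C₂ : ℝ≥0∞), mul_assoc, ENNReal.mul_rpow_of_nonneg _ _ (by positivity),
            ENNReal.ofReal_rpow_of_pos (by positivity), ← Real.rpow_intCast,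
            ← Real.rpow_mul zero_le_two]
          congr 3; push_cast; ring
        refine (mul_le_mul_right h1 _).trans (le_of_eq ?_)
        rw [← mul_assoc, ← ENNReal.ofReal_mul (by positivity), ← Real.rpow_add two_pos, ← hst]
        congr 3; ring
    refine (ENNReal.rpow_le_rpow h hq0.le).trans (le_of_eq ?_)
    rw [ENNReal.mul_rpow_of_nonneg _ _ hq0.le, ENNReal.mul_rpow_of_nonneg _ _ hq0.le,
      ← ENNReal.rpow_mul, ← ENNReal.rpow_mul, ← ENNReal.rpow_mul,
      show p / q * q = p by field_simp, show 1 / p * ((1 - p / q) * q) = q / p - 1 by field_simp,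
      ENNReal.mul_rpow_of_nonneg _ _ hp0.le, ENNReal.mul_rpow_of_nonneg _ _ hqp, hA]
    rw [ENNReal.coe_mul, ENNReal.coe_mul, ← ENNReal.coe_rpow_of_nonneg _ hq0.le,
      ← ENNReal.coe_rpow_of_nonneg _ hp0.le, ← ENNReal.coe_rpow_of_nonneg _ hqp]
    ring
  obtain ⟨M, hM⟩ := hf.2
  have hmax : ∫⁻ x, maxFun w (fun y => ‖f y‖ₑ) x ^ p ≤ maxConst n p * F :=
    lintegral_maxFun_rpow_le (M := ENNReal.ofReal M) hD hfc.enorm.measurable hf.1.2.ne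
      ENNReal.ofReal_ne_top (fun y => by
        rw [← ofReal_norm]; exact ENNReal.ofReal_le_ofReal (hM y)) hp
  calc _ ≤ ∫⁻ x, A * F ^ (q / p - 1) * maxFun w (fun y => ‖f y‖ₑ) x ^ p := lintegral_mono hpt
    _ = A * F ^ (q / p - 1) * ∫⁻ x, maxFun w (fun y => ‖f y‖ₑ) x ^ p :=
        lintegral_const_mul' _ _ (ENNReal.mul_ne_top ENNReal.coe_ne_top
          (ENNReal.rpow_ne_top_of_nonneg hqp hFt))
    _ ≤ A * F ^ (q / p - 1) * (maxConst n p * F) := mul_le_mul_right hmax _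
    _ = _ := by
        rw [ENNReal.coe_mul A, ENNReal.coe_toNNReal (maxConst_ne_top hp),
          rpow_eq_rpow_sub_one_mul F hqp]
        ring

end

section

open scoped ENNReal NNReal ContDiff

/-- Smooth compactly supported functions on the line. -/
structure IsTest (g : ℝ → ℝ) : Prop where
  smooth : ContDiff ℝ ∞ g
  supp : HasCompactSupport g

theorem IsTest.deriv {g : ℝ → ℝ} (h : IsTest g) : IsTest (deriv g) :=
  ⟨(contDiff_infty_iff_deriv.1 h.smooth).2, h.supp.deriv⟩

theorem IsTest.iterate_deriv {g : ℝ → ℝ} (h : IsTest g) (i : ℕ) : IsTest (_root_.deriv^[i] g) := by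
  induction i with
  | zero => exact h
  | succ i ih => rw [Function.iterate_succ_apply']; exact ih.deriv

theorem IsTest.comp_mul {g : ℝ → ℝ} (h : IsTest g) (a : ℝ) {c : ℝ} (hc : c ≠ 0) :
    IsTest fun x => a * g (c * x) :=
  ⟨contDiff_const.mul (h.smooth.comp (contDiff_const.mul contDiff_id)),
    (h.supp.comp_homeomorph (Homeomorph.mulLeft₀ c hc)).mul_left⟩

theorem IsTest.sub {f g : ℝ → ℝ} (hf : IsTest f) (hg : IsTest g) : IsTest fun x => f x - g x :=
  ⟨hf.smooth.sub hg.smooth, hf.supp.sub hg.supp⟩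

theorem IsTest.integrable_pow_mul {g : ℝ → ℝ} (h : IsTest g) (i : ℕ) :
    Integrable fun x => x ^ i * g x :=
  ((continuous_id.pow i).mul h.smooth.continuous).integrable_of_hasCompactSupport h.supp.mul_left

theorem IsTest.integrable {g : ℝ → ℝ} (h : IsTest g) : Integrable g :=
  h.smooth.continuous.integrable_of_hasCompactSupport h.supp

theorem IsTest.hasDerivAt {g : ℝ → ℝ} (h : IsTest g) (x : ℝ) :
    HasDerivAt g (_root_.deriv g x) x :=
  ((contDiff_infty_iff_deriv.1 h.smooth).1 x).hasDerivAt

theorem IsTest.integral_deriv {g : ℝ → ℝ} (h : IsTest g) : ∫ x, _root_.deriv g x = 0 :=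
  integral_eq_zero_of_hasDerivAt_of_integrable h.hasDerivAt h.deriv.integrable h.integrable

theorem IsTest.integral_iterate_deriv {g : ℝ → ℝ} (h : IsTest g) {i : ℕ} (hi : 0 < i) :
    ∫ x, (_root_.deriv^[i] g) x = 0 := by
  obtain ⟨i, rfl⟩ := Nat.exists_eq_succ_of_ne_zero hi.ne'
  rw [Function.iterate_succ_apply']
  exact (h.iterate_deriv i).integral_deriv

/-- Moments of an `L¹`-normalised dilate. -/
theorem integral_pow_mul_scale (g : ℝ → ℝ) (i : ℕ) {c : ℝ} (hc : 0 < c) :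
    ∫ x, x ^ i * (c⁻¹ * g (c⁻¹ * x)) = c ^ i * ∫ x, x ^ i * g x := by
  have h := Measure.integral_comp_mul_left (fun x => x ^ i * g x) c⁻¹
  rw [inv_inv, abs_of_pos hc, smul_eq_mul] at h
  have e : ∀ x : ℝ, x ^ i * (c⁻¹ * g (c⁻¹ * x)) = c ^ i * c⁻¹ * ((c⁻¹ * x) ^ i * g (c⁻¹ * x)) :=
    fun x => by rw [mul_pow, inv_pow]; field_simp
  simp_rw [e]
  rw [integral_const_mul, h]
  field_simp

theorem exists_isTest_moments (N : ℕ) : ∃ η : ℝ → ℝ, IsTest η ∧ ∫ x, η x = 1 ∧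
    ∀ i, 1 ≤ i → i ≤ N → ∫ x, x ^ i * η x = 0 := by
  induction N with
  | zero =>
    let b : ContDiffBump (0 : ℝ) := ⟨1, 2, one_pos, one_lt_two⟩
    exact ⟨b.normed volume, ⟨b.contDiff_normed, b.hasCompactSupport_normed⟩, b.integral_normed,
      fun i h1 h2 => by omega⟩
  | succ m ih =>
    obtain ⟨η, hη, h1, hm⟩ := ih
    set a : ℝ := 2 ^ (m + 1) with ha
    have ha1 : a - 1 ≠ 0 := by
      have : 1 < a := one_lt_pow₀ one_lt_two (by omega)
      linarith
    have key : ∀ i, ∫ x, x ^ i * ((a - 1)⁻¹ * a * η (1 * x)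
        - (a - 1)⁻¹ * 2⁻¹ * η (2⁻¹ * x)) = (a - 1)⁻¹ * (a - 2 ^ i) * ∫ x, x ^ i * η x := by
      intro i
      have e : ∀ x : ℝ, x ^ i * ((a - 1)⁻¹ * a * η (1 * x) - (a - 1)⁻¹ * 2⁻¹ * η (2⁻¹ * x))
          = (a - 1)⁻¹ * a * (x ^ i * η x) - (a - 1)⁻¹ * (x ^ i * (2⁻¹ * η (2⁻¹ * x))) :=
        fun x => by rw [one_mul]; ring
      simp_rw [e]
      rw [integral_sub ((hη.integrable_pow_mul i).const_mul _)
        (((hη.comp_mul 2⁻¹ (by norm_num : (2⁻¹ : ℝ) ≠ 0)).integrable_pow_mul i).const_mul _),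
        integral_const_mul, integral_const_mul, integral_pow_mul_scale η i two_pos]
      ring
    refine ⟨fun x => (a - 1)⁻¹ * a * η (1 * x) - (a - 1)⁻¹ * 2⁻¹ * η (2⁻¹ * x),
      (hη.comp_mul _ one_ne_zero).sub (hη.comp_mul _ (by norm_num)), ?_, fun i hi1 hi2 => ?_⟩
    · have := key 0
      simp only [pow_zero, one_mul, h1, mul_one] at this ⊢
      rw [this, inv_mul_cancel₀ ha1]
    · rw [key]
      rcases Nat.lt_or_ge m i with h | h
      · rw [show i = m + 1 by omega, ha, sub_self]; simp
      · rw [hm i hi1 h, mul_zero]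

theorem exists_antideriv {g : ℝ → ℝ} (hg : IsTest g) {m : ℕ}
    (hm : ∀ i ≤ m, ∫ x, x ^ i * g x = 0) :
    ∃ G, IsTest G ∧ deriv G = g ∧ ∀ i < m, ∫ x, x ^ i * G x = 0 := by
  obtain ⟨R, hR0, hR⟩ := hg.supp.isCompact.isBounded.subset_closedBall_lt 0 (0 : ℝ)
  have hz : ∀ x, R < |x| → g x = 0 := fun x hx => by
    by_contra h
    have := hR (subset_tsupport _ h)
    rw [mem_closedBall_zero_iff, Real.norm_eq_abs] at this
    linarith
  set a : ℝ := -(R + 1) with ha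
  set G : ℝ → ℝ := fun x => ∫ y in a..x, g y with hG
  have hc := hg.smooth.continuous
  have hd : ∀ x, HasDerivAt G (g x) x := fun x =>
    intervalIntegral.integral_hasDerivAt_right (hc.intervalIntegrable _ _)
      hc.aestronglyMeasurable.stronglyMeasurableAtFilter hc.continuousAt
  have hderiv : deriv G = g := funext fun x => (hd x).deriv
  have hG0 : ∀ x, R + 1 < |x| → G x = 0 := by
    intro x hx
    rcases lt_abs.1 hx with h | h
    · have hs : Function.support g ⊆ Set.Ioc a x := by
        intro y hy
        have : |y| ≤ R := by
          by_contra h'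
          exact hy (hz y (not_le.1 h'))
        have := abs_le.1 this
        exact ⟨by rw [ha]; linarith, by linarith⟩
      rw [hG]
      simp only
      rw [intervalIntegral.integral_eq_integral_of_support_subset hs]
      simpa using hm 0 (Nat.zero_le _)
    · rw [hG]
      simp only
      rw [intervalIntegral.integral_congr (g := fun _ => 0), intervalIntegral.integral_zero]
      intro y hy
      rw [Set.uIcc_of_ge (by rw [ha]; linarith), Set.mem_Icc] at hy
      exact hz y (lt_abs.2 (Or.inr (by rw [ha] at hy; linarith [hy.2])))
  have hGt : IsTest G := by
    refine ⟨contDiff_infty_iff_deriv.2 ⟨fun x => (hd x).differentiableAt, hderiv ▸ hg.smooth⟩, ?_⟩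
    refine HasCompactSupport.intro (isCompact_closedBall (0 : ℝ) (R + 1)) fun x hx => ?_
    rw [mem_closedBall_zero_iff, Real.norm_eq_abs, not_le] at hx
    exact hG0 x hx
  refine ⟨G, hGt, hderiv, fun i hi => ?_⟩
  have hpow : ∀ x : ℝ, HasDerivAt (fun x : ℝ => x ^ (i + 1)) (((i + 1 : ℕ) : ℝ) * x ^ i) x :=
    fun x => by simpa using hasDerivAt_pow (i + 1) x
  have h := integral_mul_deriv_eq_deriv_mul_of_integrable (fun x _ => hpow x) (fun x _ => hd x)
    (hg.integrable_pow_mul (i + 1))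
    (by simpa only [Pi.mul_def, mul_assoc] using (hGt.integrable_pow_mul i).const_mul ((i + 1 : ℕ) : ℝ))
    (hGt.integrable_pow_mul (i + 1))
  rw [hm (i + 1) hi] at h
  simp_rw [mul_assoc] at h
  rw [integral_const_mul, eq_comm, neg_eq_zero, mul_eq_zero] at h
  exact h.resolve_left (by positivity)

theorem exists_iterate_antideriv {g : ℝ → ℝ} (hg : IsTest g) {m : ℕ}
    (hm : ∀ i ≤ m, ∫ x, x ^ i * g x = 0) {l : ℕ} (hl : l ≤ m) :
    ∃ ψ, IsTest ψ ∧ deriv^[l] ψ = g ∧ ∀ i ≤ m - l, ∫ x, x ^ i * ψ x = 0 := by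
  induction l with
  | zero => exact ⟨g, hg, rfl, hm⟩
  | succ l ih =>
    obtain ⟨ψ, hψ, h1, h2⟩ := ih (by omega)
    obtain ⟨G, hG, h3, h4⟩ := exists_antideriv hψ h2
    refine ⟨G, hG, ?_, fun i hi => h4 i (by omega)⟩
    rw [Function.iterate_succ_apply, h3, h1]

/-- A mollifier whose differences of dilates are high order derivatives. -/
theorem exists_mollifier (N : ℕ) : ∃ η : ℝ → ℝ, IsTest η ∧ ∫ x, η x = 1 ∧
    ∀ c : ℝ, 0 < c → ∀ l ≤ N, ∃ ψ, IsTest ψ ∧ ∫ x, ψ x = 0 ∧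
      deriv^[l] ψ = fun x => η x - c⁻¹ * η (c⁻¹ * x) := by
  obtain ⟨η, hη, h1, hm⟩ := exists_isTest_moments N
  refine ⟨η, hη, h1, fun c hc l hl => ?_⟩
  have hs := hη.comp_mul c⁻¹ (inv_ne_zero hc.ne')
  obtain ⟨ψ, hψ, h2, h3⟩ := exists_iterate_antideriv (hη.sub hs) (m := N) (fun i hi => by
    simp_rw [mul_sub]
    rw [integral_sub (hη.integrable_pow_mul i) (hs.integrable_pow_mul i),
      integral_pow_mul_scale η i hc]
    rcases Nat.eq_zero_or_pos i with rfl | h0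
    · simp
    · rw [hm i h0 hi]; simp) hl
  exact ⟨ψ, hψ, by simpa using h3 0 (Nat.zero_le _), h2⟩

end

section

open scoped ENNReal NNReal ContDiff

variable {n : ℕ} {w : Fin n → ℕ}

/-- Tensor product of functions of one variable. -/
def tens (f : Fin n → ℝ → ℝ) (x : Fin n → ℝ) : ℝ := ∏ k, f k (x k)

theorem contDiff_tens {f : Fin n → ℝ → ℝ} (hf : ∀ k, IsTest (f k)) : ContDiff ℝ ∞ (tens f) := by
  unfold tens
  exact contDiff_prod fun k _ => (hf k).smooth.comp (contDiff_apply ℝ ℝ k)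

theorem hasCompactSupport_tens {f : Fin n → ℝ → ℝ} (hf : ∀ k, IsTest (f k)) :
    HasCompactSupport (tens f) := by
  refine HasCompactSupport.intro (isCompact_univ_pi fun k => (hf k).supp) fun x hx => ?_
  simp only [Set.mem_univ_pi, not_forall] at hx
  obtain ⟨k, hk⟩ := hx
  exact Finset.prod_eq_zero (Finset.mem_univ k) (image_eq_zero_of_notMem_tsupport hk)

theorem isKer_tens {f : Fin n → ℝ → ℝ} (hf : ∀ k, IsTest (f k)) : IsKer (tens f) :=
  .of_contDiff ((contDiff_tens hf).of_le (by exact_mod_cast le_top)) (hasCompactSupport_tens hf)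

theorem integral_tens (f : Fin n → ℝ → ℝ) : ∫ x, tens f x = ∏ k, ∫ y, f k y :=
  integral_fintype_prod_volume_eq_prod (fun k => f k)

theorem dil_one_tens (f : Fin n → ℝ → ℝ) :
    dil w 1 (tens f) = tens fun k x => ((2 : ℝ) ^ w k)⁻¹ * f k (((2 : ℝ) ^ w k)⁻¹ * x) := by
  ext x
  simp only [dil, tens, Finset.prod_mul_distrib, Pi.mul_apply, ds, hdim, one_mul, neg_mul,
    zpow_neg, zpow_natCast, Finset.prod_inv_distrib, Finset.prod_pow_eq_pow_sum]

theorem tens_update (f : Fin n → ℝ → ℝ) (k : Fin n) (g : ℝ → ℝ) (x : Fin n → ℝ) :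
    tens (Function.update f k g) x = g (x k) * ∏ i ∈ Finset.univ.erase k, f i (x i) := by
  unfold tens
  rw [← Finset.mul_prod_erase _ _ (Finset.mem_univ k), Function.update_self]
  congr 1
  refine Finset.prod_congr rfl fun i hi => ?_
  rw [Function.update_of_ne (Finset.ne_of_mem_erase hi)]

theorem hasLineDerivAt_tens {f : Fin n → ℝ → ℝ} (hf : ∀ k, IsTest (f k)) (k : Fin n)
    (x : Fin n → ℝ) :
    HasLineDerivAt ℝ (tens f) (tens (Function.update f k (deriv (f k))) x) x (Pi.single k 1) := by
  have h1 : ∀ t : ℝ, tens f (x + t • Pi.single k 1)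
      = f k (x k + t) * ∏ i ∈ Finset.univ.erase k, f i (x i) := by
    intro t
    unfold tens
    rw [← Finset.mul_prod_erase _ _ (Finset.mem_univ k)]
    congr 1
    · simp
    · refine Finset.prod_congr rfl fun i hi => ?_
      simp [Pi.single_eq_of_ne (Finset.ne_of_mem_erase hi)]
  unfold HasLineDerivAt
  simp_rw [h1]
  rw [tens_update]
  have h2 : HasDerivAt (f k) (deriv (f k) (x k)) (x k + 0) := by simpa using (hf k).hasDerivAt (x k)
  exact (h2.comp_const_add (x k) 0).mul_const _

theorem isTest_update {f : Fin n → ℝ → ℝ} (hf : ∀ k, IsTest (f k)) (k : Fin n) {g : ℝ → ℝ}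
    (hg : IsTest g) (i : Fin n) : IsTest (Function.update f k g i) := by
  by_cases h : i = k
  · subst h; simpa using hg
  · simpa [h] using hf i

theorem nice_schwartz (u : SchwartzMap (Fin n → ℝ) ℂ) : Nice u :=
  ⟨u.integrable, by
    obtain ⟨C, hC⟩ := u.decay 0 0
    exact ⟨C, fun x => by simpa using hC.2 x⟩⟩

theorem cv_dil_tens_deriv {f : Fin n → ℝ → ℝ} (hf : ∀ k, IsTest (f k)) (k : Fin n)
    (u : SchwartzMap (Fin n → ℝ) ℂ) (j : ℤ) (x : Fin n → ℝ) :
    cv (dil w j (tens (Function.update f k (deriv (f k))))) u x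
      = ((2 : ℝ) ^ (j * w k)) • cv (dil w j (tens f))
        (LineDeriv.lineDerivOpCLM ℝ (SchwartzMap (Fin n → ℝ) ℂ) (Pi.single k 1 : Fin n → ℝ) u) x := by
  rw [cv_dil_eq, cv_dil_eq]
  set v := LineDeriv.lineDerivOpCLM ℝ (SchwartzMap (Fin n → ℝ) ℂ) (Pi.single k 1 : Fin n → ℝ) u
  have hc : ∀ (g : SchwartzMap (Fin n → ℝ) ℂ), Continuous fun z => g (x - ds w j * z) := fun g =>
    g.continuous.comp (by fun_prop)
  have hint : ∀ (g : Fin n → ℝ → ℝ) (_ : ∀ k, IsTest (g k)) (v : (Fin n → ℝ) → ℂ),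
      Continuous v → Integrable fun z => tens g z • v z := fun g hg v hv =>
    ((contDiff_tens hg).continuous.smul hv).integrable_of_hasCompactSupport
      (hasCompactSupport_tens hg).smul_right
  have hd : ∀ z, HasLineDerivAt ℝ (fun z => u (x - ds w j * z))
      (-((2 : ℝ) ^ (j * w k)) • v (x - ds w j * z)) z (Pi.single k 1) := by
    intro z
    have e : v (x - ds w j * z) = fderiv ℝ u (x - ds w j * z) (Pi.single k 1) := by
      simp [v, SchwartzMap.lineDerivOp_apply_eq_fderiv]
    have h1 : HasFDerivAt u (fderiv ℝ u (x - ds w j * z)) (x - ds w j * z + (0:ℝ) • (-((2 : ℝ) ^ (j * w k)) • (Pi.single k 1 : Fin n → ℝ))) := by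
      simpa using (u.differentiable _).hasFDerivAt
    have h2 := (h1.comp_hasDerivAt (0 : ℝ)
      (((hasDerivAt_id (0 : ℝ)).smul_const (-((2 : ℝ) ^ (j * w k)) • (Pi.single k 1 : Fin n → ℝ))).const_add
        (x - ds w j * z)))
    unfold HasLineDerivAt
    rw [e]
    convert h2 using 1
    · ext t
      simp only [Function.comp]
      congr 1
      ext i
      by_cases hi : i = k
      · subst hi; simp [ds]; ring
      · simp [hi]
    · simp
  have key := integral_bilinear_hasLineDerivAt_right_eq_neg_left_of_integrable
    (μ := (volume : Measure (Fin n → ℝ))) (f := tens f)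
    (f' := tens (Function.update f k (deriv (f k)))) (g := fun z => u (x - ds w j * z))
    (g' := fun z => -((2 : ℝ) ^ (j * w k)) • v (x - ds w j * z)) (v := Pi.single k 1)
    (B := ContinuousLinearMap.lsmul ℝ ℝ)
    (hint _ (isTest_update hf k (hf k).deriv) _ (hc u))
    (hint _ hf _ ((hc v).fun_const_smul _)) (hint _ hf _ (hc u))
    (fun z _ => hasLineDerivAt_tens hf k z) (fun z _ => hd z)
  simp only [ContinuousLinearMap.lsmul_apply] at key
  rw [← neg_eq_iff_eq_neg] at key
  rw [← key, ← integral_neg, ← integral_smul]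
  refine integral_congr_ae (Filter.Eventually.of_forall fun z => ?_)
  simp only [smul_smul, ← neg_smul]
  congr 1; ring

theorem pdIter_succ (k : Fin n) (i : ℕ) (u : SchwartzMap (Fin n → ℝ) ℂ) :
    pdIter n k (i + 1) u = pdIter n k i
      (LineDeriv.lineDerivOpCLM ℝ (SchwartzMap (Fin n → ℝ) ℂ) (Pi.single k 1 : Fin n → ℝ) u) := by
  simp [pdIter, Function.iterate_succ_apply]

theorem cv_dil_tens_pdIter {f : Fin n → ℝ → ℝ} (hf : ∀ k, IsTest (f k)) (k : Fin n) (i : ℕ)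
    (u : SchwartzMap (Fin n → ℝ) ℂ) (j : ℤ) (x : Fin n → ℝ) :
    cv (dil w j (tens (Function.update f k (deriv^[i] (f k))))) u x
      = ((2 : ℝ) ^ (j * (i * w k))) • cv (dil w j (tens f)) (pdIter n k i u) x := by
  induction i generalizing u with
  | zero => simp [pdIter]
  | succ i ih =>
    have h := cv_dil_tens_deriv (w := w) (isTest_update hf k ((hf k).iterate_deriv i)) k u j x
    simp only [Function.update_self, Function.update_idem] at h
    rw [Function.iterate_succ_apply', h, ih, pdIter_succ, smul_smul, ← zpow_add₀ two_ne_zero]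
    congr 2; push_cast; ring

theorem exists_cv_dil_tens_foldl {f : Fin n → ℝ → ℝ} (hf : ∀ k, IsTest (f k)) (α : Fin n → ℕ)
    (ks : List (Fin n)) :
    ∃ g : Fin n → ℝ → ℝ, (∀ k, IsTest (g k)) ∧ (∀ k ∈ ks, 0 < α k → ∫ y, g k y = 0) ∧
      ∀ (u : SchwartzMap (Fin n → ℝ) ℂ) (j : ℤ) (x : Fin n → ℝ),
        cv (dil w j (tens g)) u x = ((2 : ℝ) ^ (j * (ks.map fun k => (α k * w k : ℤ)).sum)) •
          cv (dil w j (tens f)) (ks.foldl (fun v k => pdIter n k (α k) v) u : SchwartzMap (Fin n → ℝ) ℂ) x := by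
  induction ks with
  | nil => exact ⟨f, hf, by simp, by simp⟩
  | cons k ks ih =>
    obtain ⟨g, hg, h0, h⟩ := ih
    refine ⟨Function.update g k (deriv^[α k] (g k)),
      isTest_update hg k ((hg k).iterate_deriv _), fun i hi hαi => ?_, fun u j x => ?_⟩
    · by_cases hik : i = k
      · subst hik
        rw [Function.update_self]
        exact (hg i).integral_iterate_deriv hαi
      · rw [Function.update_of_ne hik]
        exact h0 i ((List.mem_cons.1 hi).resolve_left hik) hαi
    · rw [cv_dil_tens_pdIter hg, h, smul_smul, ← zpow_add₀ two_ne_zero, List.foldl_cons,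
        List.map_cons, List.sum_cons, mul_add]

theorem exists_cv_dil_tens_Dmix {f : Fin n → ℝ → ℝ} (hf : ∀ k, IsTest (f k)) (α : Fin n → ℕ) :
    ∃ g : Fin n → ℝ → ℝ, (∀ k, IsTest (g k)) ∧ (∀ k, 0 < α k → ∫ y, g k y = 0) ∧
      ∀ (u : SchwartzMap (Fin n → ℝ) ℂ) (j : ℤ) (x : Fin n → ℝ),
        cv (dil w j (tens g)) u x = ((2 : ℝ) ^ (j * ∑ k, (α k * w k : ℤ))) •
          cv (dil w j (tens f)) (Dmix n α u) x := by
  obtain ⟨g, hg, h0, h⟩ := exists_cv_dil_tens_foldl (w := w) hf α (List.finRange n)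
  refine ⟨g, hg, fun k => h0 k (List.mem_finRange k), fun u j x => ?_⟩
  rw [h, Dmix]
  congr 4

end

section

open scoped ENNReal NNReal ContDiff

variable {n : ℕ} {w : Fin n → ℕ}

theorem tens_eq_add_sum (f f' : Fin n → ℝ → ℝ) (x : Fin n → ℝ) :
    tens f x = tens f' x + ∑ k, tens (Function.update (fun i => if i < k then f' i else f i) k
      fun y => f k y - f' k y) x := by
  have h := Finset.prod_sub_ordered Finset.univ (fun i => f i (x i))
    (fun i => f i (x i) - f' i (x i))
  simp only [sub_sub_cancel] at h
  unfold tens at *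
  rw [h, sub_add_eq_add_sub, eq_sub_iff_add_eq]
  congr 1
  refine Finset.sum_congr rfl fun k _ => ?_
  have e := tens_update (fun i => if i < k then f' i else f i) k (fun y => f k y - f' k y) x
  unfold tens at e
  rw [e, mul_assoc]
  congr 1
  rw [← Finset.prod_filter_mul_prod_filter_not (Finset.univ.erase k) (· < k)]
  congr 1
  · refine Finset.prod_congr ?_ fun i hi => ?_
    · ext i; simp only [Finset.mem_filter, Finset.mem_univ, Finset.mem_erase]; grind
    · simp [(Finset.mem_filter.1 hi).2]
  · refine Finset.prod_congr ?_ fun i hi => ?_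
    · ext i; simp only [Finset.mem_filter, Finset.mem_univ, Finset.mem_erase]; grind
    · simp [(Finset.mem_filter.1 hi).2]

theorem integral_cv {A B : (Fin n → ℝ) → ℝ} (hA : Nice A) (hB : Nice B) :
    ∫ x, cv A B x = (∫ x, A x) * ∫ x, B x := by
  unfold cv
  rw [integral_integral_swap (hA.integrable_prod hB)]
  simp_rw [smul_eq_mul, integral_mul_const, integral_sub_right_eq_self A]
  rw [integral_const_mul]

/-- A Calderón-type reproducing formula for `D^α u` in terms of the pure derivatives of `u`. -/
theorem exists_reproducing (l α : Fin n → ℕ) (L : ℕ)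
    (hL : ∀ k, l k * w k = L) :
    ∃ (Φ Φ' A : (Fin n → ℝ) → ℝ) (ψ : Fin n → (Fin n → ℝ) → ℝ),
      IsKer Φ ∧ ∫ x, Φ x = 1 ∧ Nice Φ' ∧ IsKer A ∧ (∀ k, IsKer (ψ k)) ∧ (∀ k, ∫ x, ψ k x = 0) ∧
      ((∃ k, 0 < α k) → ∫ x, A x = 0) ∧
      (∀ (u : SchwartzMap (Fin n → ℝ) ℂ) x, cv Φ (Dmix n α u) x = cv Φ' u x) ∧
      ∀ (u : SchwartzMap (Fin n → ℝ) ℂ) (j : ℤ) x,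
        cv (dil w j Φ) (Dmix n α u) x = cv (dil w (j + 1) Φ) (Dmix n α u) x +
          ((2 : ℝ) ^ (j * ((L : ℤ) - ∑ k, (α k * w k : ℤ)))) •
            ∑ k, cv (dil w j (cv A (ψ k))) (pdIter n k (l k) u) x := by
  obtain ⟨η, hη, h1, hm⟩ := exists_mollifier (∑ k, l k)
  have hpos : ∀ k, (0 : ℝ) < 2 ^ w k := fun k => by positivity
  choose ψ₁ hψ₁ hψ0 hψd using fun k => hm (2 ^ w k) (hpos k) (l k)
    (Finset.single_le_sum (f := l) (fun _ _ => Nat.zero_le _) (Finset.mem_univ k))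
  set e : Fin n → ℝ → ℝ := fun _ => η with he_def
  set e' : Fin n → ℝ → ℝ := fun k x => ((2 : ℝ) ^ w k)⁻¹ * η (((2 : ℝ) ^ w k)⁻¹ * x) with he'_def
  have he : ∀ k, IsTest (e k) := fun _ => hη
  have he' : ∀ k, IsTest (e' k) := fun k => hη.comp_mul _ (inv_ne_zero (hpos k).ne')
  have hT' : dil w 1 (tens e) = tens e' := dil_one_tens _
  have hT := (isKer_tens he)
  have hTn := hT.nice
  have hTn' := (isKer_tens he').nice
  obtain ⟨g, hg, hg0, hgD⟩ := exists_cv_dil_tens_Dmix (w := w) he α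
  obtain ⟨g', hg', hg0', hgD'⟩ := exists_cv_dil_tens_Dmix (w := w) he' α
  set F : Fin n → Fin n → ℝ → ℝ := fun k i => if i < k then e' i else e i with hF_def
  have hF : ∀ k i, IsTest (F k i) := fun k i => by
    simp only [F]; split_ifs
    · exact he' i
    · exact he i
  set ψ : Fin n → (Fin n → ℝ) → ℝ := fun k => tens (Function.update (F k) k (ψ₁ k)) with hψ_def
  have hψt : ∀ k i, IsTest (Function.update (F k) k (ψ₁ k) i) :=
    fun k => isTest_update (hF k) k (hψ₁ k)
  have hψK : ∀ k, IsKer (ψ k) := fun k => isKer_tens (hψt k)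
  set A : (Fin n → ℝ) → ℝ := fun x => tens g x + tens g' x with hA_def
  have hgn := (isKer_tens hg).nice
  have hgn' := (isKer_tens hg').nice
  have hA : IsKer A := .of_contDiff
    (((contDiff_tens hg).add (contDiff_tens hg')).of_le (by exact_mod_cast le_top))
    ((hasCompactSupport_tens hg).add (hasCompactSupport_tens hg'))
  refine ⟨cv (tens e) (tens e), cv (tens e) (tens g), A, ψ, hT.cv hT, ?_, hTn.cv hgn, hA, hψK,
    fun k => ?_, ?_, ?_, ?_⟩
  · rw [integral_cv hTn hTn, integral_tens]; simp [e, h1]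
  · rw [integral_tens]
    exact Finset.prod_eq_zero (Finset.mem_univ k) (by simpa using hψ0 k)
  · rintro ⟨k, hk⟩
    rw [hA_def, integral_add hgn.1 hgn'.1, integral_tens, integral_tens,
      Finset.prod_eq_zero (Finset.mem_univ k) (hg0 k hk),
      Finset.prod_eq_zero (Finset.mem_univ k) (hg0' k hk), add_zero]
  · intro u x
    rw [← cv_assoc hTn hTn (nice_schwartz _), ← cv_assoc hTn hgn (nice_schwartz _)]
    congr 1
    ext y
    have h := hgD u 0 y
    have h0 : ∀ κ : (Fin n → ℝ) → ℝ, dil w 0 κ = κ := fun κ => by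
      ext z; simp [dil, ds_zero]
    simpa [h0] using h.symm
  · intro u j x
    set V : (Fin n → ℝ) → ℂ := ⇑(Dmix n α u)
    have hV : Nice V := nice_schwartz _
    have hu : Nice u := nice_schwartz _
    have ha : Nice (dil w j (tens e)) := hTn.dil j
    have hb : Nice (dil w j (tens e')) := hTn'.dil j
    have hAn : Nice (dil w j A) := hA.nice.dil j
    set c : ℝ := (2 : ℝ) ^ (j * ∑ k, (α k * w k : ℤ)) with hc
    have hcpos : c ≠ 0 := by positivity
    -- the sum of the two mollifications of `D^α u`
    have hW : ∀ y, cv (dil w j A) u y = c • (cv (dil w j (tens e)) V y + cv (dil w j (tens e')) V y) := by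
      intro y
      rw [hA_def, dil_add, cv_add_left (hgn.dil j) (hgn'.dil j) hu, hgD, hgD', smul_add]
    -- the difference of the two mollifications of `u`
    have hd : cv (dil w j (tens e)) u = fun y => cv (dil w j (tens e')) u y +
        ∑ k, ((2 : ℝ) ^ (j * (L : ℤ))) • cv (dil w j (ψ k)) (pdIter n k (l k) u) y := by
      ext y
      have h2 : ∀ k, cv (dil w j (tens (Function.update (F k) k fun y => e k y - e' k y))) u y
          = ((2 : ℝ) ^ (j * (L : ℤ))) • cv (dil w j (ψ k)) (pdIter n k (l k) u) y := by
        intro k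
        have h := cv_dil_tens_pdIter (w := w) (hψt k) k (l k) u j y
        simp only [Function.update_self, Function.update_idem, hψd] at h
        rw [← hL k]
        push_cast
        exact h
      simp_rw [← h2]
      have hkn : ∀ k ∈ Finset.univ, Nice (dil w j (tens (Function.update (F k) k fun y => e k y - e' k y))) :=
        fun k _ => (isKer_tens (isTest_update (hF k) k ((he k).sub (he' k)))).nice.dil j
      rw [← cv_sum_left _ hkn hu, ← cv_add_left hb (.sum _ hkn) hu]
      congr 1
      ext z
      simp only [dil]
      rw [tens_eq_add_sum e e', mul_add, Finset.mul_sum]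
    have hψn : ∀ k ∈ Finset.univ, Nice fun y => ((2 : ℝ) ^ (j * (L : ℤ))) •
        cv (dil w j (ψ k)) (pdIter n k (l k) u) y :=
      fun k _ => (((hψK k).nice.dil j).cv (nice_schwartz _)).smul _
    have h3 : cv (dil w j (tens e)) (cv (dil w j A) u) x
        = cv (dil w j (tens e')) (cv (dil w j A) u) x + ((2 : ℝ) ^ (j * (L : ℤ))) •
          ∑ k, cv (dil w j (cv A (ψ k))) (pdIter n k (l k) u) x := by
      rw [cv_left_comm ha hAn hu, cv_left_comm hb hAn hu, hd,
        cv_add_right hAn (hb.cv hu) (.sum _ hψn), cv_sum_right _ hAn hψn, Finset.smul_sum]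
      congr 1
      refine Finset.sum_congr rfl fun k _ => ?_
      rw [cv_smul_right, cv_assoc hAn ((hψK k).nice.dil j) (nice_schwartz _), cv_dil_dil]
    have h4 : ∀ K, Nice K → cv K (cv (dil w j A) u) x
        = c • (cv K (cv (dil w j (tens e)) V) x + cv K (cv (dil w j (tens e')) V) x) := by
      intro K hK
      rw [funext hW, cv_smul_right, cv_add_right hK (ha.cv hV) (hb.cv hV)]
    rw [h4 _ ha, h4 _ hb, cv_left_comm hb ha hV, smul_add, smul_add] at h3
    replace h3 : c • cv (dil w j (tens e)) (cv (dil w j (tens e)) V) x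
        = c • cv (dil w j (tens e')) (cv (dil w j (tens e')) V) x + ((2 : ℝ) ^ (j * (L : ℤ))) •
          ∑ k, cv (dil w j (cv A (ψ k))) (pdIter n k (l k) u) x :=
      add_right_cancel (h3.trans (by abel))
    rw [add_comm j 1, ← dil_dil, ← cv_dil_dil, ← cv_dil_dil, ← cv_dil_dil, hT',
      ← cv_assoc ha ha hV, ← cv_assoc hb hb hV]
    have h5 := congrArg (fun v => c⁻¹ • v) h3
    simp only [smul_add, smul_smul, inv_mul_cancel₀ hcpos, one_smul] at h5
    rw [h5, mul_sub, zpow_sub₀ two_ne_zero, ← hc, div_eq_inv_mul]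

end

section

open scoped ENNReal NNReal ContDiff Topology

variable {n : ℕ} {w : Fin n → ℕ}

theorem dil_zero (κ : (Fin n → ℝ) → ℝ) : dil w 0 κ = κ := by
  ext z; simp [dil, ds_zero]

theorem tendsto_cv_dil_neg (hw : ∀ k, 0 < w k) {Φ : (Fin n → ℝ) → ℝ} (hΦ : Nice Φ)
    (h1 : ∫ x, Φ x = 1) {v : (Fin n → ℝ) → ℂ} (hv : Nice v) (hvc : Continuous v)
    (x : Fin n → ℝ) :
    Filter.Tendsto (fun N : ℕ => cv (dil w (-(N : ℤ)) Φ) v x) Filter.atTop (𝓝 (v x)) := by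
  obtain ⟨M, hM⟩ := hv.2
  have e : v x = ∫ z, Φ z • v x := by rw [integral_smul_const, h1, one_smul]
  rw [e]
  simp_rw [cv_dil_eq]
  refine tendsto_integral_of_dominated_convergence (fun z => M * ‖Φ z‖) (fun N => ?_)
    (hΦ.1.norm.const_mul M) (fun N => Filter.Eventually.of_forall fun z => ?_)
    (Filter.Eventually.of_forall fun z => ?_)
  · exact hΦ.1.aestronglyMeasurable.smul (hvc.comp (by fun_prop)).aestronglyMeasurable
  · rw [norm_smul, mul_comm]
    exact mul_le_mul_of_nonneg_right (hM _) (norm_nonneg _)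
  · refine Filter.Tendsto.const_smul ?_ _
    have h2 : Filter.Tendsto (fun N : ℕ => x - ds w (-(N : ℤ)) * z) Filter.atTop (𝓝 x) := by
      rw [tendsto_pi_nhds]
      intro k
      have h3 : Filter.Tendsto (fun N : ℕ => (((2 : ℝ) ^ w k)⁻¹) ^ N) Filter.atTop (𝓝 0) :=
        tendsto_pow_atTop_nhds_zero_of_lt_one (by positivity)
          (inv_lt_one_of_one_lt₀ (one_lt_pow₀ one_lt_two (hw k).ne'))
      have h4 := (h3.mul_const (z k)).const_sub (x k)
      simp only [zero_mul, sub_zero] at h4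
      refine h4.congr fun N => ?_
      simp only [Pi.sub_apply, Pi.mul_apply, ds]
      rw [neg_mul, zpow_neg, mul_comm (N : ℤ), zpow_mul, zpow_natCast, zpow_natCast, inv_pow]
    exact (hvc.tendsto x).comp h2

theorem tendsto_cv_dil_atTop (hD : 0 < hdim w) {Φ : (Fin n → ℝ) → ℝ} (hΦ : Nice Φ)
    {v : (Fin n → ℝ) → ℂ} (hv : Nice v) (x : Fin n → ℝ) :
    Filter.Tendsto (fun N : ℕ => cv (dil w (N : ℤ) Φ) v x) Filter.atTop (𝓝 0) := by
  obtain ⟨M, hM⟩ := hΦ.2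
  have h3 : Filter.Tendsto (fun N : ℕ => (((2 : ℝ) ^ hdim w)⁻¹) ^ N) Filter.atTop (𝓝 0) :=
    tendsto_pow_atTop_nhds_zero_of_lt_one (by positivity)
      (inv_lt_one_of_one_lt₀ (one_lt_pow₀ one_lt_two hD.ne'))
  have h4 := (h3.mul_const M).mul_const (∫ y, ‖v y‖)
  simp only [zero_mul] at h4
  refine squeeze_zero_norm (fun N => ?_) h4
  rw [← integral_const_mul]
  refine norm_integral_le_of_norm_le (hv.1.norm.const_mul _)
    (Filter.Eventually.of_forall fun y => ?_)
  rw [norm_smul]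
  refine mul_le_mul_of_nonneg_right ?_ (norm_nonneg _)
  rw [dil, norm_mul, mul_comm (N : ℤ), zpow_neg, zpow_mul, zpow_natCast, zpow_natCast, inv_pow,
    Real.norm_of_nonneg (by positivity)]
  exact mul_le_mul_of_nonneg_left (hM _) (by positivity)

theorem eLpNorm_ofReal_eq {p : ℝ} (hp : 0 < p) (f : (Fin n → ℝ) → ℂ) :
    eLpNorm f (ENNReal.ofReal p) volume = (∫⁻ x, ‖f x‖ₑ ^ p) ^ (1 / p) := by
  rw [eLpNorm_eq_lintegral_rpow_enorm_toReal (by simpa using hp) ENNReal.ofReal_ne_top,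
    ENNReal.toReal_ofReal hp.le]

theorem eLpNorm_le_of_lintegral_le {p q : ℝ} (hp : 0 < p) (hq : 0 < q)
    {f g : (Fin n → ℝ) → ℂ} {C : ℝ≥0∞}
    (h : ∫⁻ x, ‖g x‖ₑ ^ q ≤ C * (∫⁻ x, ‖f x‖ₑ ^ p) ^ (q / p)) :
    eLpNorm g (ENNReal.ofReal q) volume
      ≤ C ^ (1 / q) * eLpNorm f (ENNReal.ofReal p) volume := by
  rw [eLpNorm_ofReal_eq hp, eLpNorm_ofReal_eq hq]
  calc (∫⁻ x, ‖g x‖ₑ ^ q) ^ (1 / q) ≤ (C * (∫⁻ x, ‖f x‖ₑ ^ p) ^ (q / p)) ^ (1 / q) :=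
        ENNReal.rpow_le_rpow h (by positivity)
    _ = _ := by
        rw [ENNReal.mul_rpow_of_nonneg _ _ (by positivity), ← ENNReal.rpow_mul]
        congr 2
        field_simp

theorem exists_eLpNorm_sum_dil_le (hw : ∀ k, 0 < w k) (hD : 0 < hdim w)
    {A B : (Fin n → ℝ) → ℝ} (hA : IsKer A) (hB : IsKer B) (hB0 : ∫ x, B x = 0) {p q : ℝ}
    (hp : 1 < p) (hpq : p ≤ q) (hA0 : p = q → ∫ x, A x = 0) {s : ℝ}
    (hs : s = hdim w * (1 / p - 1 / q)) :
    ∃ C : ℝ≥0, ∀ (J : Finset ℤ) (f : (Fin n → ℝ) → ℂ), Nice f → Continuous f →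
      eLpNorm (fun x => ∑ j ∈ J, ((2 : ℝ) ^ (j * s)) • cv (dil w j (cv A B)) f x)
        (ENNReal.ofReal q) volume ≤ C * eLpNorm f (ENNReal.ofReal p) volume := by
  have hp0 : 0 < p := by linarith
  have hq0 : 0 < q := by linarith
  suffices h : ∃ C : ℝ≥0, ∀ (J : Finset ℤ) (f : (Fin n → ℝ) → ℂ), Nice f → Continuous f →
      ∫⁻ x, ‖∑ j ∈ J, ((2 : ℝ) ^ (j * s)) • cv (dil w j (cv A B)) f x‖ₑ ^ q
        ≤ C * (∫⁻ y, ‖f y‖ₑ ^ p) ^ (q / p) by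
    obtain ⟨C, hC⟩ := h
    refine ⟨C ^ (1 / q), fun J f hf hfc => ?_⟩
    rw [ENNReal.coe_rpow_of_nonneg _ (by positivity)]
    exact eLpNorm_le_of_lintegral_le hp0 hq0 (hC J f hf hfc)
  rcases hpq.eq_or_lt with rfl | hlt
  · obtain ⟨C, hC⟩ := lintegral_cv_sum_dil_rpow_le hw hD hA hB (hA0 rfl) hB0 hp
    refine ⟨C, fun J f hf hfc => ?_⟩
    have := hC J f hf hfc
    simp_rw [cv_sum_left J (fun j _ => (hA.nice.cv hB.nice).dil (w := w) j) hf] at this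
    simpa [hs, hp0.ne'] using this
  · obtain ⟨C, hC⟩ := lintegral_sum_dil_rpow_le hw hD (hA.cv hB) hp hlt
    refine ⟨C, fun J f hf hfc => le_trans (lintegral_mono fun x => ?_) (hC J f hf hfc)⟩
    refine ENNReal.rpow_le_rpow ((enorm_sum_le _ _).trans (Finset.sum_le_sum fun j _ => ?_)) hq0.le
    rw [enorm_smul, hs, Real.enorm_of_nonneg (by positivity)]

theorem exists_eLpNorm_sum_neg_dil_le {κ : (Fin n → ℝ) → ℝ} (hκ : Nice κ) (hκc : Continuous κ)
    {p q : ℝ} (hp : 1 < p) (hpq : p ≤ q) {s : ℝ} (hs : hdim w * (1 / p - 1 / q) < s) :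
    ∃ C : ℝ≥0, ∀ (J : Finset ℤ) (f : (Fin n → ℝ) → ℂ), (∀ j ∈ J, j ≤ 0) → Nice f →
      eLpNorm (fun x => ∑ j ∈ J, ((2 : ℝ) ^ (j * s)) • cv (dil w j κ) f x)
        (ENNReal.ofReal q) volume ≤ C * eLpNorm f (ENNReal.ofReal p) volume := by
  have hp0 : 0 < p := by linarith
  have hq0 : 0 < q := by linarith
  set δ : ℝ := s - hdim w * (1 / p - 1 / q) with hδ
  have hδ0 : 0 < δ := by linarith
  have hsum := summable_two_rpow_neg_abs hδ0
  obtain ⟨C, hC⟩ := lintegral_cv_dil_rpow_le (w := w) hκ hp hpq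
  refine ⟨C ^ (1 / q) * (∑' m : ℤ, (2 : ℝ) ^ (-(δ * |(m : ℝ)|))).toNNReal, fun J f hJ hf => ?_⟩
  have hsumfun : (fun x => ∑ j ∈ J, ((2 : ℝ) ^ (j * s)) • cv (dil w j κ) f x)
      = ∑ j ∈ J, ((2 : ℝ) ^ (j * s)) • cv (dil w j κ) f := by
    ext x; simp
  rw [hsumfun]
  refine (eLpNorm_sum_le (fun j _ => ?_) (by simpa using (hp.le.trans hpq))).trans ?_
  · exact ((continuous_cv (hκ.dil j) (continuous_dil hκc j) hf).const_smul _).aestronglyMeasurable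
  calc ∑ j ∈ J, eLpNorm (((2 : ℝ) ^ (j * s)) • cv (dil w j κ) f) (ENNReal.ofReal q) volume
      ≤ ∑ j ∈ J, (C : ℝ≥0∞) ^ (1 / q) * ENNReal.ofReal ((2 : ℝ) ^ (-(δ * |(j : ℝ)|))) *
          eLpNorm f (ENNReal.ofReal p) volume := by
        refine Finset.sum_le_sum fun j hj => ?_
        rw [eLpNorm_const_smul]
        refine (mul_le_mul_right (eLpNorm_le_of_lintegral_le hp0 hq0 (hC j f hf)) _).trans_eq ?_
        rw [← mul_assoc]
        congr 1
        rw [ENNReal.mul_rpow_of_nonneg _ _ (by positivity), mul_left_comm]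
        congr 1
        rw [Real.enorm_of_nonneg (by positivity),
          ENNReal.ofReal_rpow_of_nonneg (by positivity) (by positivity),
          ← ENNReal.ofReal_mul (by positivity), ← Real.rpow_mul zero_le_two,
          ← Real.rpow_add two_pos]
        congr 2
        have : (j : ℝ) ≤ 0 := by exact_mod_cast hJ j hj
        rw [abs_of_nonpos this, hδ]
        field_simp
        ring
    _ = (C : ℝ≥0∞) ^ (1 / q) * ENNReal.ofReal (∑ j ∈ J, (2 : ℝ) ^ (-(δ * |(j : ℝ)|))) *
          eLpNorm f (ENNReal.ofReal p) volume := by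
        rw [← Finset.sum_mul, ← Finset.mul_sum, ENNReal.ofReal_sum_of_nonneg]
        intro i _; positivity
    _ ≤ _ := by
        rw [ENNReal.coe_mul, ENNReal.coe_rpow_of_nonneg _ (by positivity)]
        refine mul_le_mul_left (mul_le_mul_right ?_ _) _
        exact ENNReal.ofReal_le_ofReal (hsum.sum_le_tsum _ fun i _ => by positivity)

theorem eLpNorm_le_of_tendsto {q : ℝ≥0∞} {F : ℕ → (Fin n → ℝ) → ℂ} {V : (Fin n → ℝ) → ℂ}
    {K : ℝ≥0∞} (hF : ∀ N, Continuous (F N))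
    (hlim : ∀ x, Filter.Tendsto (fun N => F N x) Filter.atTop (𝓝 (V x)))
    (hK : ∀ N, eLpNorm (F N) q volume ≤ K) : eLpNorm V q volume ≤ K := by
  refine (Lp.eLpNorm_lim_le_liminf_eLpNorm (fun N => (hF N).aestronglyMeasurable) V
    (Filter.Eventually.of_forall hlim)).trans ?_
  exact Filter.liminf_le_of_frequently_le' (Filter.Frequently.of_forall hK)

end

section

open scoped ENNReal NNReal ContDiff Topology

variable {n : ℕ} {w : Fin n → ℕ}

theorem eq_add_sum_Ico_of_step {G : ℤ → ℂ} {S : ℤ → ℂ} (h : ∀ j, G j = G (j + 1) + S j) (a : ℤ)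
    (N : ℕ) : G a = G (a + N) + ∑ j ∈ Finset.Ico a (a + N), S j := by
  induction N with
  | zero => simp
  | succ N ih =>
    have e : Finset.Ico a (a + (N + 1 : ℕ)) = insert (a + N) (Finset.Ico a (a + N)) := by
      ext i; simp only [Finset.mem_Ico, Finset.mem_insert]; omega
    rw [e, Finset.sum_insert (by simp), ih, h (a + N)]
    push_cast
    rw [add_assoc a, add_assoc, add_comm (S _)]

theorem eLpNorm_fun_sum_le {ι : Type*} [Fintype ι] {q : ℝ} (hq : 1 ≤ q)
    {F : ι → (Fin n → ℝ) → ℂ} {B : ι → ℝ≥0∞} (hF : ∀ k, Continuous (F k))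
    (h : ∀ k, eLpNorm (F k) (ENNReal.ofReal q) volume ≤ B k) :
    eLpNorm (fun x => ∑ k, F k x) (ENNReal.ofReal q) volume ≤ ∑ k, B k := by
  have e : (fun x => ∑ k, F k x) = ∑ k, F k := by ext x; simp
  rw [e]
  exact (eLpNorm_sum_le (fun k _ => (hF k).aestronglyMeasurable) (by simpa using hq)).trans
    (Finset.sum_le_sum fun k _ => h k)

/-- The anisotropic embedding without parameters. -/
theorem exists_eLpNorm_Dmix_le (hw : ∀ k, 0 < w k) {p q : ℝ} (hp : 1 < p) (hpq : p ≤ q)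
    (l α : Fin n → ℕ) {L : ℕ} (hL0 : 0 < L) (hL : ∀ k, l k * w k = L)
    (hle : ∑ k, (α k * w k : ℝ) + hdim w * (1 / p - 1 / q) ≤ L) :
    ∃ C : ℝ≥0, ∀ u : SchwartzMap (Fin n → ℝ) ℂ,
      eLpNorm (Dmix n α u) (ENNReal.ofReal q) volume
        ≤ C * (eLpNorm u (ENNReal.ofReal p) volume
          + ∑ k, eLpNorm (pdIter n k (l k) u) (ENNReal.ofReal p) volume) := by
  have hp0 : 0 < p := by linarith
  have hq0 : 0 < q := by linarith
  have hq1 : 1 ≤ q := by linarith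
  have hL0' : (0 : ℝ) < L := by exact_mod_cast hL0
  obtain ⟨Φ, Φ', A, ψ, hΦ, hΦ1, hΦ', hA, hψ, hψ0, hA0, hΦu, hrep⟩ :=
    exists_reproducing (w := w) l α L hL
  set m : ℤ := (L : ℤ) - ∑ k, (α k * w k : ℤ) with hm
  have hms : (m : ℝ) = L - ∑ k, (α k * w k : ℝ) := by rw [hm]; push_cast; rfl
  have hrep' : ∀ (u : SchwartzMap (Fin n → ℝ) ℂ) x (a : ℤ) (N : ℕ),
      cv (dil w a Φ) (Dmix n α u) x = cv (dil w (a + N) Φ) (Dmix n α u) x +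
        ∑ k, ∑ j ∈ Finset.Ico a (a + N), ((2 : ℝ) ^ ((j : ℝ) * (m : ℝ))) •
          cv (dil w j (cv A (ψ k))) (pdIter n k (l k) u) x := by
    intro u x a N
    rw [eq_add_sum_Ico_of_step (G := fun j => cv (dil w j Φ) (Dmix n α u) x)
      (fun j => hrep u j x) a N, Finset.sum_comm]
    congr 1
    refine Finset.sum_congr rfl fun j _ => ?_
    rw [← Finset.smul_sum, ← Real.rpow_intCast]
    push_cast
    rfl
  have hcont : ∀ (u : SchwartzMap (Fin n → ℝ) ℂ) k (J : Finset ℤ), Continuous fun x =>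
      ∑ j ∈ J, ((2 : ℝ) ^ ((j : ℝ) * (m : ℝ))) •
        cv (dil w j (cv A (ψ k))) (pdIter n k (l k) u) x := fun u k J =>
    continuous_finsetSum _ fun j _ =>
      (continuous_cv ((hA.cv (hψ k)).nice.dil j) (continuous_dil (hA.cv (hψ k)).cont j)
        (nice_schwartz _)).fun_const_smul _
  have hlim : ∀ (u : SchwartzMap (Fin n → ℝ) ℂ) x, Filter.Tendsto
      (fun N : ℕ => cv (dil w (-(N : ℤ)) Φ) (Dmix n α u) x) Filter.atTop (𝓝 (Dmix n α u x)) :=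
    fun u x => tendsto_cv_dil_neg hw hΦ.nice hΦ1 (nice_schwartz _) (Dmix n α u).continuous x
  rcases hle.eq_or_lt with heq | hlt
  · have hD : 0 < hdim w := by
      rcases Nat.eq_zero_or_pos n with rfl | hn
      · simp [hdim] at heq; linarith
      · exact Finset.sum_pos (fun k _ => hw k) ⟨⟨0, hn⟩, Finset.mem_univ _⟩
    have hAz : p = q → ∫ x, A x = 0 := by
      rintro rfl
      refine hA0 ?_
      by_contra! hα
      have : ∀ k, α k = 0 := fun k => Nat.le_zero.1 (hα k)
      simp [this] at heq
      linarith
    choose C hC using fun k => exists_eLpNorm_sum_dil_le hw hD hA (hψ k) (hψ0 k) hp hpq hAz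
      (s := m) (by rw [hms]; linarith)
    refine ⟨∑ k, C k, fun u => ?_⟩
    refine eLpNorm_le_of_tendsto (F := fun (N : ℕ) x => ∑ k,
      ∑ j ∈ Finset.Ico (-(N : ℤ)) (-(N : ℤ) + (2 * N : ℕ)), ((2 : ℝ) ^ ((j : ℝ) * (m : ℝ))) •
          cv (dil w j (cv A (ψ k))) (pdIter n k (l k) u) x)
      (fun N => continuous_finsetSum _ fun k _ => hcont u k _) (fun x => ?_) (fun N => ?_)
    · have h := (hlim u x).sub (tendsto_cv_dil_atTop hD hΦ.nice (nice_schwartz (Dmix n α u)) x)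
      rw [sub_zero] at h
      refine h.congr fun N => ?_
      rw [hrep' u x _ (2 * N)]
      have : -(N : ℤ) + (2 * N : ℕ) = N := by push_cast; ring
      rw [this, add_sub_cancel_left]
    · refine (eLpNorm_fun_sum_le hq1 (fun k => hcont u k _) fun k =>
        hC k _ _ (nice_schwartz _) (SchwartzMap.continuous _)).trans ?_
      rw [ENNReal.ofNNReal_finsetSum, Finset.sum_mul]
      refine Finset.sum_le_sum fun k _ => mul_le_mul_right (le_add_left ?_) _
      exact Finset.single_le_sum (f := fun k => eLpNorm (pdIter n k (l k) u) (ENNReal.ofReal p)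
        volume) (fun _ _ => zero_le) (Finset.mem_univ k)
  · choose C hC using fun k => exists_eLpNorm_sum_neg_dil_le (w := w) (hA.cv (hψ k)).nice
      (hA.cv (hψ k)).cont hp hpq (s := m) (by rw [hms]; linarith)
    obtain ⟨C₀, hC₀⟩ := lintegral_cv_dil_rpow_le (w := w) hΦ' hp hpq
    have hΦ'' : ∀ u : SchwartzMap (Fin n → ℝ) ℂ, eLpNorm (cv Φ' u) (ENNReal.ofReal q) volume
        ≤ (C₀ ^ (1 / q) : ℝ≥0) * eLpNorm u (ENNReal.ofReal p) volume := by
      intro u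
      have h := hC₀ 0 u (nice_schwartz u)
      simp only [dil_zero, Int.cast_zero, zero_mul, neg_zero, Real.rpow_zero, ENNReal.ofReal_one,
        mul_one] at h
      rw [ENNReal.coe_rpow_of_nonneg _ (by positivity)]
      exact eLpNorm_le_of_lintegral_le hp0 hq0 h
    refine ⟨C₀ ^ (1 / q) + ∑ k, C k, fun u => ?_⟩
    have hcΦ : Continuous (cv Φ' u) := by
      rw [← funext (hΦu u)]
      exact continuous_cv hΦ.nice hΦ.cont (nice_schwartz _)
    have hF := fun (N : ℕ) x => hrep' u x (-(N : ℤ)) N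
    simp only [neg_add_cancel, dil_zero, hΦu] at hF
    refine eLpNorm_le_of_tendsto (F := fun (N : ℕ) x => cv (dil w (-(N : ℤ)) Φ) (Dmix n α u) x)
      (fun N => continuous_cv (hΦ.nice.dil _) (continuous_dil hΦ.cont _) (nice_schwartz _))
      (hlim u) (fun N => ?_)
    simp_rw [hF]
    refine (eLpNorm_add_le hcΦ.aestronglyMeasurable
      (continuous_finsetSum _ fun k _ => hcont u k _).aestronglyMeasurable
      (by simpa using hq1)).trans ?_
    rw [ENNReal.coe_add, add_mul]
    refine add_le_add ((hΦ'' u).trans (mul_le_mul_right le_self_add _)) ?_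
    refine (eLpNorm_fun_sum_le hq1 (fun k => hcont u k _) fun k =>
      hC k _ _ (fun j hj => (Finset.mem_Ico.1 hj).2.le) (nice_schwartz _)).trans ?_
    rw [ENNReal.ofNNReal_finsetSum, Finset.sum_mul]
    refine Finset.sum_le_sum fun k _ => mul_le_mul_right (le_add_left ?_) _
    exact Finset.single_le_sum (f := fun k => eLpNorm (pdIter n k (l k) u) (ENNReal.ofReal p)
      volume) (fun _ _ => zero_le) (Finset.mem_univ k)

end

section

open scoped ENNReal NNReal ContDiff Topology

variable {n : ℕ} {w : Fin n → ℕ}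

/-- Coordinatewise multiplication by positive reals. -/
def mulEquiv {c : Fin n → ℝ} (hc : ∀ k, 0 < c k) : (Fin n → ℝ) ≃L[ℝ] (Fin n → ℝ) :=
  ContinuousLinearEquiv.piCongrRight fun k =>
    ContinuousLinearEquiv.smulLeft (Units.mk0 (c k) (hc k).ne')

theorem mulEquiv_apply {c : Fin n → ℝ} (hc : ∀ k, 0 < c k) (x : Fin n → ℝ) :
    mulEquiv hc x = c * x := rfl

/-- The rescaled Schwartz function `x ↦ u (c * x)`. -/
def scale {c : Fin n → ℝ} (hc : ∀ k, 0 < c k) (u : SchwartzMap (Fin n → ℝ) ℂ) :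
    SchwartzMap (Fin n → ℝ) ℂ :=
  SchwartzMap.compCLMOfContinuousLinearEquiv ℝ (mulEquiv hc) u

theorem scale_apply {c : Fin n → ℝ} (hc : ∀ k, 0 < c k) (u : SchwartzMap (Fin n → ℝ) ℂ)
    (x : Fin n → ℝ) : scale hc u x = u (c * x) := rfl

theorem lineDerivOpCLM_smul_scale {c : Fin n → ℝ} (hc : ∀ k, 0 < c k) (k : Fin n) (a : ℝ)
    (u : SchwartzMap (Fin n → ℝ) ℂ) :
    LineDeriv.lineDerivOpCLM ℝ (SchwartzMap (Fin n → ℝ) ℂ) (Pi.single k 1 : Fin n → ℝ)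
        (a • scale hc u) = (a * c k) • scale hc
      (LineDeriv.lineDerivOpCLM ℝ (SchwartzMap (Fin n → ℝ) ℂ) (Pi.single k 1 : Fin n → ℝ) u) := by
  have h : mulEquiv hc (Pi.single k 1) = c k • (Pi.single k 1 : Fin n → ℝ) := by
    ext i
    rw [mulEquiv_apply]
    by_cases hi : i = k
    · subst hi; simp
    · simp [hi]
  rw [map_smul, mul_smul]
  congr 1
  simp only [scale, LineDeriv.lineDerivOpCLM_apply,
    SchwartzMap.lineDerivOp_compCLMOfContinuousLinearEquiv, h]
  rw [LineDeriv.lineDerivOp_left_smul, map_smul]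

theorem pdIter_smul_scale {c : Fin n → ℝ} (hc : ∀ k, 0 < c k) (k : Fin n) (i : ℕ) (a : ℝ)
    (u : SchwartzMap (Fin n → ℝ) ℂ) :
    pdIter n k i (a • scale hc u) = (a * c k ^ i) • scale hc (pdIter n k i u) := by
  induction i generalizing a u with
  | zero => simp [pdIter]
  | succ i ih =>
    rw [pdIter_succ, lineDerivOpCLM_smul_scale, ih, ← pdIter_succ, pow_succ', mul_assoc]

theorem foldl_pdIter_smul_scale {c : Fin n → ℝ} (hc : ∀ k, 0 < c k) (α : Fin n → ℕ)
    (ks : List (Fin n)) (a : ℝ) (u : SchwartzMap (Fin n → ℝ) ℂ) :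
    ks.foldl (fun v k => pdIter n k (α k) v) (a • scale hc u)
      = (a * (ks.map fun k => c k ^ α k).prod) •
        scale hc (ks.foldl (fun v k => pdIter n k (α k) v) u) := by
  induction ks generalizing a u with
  | nil => simp
  | cons k ks ih =>
    rw [List.foldl_cons, pdIter_smul_scale, ih, List.foldl_cons, List.map_cons, List.prod_cons,
      mul_assoc]

theorem Dmix_scale {c : Fin n → ℝ} (hc : ∀ k, 0 < c k) (α : Fin n → ℕ)
    (u : SchwartzMap (Fin n → ℝ) ℂ) :
    Dmix n α (scale hc u) = (∏ k, c k ^ α k) • scale hc (Dmix n α u) := by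
  have h := foldl_pdIter_smul_scale hc α (List.finRange n) 1 u
  rw [one_smul, one_mul] at h
  rw [Dmix, h, Dmix]
  congr 1

theorem LpN_nonneg (p : ℝ) (f : (Fin n → ℝ) → ℂ) : 0 ≤ LpN n p f := by
  unfold LpN; positivity

theorem LpN_smul_scale {c : Fin n → ℝ} (hc : ∀ k, 0 < c k) {p : ℝ} (hp : 0 < p) {a : ℝ}
    (ha : 0 ≤ a) (u : SchwartzMap (Fin n → ℝ) ℂ) :
    LpN n p (a • scale hc u : SchwartzMap (Fin n → ℝ) ℂ)
      = a * (∏ k, c k) ^ (-(1 / p)) * LpN n p u := by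
  have hP : 0 < ∏ k, c k := Finset.prod_pos fun k _ => hc k
  unfold LpN
  have h1 : ∀ x, ‖(a • scale hc u : SchwartzMap (Fin n → ℝ) ℂ) x‖ ^ p
      = a ^ p * ‖u (c * x)‖ ^ p := by
    intro x
    rw [_root_.smul_apply, scale_apply, norm_smul, Real.norm_of_nonneg ha,
      Real.mul_rpow ha (norm_nonneg _)]
  simp_rw [h1]
  rw [integral_const_mul, integral_comp_mul hc fun x => ‖u x‖ ^ p, smul_eq_mul,
    Real.mul_rpow (by positivity) (by positivity), Real.mul_rpow (by positivity) (by positivity),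
    ← Real.rpow_mul ha, mul_one_div_cancel hp.ne', Real.rpow_one, Real.rpow_neg hP.le,
    Real.inv_rpow hP.le, mul_assoc]

theorem eLpNorm_eq_ofReal_LpN {p : ℝ} (hp : 1 ≤ p) (u : SchwartzMap (Fin n → ℝ) ℂ) :
    eLpNorm u (ENNReal.ofReal p) volume = ENNReal.ofReal (LpN n p u) := by
  have hp0 : 0 < p := by linarith
  rw [((nice_schwartz u).memLp hp).eLpNorm_eq_integral_rpow_norm (by simpa using hp0)
    ENNReal.ofReal_ne_top, ENNReal.toReal_ofReal hp0.le, LpN, one_div]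

theorem exists_LpN_Dmix_le {p q : ℝ} (hp : 1 < p) (hpq : p ≤ q) (l : Fin n → ℕ)
    (hl : ∀ k, 0 < l k) (α : Fin n → ℕ)
    (hle : ∑ k, ((α k : ℝ) + 1 / p - 1 / q) / (l k : ℝ) ≤ 1) :
    ∃ C : ℝ, 0 ≤ C ∧ ∀ u : SchwartzMap (Fin n → ℝ) ℂ,
      LpN n q (Dmix n α u) ≤ C * (LpN n p u + ∑ k, LpN n p (pdIter n k (l k) u)) := by
  set L : ℕ := ∏ k, l k with hLdef
  have hL0 : 0 < L := Finset.prod_pos fun k _ => hl k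
  have hL0' : (0 : ℝ) < L := by exact_mod_cast hL0
  have hdvd : ∀ k, l k ∣ L := fun k => Finset.dvd_prod_of_mem l (Finset.mem_univ k)
  have hL : ∀ k, l k * (L / l k) = L := fun k => Nat.mul_div_cancel' (hdvd k)
  have hw : ∀ k, 0 < L / l k := fun k => Nat.div_pos (Nat.le_of_dvd hL0 (hdvd k)) (hl k)
  have hwr : ∀ k, ((L / l k : ℕ) : ℝ) = L / l k := fun k =>
    Nat.cast_div (hdvd k) (by exact_mod_cast (hl k).ne')
  obtain ⟨C, hC⟩ := exists_eLpNorm_Dmix_le (w := fun k => L / l k) hw hp hpq l α hL0 hL (by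
    have h := mul_le_mul_of_nonneg_left hle hL0'.le
    rw [mul_one] at h
    refine le_trans (le_of_eq ?_) h
    simp only [hdim, Nat.cast_sum, hwr]
    rw [Finset.sum_mul, ← Finset.sum_add_distrib, Finset.mul_sum]
    refine Finset.sum_congr rfl fun k _ => ?_
    ring)
  refine ⟨C, C.coe_nonneg, fun u => ?_⟩
  have h := hC u
  simp only [eLpNorm_eq_ofReal_LpN hp.le, eLpNorm_eq_ofReal_LpN (hp.le.trans hpq)] at h
  rw [← ENNReal.ofReal_sum_of_nonneg (fun k _ => LpN_nonneg _ _),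
    ← ENNReal.ofReal_add (LpN_nonneg _ _) (Finset.sum_nonneg fun k _ => LpN_nonneg _ _),
    ← ENNReal.ofReal_coe_nnreal, ← ENNReal.ofReal_mul C.coe_nonneg] at h
  exact (ENNReal.ofReal_le_ofReal_iff (mul_nonneg C.coe_nonneg (add_nonneg (LpN_nonneg _ _)
    (Finset.sum_nonneg fun k _ => LpN_nonneg _ _)))).1 h

theorem exists_LpN_Dmix_scaled_le {p q : ℝ} (hp : 1 < p) (hpq : p ≤ q) (l : Fin n → ℕ)
    (hl : ∀ k, 0 < l k) (α : Fin n → ℕ)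
    (hle : ∑ k, ((α k : ℝ) + 1 / p - 1 / q) / (l k : ℝ) ≤ 1) :
    ∃ C : ℝ, 0 ≤ C ∧ ∀ (u : SchwartzMap (Fin n → ℝ) ℂ) (τ : ℝ), 0 < τ →
      ∀ t : Fin n → ℝ, (∀ k, 0 < t k) →
      τ ^ (∑ k, ((α k : ℝ) + 1 / p - 1 / q) / (l k : ℝ)) *
        ((∏ k, t k ^ (((α k : ℝ) + 1 / p - 1 / q) / (l k : ℝ))) * LpN n q (Dmix n α u))
        ≤ C * (LpN n p u + τ * ∑ k, t k * LpN n p (pdIter n k (l k) u)) := by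
  obtain ⟨C, hC0, hC⟩ := exists_LpN_Dmix_le hp hpq l hl α hle
  refine ⟨C, hC0, fun u τ hτ t ht => ?_⟩
  have hp0 : 0 < p := by linarith
  have hq0 : 0 < q := by linarith
  have hlr : ∀ k, (0 : ℝ) < l k := fun k => by exact_mod_cast hl k
  set c : Fin n → ℝ := fun k => (τ * t k) ^ (1 / (l k : ℝ)) with hc_def
  have hτt : ∀ k, 0 < τ * t k := fun k => mul_pos hτ (ht k)
  have hc : ∀ k, 0 < c k := fun k => Real.rpow_pos_of_pos (hτt k) _
  have hcl : ∀ k, c k ^ l k = τ * t k := fun k => by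
    rw [hc_def, ← Real.rpow_natCast, ← Real.rpow_mul (hτt k).le,
      one_div_mul_cancel (hlr k).ne', Real.rpow_one]
  set P := ∏ k, c k with hP_def
  have hP : 0 < P := Finset.prod_pos fun k _ => hc k
  have h := hC (scale hc u)
  have e1 : LpN n p (scale hc u) = P ^ (-(1 / p)) * LpN n p u := by
    have := LpN_smul_scale hc hp0 zero_le_one u
    rwa [one_smul, one_mul] at this
  have e2 : ∀ k, LpN n p (pdIter n k (l k) (scale hc u))
      = P ^ (-(1 / p)) * (τ * (t k * LpN n p (pdIter n k (l k) u))) := fun k => by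
    have := pdIter_smul_scale hc k (l k) 1 u
    rw [one_smul, one_mul, hcl] at this
    rw [this, LpN_smul_scale hc hp0 (hτt k).le]
    ring
  rw [Dmix_scale, LpN_smul_scale hc hq0 (Finset.prod_nonneg fun k _ => (pow_pos (hc k) _).le),
    e1] at h
  simp_rw [e2] at h
  rw [← Finset.mul_sum, ← Finset.mul_sum, ← mul_add] at h
  have h' := mul_le_mul_of_nonneg_left h (Real.rpow_nonneg hP.le (1 / p))
  have e3 : P ^ (1 / p) * (C * (P ^ (-(1 / p)) * (LpN n p u +
      τ * ∑ k, t k * LpN n p (pdIter n k (l k) u))))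
      = C * (LpN n p u + τ * ∑ k, t k * LpN n p (pdIter n k (l k) u)) := by
    rw [mul_left_comm, ← mul_assoc (P ^ (1 / p)), ← Real.rpow_add hP, add_neg_cancel,
      Real.rpow_zero, one_mul]
  rw [e3] at h'
  refine le_trans (le_of_eq ?_) h'
  rw [← mul_assoc, ← mul_assoc]
  congr 1
  rw [Real.rpow_sum_of_pos hτ, ← Finset.prod_mul_distrib, mul_left_comm, ← Real.rpow_add hP,
    hP_def, ← Real.finsetProd_rpow _ _ (fun k _ => (hc k).le), ← Finset.prod_mul_distrib]
  refine Finset.prod_congr rfl fun k _ => ?_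
  rw [← Real.mul_rpow hτ.le (ht k).le, ← Real.rpow_natCast, ← Real.rpow_add (hc k), hc_def,
    ← Real.rpow_mul (hτt k).le]
  congr 1
  ring

end

end Anisotropic

/-- The scalar instance of Theorem 3.1 / Result 3.4 (classical anisotropic Sobolev embedding
with parameters): for `1 < p ≤ q < ∞`, `ϰ = ∑ k, (α k + 1/p - 1/q)/(l k) ≤ 1` and
`0 ≤ μ ≤ 1 - ϰ`, `(∏ k, t k ^ ((α k + 1/p - 1/q)/(l k))) ‖D^α u‖_{L^q}
≤ C_μ [h^μ (‖u‖_{L^p} + ∑ k, t k ‖∂ₖ^{l k} u‖_{L^p}) + h^(-(1-μ)) ‖u‖_{L^p}]`. -/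
theorem scalar_anisotropic_embedding (n : ℕ) (p q : ℝ) (hp : 1 < p) (hpq : p ≤ q)
    (l : Fin n → ℕ) (hl : ∀ k, 0 < l k) (α : Fin n → ℕ)
    (hϰ : (∑ k, ((α k : ℝ) + 1 / p - 1 / q) / (l k : ℝ)) ≤ 1) (μ : ℝ) (hμ0 : 0 ≤ μ)
    (hμ1 : μ ≤ 1 - ∑ k, ((α k : ℝ) + 1 / p - 1 / q) / (l k : ℝ)) :
    ∃ C : ℝ, 0 < C ∧ ∀ u : SchwartzMap (Fin n → ℝ) ℂ, ∀ h : ℝ, 0 < h →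
      ∀ t : Fin n → ℝ, (∀ k, 0 < t k) →
      (∏ k, t k ^ (((α k : ℝ) + 1 / p - 1 / q) / (l k : ℝ))) * LpN n q (fun x => Dmix n α u x)
      ≤ C * (h ^ μ * (LpN n p (fun x => u x) +
              ∑ k, t k * LpN n p (fun x => pdIter n k (l k) u x)) +
             h ^ (-(1 - μ)) * LpN n p (fun x => u x)) := by
  obtain ⟨C, hC0, hC⟩ := Anisotropic.exists_LpN_Dmix_scaled_le hp hpq l hl α hϰ
  refine ⟨C + 1, by linarith, fun u h hh t ht => ?_⟩
  set ϰ := ∑ k, ((α k : ℝ) + 1 / p - 1 / q) / (l k : ℝ)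
  set B := LpN n p (fun x => u x)
  set A := ∑ k, t k * LpN n p (fun x => pdIter n k (l k) u x)
  set X := (∏ k, t k ^ (((α k : ℝ) + 1 / p - 1 / q) / (l k : ℝ))) * LpN n q (fun x => Dmix n α u x)
  have hB : 0 ≤ B := Anisotropic.LpN_nonneg _ _
  have hA : 0 ≤ A := Finset.sum_nonneg fun k _ =>
    mul_nonneg (ht k).le (Anisotropic.LpN_nonneg _ _)
  have hX : ∀ τ : ℝ, 0 < τ → τ ^ ϰ * X ≤ C * (B + τ * A) := fun τ hτ => hC u τ hτ t ht
  suffices hmain : X ≤ C * (h ^ μ * (B + A) + h ^ (-(1 - μ)) * B) by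
    refine hmain.trans (mul_le_mul_of_nonneg_right (by linarith) (by positivity))
  rcases le_total h 1 with h1 | h1
  · have e : X = h ^ (-ϰ) * (h ^ ϰ * X) := by
      rw [← mul_assoc, ← Real.rpow_add hh, neg_add_cancel, Real.rpow_zero, one_mul]
    have e1 : h ^ (-ϰ) * h ≤ h ^ μ := by
      nth_rewrite 2 [← Real.rpow_one h]
      rw [← Real.rpow_add hh]
      exact Real.rpow_le_rpow_of_exponent_ge hh h1 (by linarith)
    have e2 : h ^ (-ϰ) ≤ h ^ (-(1 - μ)) :=
      Real.rpow_le_rpow_of_exponent_ge hh h1 (by linarith)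
    calc X ≤ h ^ (-ϰ) * (C * (B + h * A)) :=
          e.trans_le (mul_le_mul_of_nonneg_left (hX h hh) (by positivity))
      _ = C * (h ^ (-ϰ) * h * A + h ^ (-ϰ) * B) := by ring
      _ ≤ C * (h ^ μ * A + h ^ (-(1 - μ)) * B) := by gcongr
      _ ≤ _ := by
        gcongr
        linarith
  · have h2 := hX 1 one_pos
    rw [Real.one_rpow, one_mul, one_mul] at h2
    refine h2.trans (mul_le_mul_of_nonneg_left ?_ hC0)
    have h3 : 1 ≤ h ^ μ := Real.one_le_rpow h1 hμ0
    have h4 : 0 ≤ h ^ (-(1 - μ)) * B := by positivity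
    nlinarith [mul_le_mul_of_nonneg_right h3 (add_nonneg hB hA)]
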